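/- For every ε > 0 there exist constants c > 0 and C > 0 such that for all sufficiently large x, |M(x) - x^{(1/√e)·exp(-li_f(x)/x)}| ≤ C · x^{1/√e} · e^{-c(log x)^{3/5-ε}}. -/

import Mathlib

open Filter Real MeasureTheory
open scoped Classical

/-- The largest prime factor of `n`, with the convention `P 1 = 1`. -/
noncomputable def largestPrimeFactor (n : ℕ) : ℕ :=
  if n ≤ 1 then 1 else n.primeFactors.sup id

/-- `medianLPF x` is the median largest prime factor of the integers in `[1, x]`:
the `⌈N/2⌉`-th smallest element of the multiset `{P(n) : 1 ≤ n ≤ N}` where `N = ⌊x⌋`. -/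
noncomputable def medianLPF (x : ℝ) : ℕ :=
  (((Finset.Icc 1 ⌊x⌋₊).val.map largestPrimeFactor).sort (· ≤ ·)).getD
    ((⌊x⌋₊ + 1) / 2 - 1) 0

/-- `lif x = ∫₂^x {x/t}/log t dt`. -/
noncomputable def lif (x : ℝ) : ℝ := ∫ t in (2:ℝ)..x, Int.fract (x / t) / Real.log t

namespace VK

/-! ### Linnik's lemma -/

lemma zmod_isUnit_iff {p k : ℕ} (hp : p.Prime) (hk : 0 < k) (n : ℤ) :
    IsUnit (n : ZMod (p ^ k)) ↔ ¬ (p : ℤ) ∣ n := by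
  rw [ZMod.coe_int_isUnit_iff_isCoprime, Nat.cast_pow, IsCoprime.pow_left_iff hk]
  exact (Nat.prime_iff_prime_int.mp hp).coprime_iff_not_dvd

lemma zmod_local {p k : ℕ} (hp : p.Prime) (hk : 0 < k) : IsLocalRing (ZMod (p ^ k)) := by
  have : Fact (1 < p ^ k) := ⟨Nat.one_lt_pow hk.ne' hp.one_lt⟩
  have : Nontrivial (ZMod (p ^ k)) := ZMod.nontrivial _
  refine IsLocalRing.of_isUnit_or_isUnit_one_sub_self fun a => ?_
  obtain ⟨n, rfl⟩ := ZMod.intCast_surjective a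
  have : ((1 : ZMod (p ^ k)) - n) = ((1 - n : ℤ) : ZMod (p ^ k)) := by push_cast; ring
  rw [this, zmod_isUnit_iff hp hk, zmod_isUnit_iff hp hk]
  by_contra! h
  have h2 := dvd_add h.1 h.2
  rw [add_sub_cancel] at h2
  exact (Nat.prime_iff_prime_int.mp hp).not_isUnit (isUnit_of_dvd_one h2)

lemma esymm_eq {R : Type} [CommRing R] {k : ℕ} (z w : Fin k → R)
    (hu : ∀ m : ℕ, 1 ≤ m → m ≤ k → IsUnit (m : R))
    (h : ∀ j : ℕ, 1 ≤ j → j ≤ k → ∑ i, z i ^ j = ∑ i, w i ^ j) :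
    ∀ m ≤ k, MvPolynomial.aeval z (MvPolynomial.esymm (Fin k) R m)
      = MvPolynomial.aeval w (MvPolynomial.esymm (Fin k) R m) := by
  intro m
  induction m using Nat.strong_induction_on with
  | _ m ih =>
    intro hm
    rcases Nat.eq_zero_or_pos m with rfl | hm0
    · simp
    apply (hu m hm0 hm).mul_left_cancel
    have e : ∀ v : Fin k → R, (m : R) * MvPolynomial.aeval v (MvPolynomial.esymm (Fin k) R m) =
        MvPolynomial.aeval v ((m : MvPolynomial (Fin k) R) * MvPolynomial.esymm (Fin k) R m) := by
      intro v; simp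
    rw [e, e, MvPolynomial.mul_esymm_eq_sum]
    simp only [map_mul, map_sum, map_pow, map_neg, map_one]
    congr 1
    refine Finset.sum_congr rfl fun a ha => ?_
    rw [Finset.mem_filter, Finset.HasAntidiagonal.mem_antidiagonal] at ha
    rw [ih a.1 ha.2 (by omega)]
    congr 1
    simp only [MvPolynomial.psum, map_sum, map_pow, MvPolynomial.aeval_X]
    exact h _ (by omega) (by omega)

lemma perm_of_psum {R : Type} [CommRing R] [IsLocalRing R] {k : ℕ} (z w : Fin k → R)
    (hu : ∀ m : ℕ, 1 ≤ m → m ≤ k → IsUnit (m : R))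
    (hz : ∀ i j, i ≠ j → IsUnit (z i - z j)) (hw : Function.Injective w)
    (h : ∀ j : ℕ, 1 ≤ j → j ≤ k → ∑ i, z i ^ j = ∑ i, w i ^ j) :
    ∃ σ : Equiv.Perm (Fin k), w = fun i => z (σ i) := by
  have hp : ∀ x : R, ∏ i, (x - z i) = ∏ i, (x - w i) := by
    intro x
    have key : ∀ v : Fin k → R, ∏ i, (x - v i) = ∑ j ∈ Finset.range (k + 1),
        (-1) ^ j * (MvPolynomial.aeval v (MvPolynomial.esymm (Fin k) R j) * x ^ (k - j)) := by
      intro v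
      have := congrArg (Polynomial.eval x)
        (Multiset.prod_X_sub_X_eq_sum_esymm (Multiset.map v Finset.univ.val))
      simp only [Multiset.map_map, Polynomial.eval_finsetSum, Multiset.card_map,
        Polynomial.eval_mul, Polynomial.eval_pow, Polynomial.eval_neg, Polynomial.eval_one,
        Polynomial.eval_C, Polynomial.eval_X] at this
      rw [Polynomial.eval_multiset_prod, Multiset.map_map] at this
      simp only [MvPolynomial.aeval_esymm_eq_multiset_esymm]
      rw [Finset.prod_eq_multiset_prod]
      simpa only [Function.comp_def, Polynomial.eval_sub, Polynomial.eval_X, Polynomial.eval_C,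
        Finset.card_val, Finset.card_univ, Fintype.card_fin] using this
    rw [key, key]
    refine Finset.sum_congr rfl fun j hj => ?_
    rw [esymm_eq z w hu h j (by simpa [Nat.lt_succ_iff] using hj)]
  have hex : ∀ m, ∃ i, w m = z i := by
    intro m
    have h0 : ∏ i, (w m - z i) = 0 := by
      rw [hp]; exact Finset.prod_eq_zero (Finset.mem_univ m) (sub_self _)
    have : ∃ i, ¬ IsUnit (w m - z i) := by
      by_contra! hc
      have := (IsUnit.prod_univ_iff (f := fun i => w m - z i)).2 hc
      rw [h0] at this
      exact not_isUnit_zero this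
    obtain ⟨i, hi⟩ := this
    refine ⟨i, ?_⟩
    rw [← Finset.mul_prod_erase _ _ (Finset.mem_univ i)] at h0
    have hun : IsUnit (∏ l ∈ Finset.univ.erase i, (w m - z l)) := by
      refine (IsUnit.prod_iff).2 fun l hl => ?_
      by_contra hc
      have h1 := IsLocalRing.nonunits_add (a := w m - z l) (b := -(w m - z i)) hc
        (by rw [mem_nonunits_iff, IsUnit.neg_iff]; exact hi)
      have h2 : w m - z l + -(w m - z i) = z i - z l := by ring
      rw [h2] at h1
      exact h1 (hz i l (Finset.ne_of_mem_erase hl).symm)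
    have := (hun.mul_left_eq_zero).1 h0
    exact sub_eq_zero.1 this
  choose f hf using hex
  have hinj : Function.Injective f := by
    intro a b hab
    exact hw (by rw [hf a, hf b, hab])
  refine ⟨Equiv.ofBijective f (Finite.injective_iff_bijective.1 hinj), ?_⟩
  funext i; simpa using hf i

/-- Linnik's lemma. -/
lemma linnik {p k N : ℕ} (hp : p.Prime) (hk : 0 < k) (hkp : k < p) (hN : N ≤ p ^ k) (b : ℤ)
    (h : Fin k → ℤ) :
    ((Fintype.piFinset fun _ : Fin k => Finset.Icc (1 : ℤ) N).filter fun x =>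
      (∀ i j, i ≠ j → ¬ (p : ℤ) ∣ x i - x j) ∧
      ∀ j : Fin k, (p : ℤ) ^ (j.1 + 1) ∣ ∑ i, (x i - b) ^ (j.1 + 1) - h j).card
      ≤ k.factorial * p ^ (k * (k - 1) / 2) := by
  set S := ((Fintype.piFinset fun _ : Fin k => Finset.Icc (1 : ℤ) N).filter fun x =>
      (∀ i j, i ≠ j → ¬ (p : ℤ) ∣ x i - x j) ∧
      ∀ j : Fin k, (p : ℤ) ^ (j.1 + 1) ∣ ∑ i, (x i - b) ^ (j.1 + 1) - h j) with hS
  have := zmod_local hp hk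
  let q : (Fin k → ℤ) → (Fin k → ZMod (p ^ k)) := fun x i => ((x i - b : ℤ) : ZMod (p ^ k))
  let F : (Fin k → ℤ) → (Fin k → ZMod (p ^ k)) := fun x j => ∑ i, q x i ^ (j.1 + 1)
  have hqinj : ∀ x ∈ S, ∀ y ∈ S, q x = q y → x = y := by
    intro x hx y hy hxy
    funext i
    have hxi := Finset.mem_Icc.1 (Fintype.mem_piFinset.1 (Finset.mem_filter.1 hx).1 i)
    have hyi := Finset.mem_Icc.1 (Fintype.mem_piFinset.1 (Finset.mem_filter.1 hy).1 i)
    have := congrFun hxy i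
    simp only [q] at this
    rw [ZMod.intCast_eq_intCast_iff_dvd_sub] at this
    have h3 : ((p ^ k : ℕ) : ℤ) ∣ y i - x i := by convert this using 1; ring
    have hN' : (N : ℤ) ≤ ((p ^ k : ℕ) : ℤ) := by exact_mod_cast hN
    have := Int.eq_zero_of_abs_lt_dvd h3 (by rw [abs_lt]; constructor <;> linarith)
    linarith
  have h1 : S.card ≤ k.factorial * (S.image F).card := by
    refine Finset.card_le_mul_card_image S _ fun v hv => ?_
    obtain ⟨x0, hx0, rfl⟩ := Finset.mem_image.1 hv
    have : ((S.filter fun a => F a = F x0).image q).card ≤ k.factorial := by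
      have hsub : (S.filter fun a => F a = F x0).image q ⊆
          (Finset.univ : Finset (Equiv.Perm (Fin k))).image fun σ => fun i => q x0 (σ i) := by
        intro w hw
        obtain ⟨x, hx, rfl⟩ := Finset.mem_image.1 hw
        obtain ⟨hxS, hxF⟩ := Finset.mem_filter.1 hx
        have hdu : ∀ x ∈ S, ∀ i j, i ≠ j → IsUnit (q x i - q x j) := by
          intro x hx i j hij
          have : q x i - q x j = ((x i - x j : ℤ) : ZMod (p ^ k)) := by
            simp only [q]; push_cast; ring
          rw [this, zmod_isUnit_iff hp hk]
          exact (Finset.mem_filter.1 hx).2.1 i j hij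
        obtain ⟨σ, hσ⟩ := perm_of_psum (q x0) (q x) (by
            intro m hm1 hm2
            have := (zmod_isUnit_iff hp hk (m : ℤ)).2 (by
              intro hd
              have := Int.le_of_dvd (by exact_mod_cast hm1) hd
              have : p ≤ m := by exact_mod_cast this
              omega)
            simpa using this) (hdu x0 hx0) (by
            intro i j hij
            by_contra hne
            have := hdu x hxS i j hne
            rw [hij, sub_self] at this
            exact not_isUnit_zero this) (by
            intro j hj1 hj2
            have := congrFun hxF ⟨j - 1, by omega⟩
            simp only [F, Nat.sub_add_cancel hj1] at this
            exact this.symm)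
        exact Finset.mem_image.2 ⟨σ, Finset.mem_univ _, hσ.symm⟩
      calc _ ≤ _ := Finset.card_le_card hsub
        _ ≤ _ := Finset.card_image_le
        _ = _ := by rw [Finset.card_univ, Fintype.card_perm, Fintype.card_fin]
    rwa [Finset.card_image_of_injOn] at this
    intro x hx y hy
    exact hqinj x (Finset.mem_filter.1 hx).1 y (Finset.mem_filter.1 hy).1
  refine h1.trans (Nat.mul_le_mul_left _ ?_)
  have hsub : S.image F ⊆ Fintype.piFinset fun j : Fin k =>
      (Finset.range (p ^ (k - (j.1 + 1)))).image fun c : ℕ =>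
        ((h j : ZMod (p ^ k)) + (p : ZMod (p ^ k)) ^ (j.1 + 1) * (c : ZMod (p ^ k))) := by
    intro v hv
    obtain ⟨x, hx, rfl⟩ := Finset.mem_image.1 hv
    refine Fintype.mem_piFinset.2 fun j => ?_
    obtain ⟨d, hd⟩ := (Finset.mem_filter.1 hx).2.2 j
    have hpos : (0 : ℤ) < ((p ^ (k - (j.1 + 1)) : ℕ) : ℤ) := by
      exact_mod_cast pow_pos hp.pos _
    refine Finset.mem_image.2 ⟨(d % ((p ^ (k - (j.1 + 1)) : ℕ) : ℤ)).toNat, ?_, ?_⟩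
    · rw [Finset.mem_range, ← Int.ofNat_lt, Int.toNat_of_nonneg (Int.emod_nonneg _ hpos.ne')]
      exact Int.emod_lt_of_pos _ hpos
    · have e1 : (((d % ((p ^ (k - (j.1 + 1)) : ℕ) : ℤ)).toNat : ℕ) : ZMod (p ^ k))
          = ((d % ((p ^ (k - (j.1 + 1)) : ℕ) : ℤ) : ℤ) : ZMod (p ^ k)) := by
        rw [← Int.cast_natCast, Int.toNat_of_nonneg (Int.emod_nonneg _ hpos.ne')]
      have e2 : F x j = ((∑ i, (x i - b) ^ (j.1 + 1) : ℤ) : ZMod (p ^ k)) := by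
        simp only [F, q]; push_cast; rfl
      rw [e1, e2, sub_eq_iff_eq_add.1 hd]
      have e3 : ((h j : ZMod (p ^ k)) + (p : ZMod (p ^ k)) ^ (j.1 + 1) *
          ((d % ((p ^ (k - (j.1 + 1)) : ℕ) : ℤ) : ℤ) : ZMod (p ^ k))) =
          ((h j + (p : ℤ) ^ (j.1 + 1) * (d % ((p ^ (k - (j.1 + 1)) : ℕ) : ℤ)) : ℤ) :
            ZMod (p ^ k)) := by push_cast; rfl
      rw [e3, ZMod.intCast_eq_intCast_iff_dvd_sub]
      refine ⟨d / ((p ^ (k - (j.1 + 1)) : ℕ) : ℤ), ?_⟩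
      have e4 := Int.mul_ediv_add_emod d ((p ^ (k - (j.1 + 1)) : ℕ) : ℤ)
      have e5 : ((p ^ k : ℕ) : ℤ) = (p : ℤ) ^ (j.1 + 1) * ((p ^ (k - (j.1 + 1)) : ℕ) : ℤ) := by
        rw [Nat.cast_pow, Nat.cast_pow, ← pow_add]; congr 1; omega
      rw [e5]
      linear_combination (-(p : ℤ) ^ (j.1 + 1)) * e4
  calc _ ≤ _ := Finset.card_le_card hsub
    _ ≤ ∏ j : Fin k, p ^ (k - (j.1 + 1)) := by
      rw [Fintype.card_piFinset]
      exact Finset.prod_le_prod' fun j _ => Finset.card_image_le.trans (by simp)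
    _ = p ^ (k * (k - 1) / 2) := by
      rw [Finset.prod_pow_eq_pow_sum, ← Finset.sum_range_id, Fin.sum_univ_eq_sum_range
        (fun j => k - (j + 1)), ← Finset.sum_range_reflect (fun j => j)]
      congr 1
      exact Finset.sum_congr rfl fun j _ => by omega

end VK

namespace VK

/-! ### Energies and character sums -/

/-- number of coincidences -/
noncomputable def En {k : ℕ} {τ : Type} (X : Finset τ) (φ : τ → Fin k → ℤ) : ℕ :=
  ((X ×ˢ X).filter fun z => φ z.1 = φ z.2).card

lemma char_energy {k Q : ℕ} [NeZero Q] {τ : Type} (X : Finset τ) (g : τ → Fin k → ZMod Q) :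
    ∑ ψ : AddChar (Fin k → ZMod Q) ℂ, ‖∑ x ∈ X, ψ (g x)‖ ^ 2 =
      Fintype.card (Fin k → ZMod Q) * (((X ×ˢ X).filter fun z => g z.1 = g z.2).card : ℝ) := by
  have h1 : ∀ ψ : AddChar (Fin k → ZMod Q) ℂ, ((‖∑ x ∈ X, ψ (g x)‖ ^ 2 : ℝ) : ℂ) =
      ∑ z ∈ X ×ˢ X, ψ (g z.1 - g z.2) := by
    intro ψ
    rw [Complex.ofReal_pow, ← Complex.mul_conj', map_sum, Finset.sum_mul_sum, Finset.sum_product]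
    refine Finset.sum_congr rfl fun x _ => Finset.sum_congr rfl fun y _ => ?_
    rw [sub_eq_add_neg, AddChar.map_add_eq_mul, AddChar.map_neg_eq_conj]
  apply Complex.ofReal_injective
  rw [Complex.ofReal_sum, Finset.sum_congr rfl fun ψ _ => h1 ψ, Finset.sum_comm]
  simp only [AddChar.sum_apply_eq_ite, sub_eq_zero]
  rw [← Finset.sum_filter, Finset.sum_const, nsmul_eq_mul]
  push_cast
  ring

lemma En_le {k : ℕ} {τ τ' ι : Type} (X : Finset τ) (φ : τ → Fin k → ℤ) (I : Finset ι)
    (Y : ι → Finset τ') (φ' : τ' → Fin k → ℤ) (c : ℝ)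
    (h : ∀ ψ : AddChar (Fin k → ℤ) ℂ, (∀ v, ‖ψ v‖ = 1) →
      ‖∑ x ∈ X, ψ (φ x)‖ ^ 2 ≤ c * ∑ i ∈ I, ‖∑ y ∈ Y i, ψ (φ' y)‖ ^ 2) :
    (En X φ : ℝ) ≤ c * ∑ i ∈ I, (En (Y i) φ' : ℝ) := by
  let U := (I.sigma fun i => Y i ×ˢ Y i) ×ˢ (Finset.univ : Finset (Fin k))
  let G : ((_ : ι) × τ' × τ') × Fin k → ℕ := fun u => (φ' u.1.2.1 u.2 - φ' u.1.2.2 u.2).natAbs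
  set Q := U.sup G + 1 with hQ
  have : NeZero Q := ⟨by omega⟩
  let r : (Fin k → ℤ) →+ (Fin k → ZMod Q) := (Int.castAddHom (ZMod Q)).compLeft (Fin k)
  have hr : ∀ v w, r v = r w ↔ ∀ j, (Q : ℤ) ∣ w j - v j := by
    intro v w
    rw [funext_iff]
    refine forall_congr' fun j => ?_
    exact ZMod.intCast_eq_intCast_iff_dvd_sub (v j) (w j) Q
  have hsum := Finset.sum_le_sum fun (ψ : AddChar (Fin k → ZMod Q) ℂ) (_ : ψ ∈ Finset.univ) =>
    h (ψ.compAddMonoidHom r) (fun v => by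
      rw [AddChar.compAddMonoidHom_apply]; exact AddChar.norm_apply _ _)
  rw [← Finset.mul_sum, Finset.sum_comm] at hsum
  simp only [AddChar.compAddMonoidHom_apply] at hsum
  rw [char_energy X (fun x => r (φ x))] at hsum
  rw [Finset.sum_congr rfl fun i _ => char_energy (Y i) (fun x => r (φ' x)), ← Finset.mul_sum]
    at hsum
  have hpos : (0 : ℝ) < Fintype.card (Fin k → ZMod Q) := by exact_mod_cast Fintype.card_pos
  have e1 : ∀ i ∈ I, (((Y i ×ˢ Y i).filter fun z => r (φ' z.1) = r (φ' z.2)).card : ℝ)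
      = En (Y i) φ' := by
    intro i hi
    rw [En]
    congr 2
    refine Finset.filter_congr fun z hz => ⟨fun hz' => ?_, fun h => by rw [h]⟩
    funext j
    have hd := (hr _ _).1 hz' j
    have hlt : G (⟨i, z⟩, j) ≤ U.sup G := Finset.le_sup (f := G) (Finset.mem_product.2
      ⟨Finset.mem_sigma.2 ⟨hi, hz⟩, Finset.mem_univ _⟩)
    have : φ' z.2 j - φ' z.1 j = 0 := by
      refine Int.eq_zero_of_abs_lt_dvd hd ?_
      rw [abs_sub_comm, Int.abs_eq_natAbs]
      simp only [G] at hlt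
      exact_mod_cast Nat.lt_succ_of_le hlt
    linarith
  rw [Finset.sum_congr rfl e1] at hsum
  have e2 : (En X φ : ℝ) ≤ ((X ×ˢ X).filter fun z => r (φ z.1) = r (φ z.2)).card := by
    rw [En]
    exact_mod_cast Finset.card_le_card (Finset.monotone_filter_right _ fun z _ hz => by
      exact congrArg r hz)
  refine e2.trans ?_
  refine le_of_mul_le_mul_left (hsum.trans (le_of_eq ?_)) hpos
  ring

/-- shifted coincidences are at most the unshifted ones -/
lemma shift_le {k : ℕ} {τ : Type} (X : Finset τ) (φ : τ → Fin k → ℤ) (h : Fin k → ℤ) :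
    ((X ×ˢ X).filter fun z => φ z.1 = φ z.2 + h).card ≤ En X φ := by
  let R : (Fin k → ℤ) → ℕ := fun v => (X.filter fun x => φ x = v).card
  let V := X.image φ ∪ (X.image fun x => φ x + h)
  have key : ∀ g : Fin k → ℤ, (∀ x ∈ X, φ x + g ∈ V) →
      ((X ×ˢ X).filter fun z => φ z.1 = φ z.2 + g).card = ∑ v ∈ V, R v * R (v - g) := by
    intro g hg
    rw [Finset.card_eq_sum_card_fiberwise (f := fun z => φ z.2 + g) (t := V)]
    · refine Finset.sum_congr rfl fun v _ => ?_
      rw [← Finset.card_product]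
      congr 1
      ext z
      simp only [Finset.mem_filter, Finset.mem_product]
      constructor
      · rintro ⟨⟨⟨h1, h2⟩, h3⟩, h4⟩
        exact ⟨⟨h1, h3.trans h4⟩, h2, by rw [← h4]; simp⟩
      · rintro ⟨⟨h1, h2⟩, h3, h4⟩
        have : φ z.2 + g = v := by rw [h4]; simp
        exact ⟨⟨⟨h1, h3⟩, h2.trans this.symm⟩, this⟩
    · intro z hz
      simp only [Finset.coe_filter, Finset.mem_product, Set.mem_setOf_eq] at hz
      exact hg _ hz.1.2
  have h0 := key 0 (fun x hx => by
    rw [add_zero]; exact Finset.mem_union_left _ (Finset.mem_image_of_mem _ hx))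
  have h1 := key h (fun x hx => Finset.mem_union_right _
    (Finset.mem_image_of_mem (fun x => φ x + h) hx))
  simp only [add_zero, sub_zero] at h0
  rw [En, h0, h1]
  have h2 : ∑ v ∈ V, R (v - h) * R (v - h) ≤ ∑ v ∈ V, R v * R v := by
    have e : ∑ v ∈ V, R (v - h) * R (v - h) = ∑ v ∈ V.image (fun v => v - h), R v * R v := by
      rw [Finset.sum_image]
      intro a _ b _ hab
      simpa using hab
    rw [e, ← Finset.sum_filter_ne_zero]
    refine Finset.sum_le_sum_of_subset fun v hv => ?_
    have : R v ≠ 0 := fun h0 => (Finset.mem_filter.1 hv).2 (by rw [h0, zero_mul])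
    obtain ⟨x, hx⟩ := Finset.card_pos.1 (Nat.pos_of_ne_zero this)
    obtain ⟨hx1, hx2⟩ := Finset.mem_filter.1 hx
    rw [← hx2]
    exact Finset.mem_union_left _ (Finset.mem_image_of_mem _ hx1)
  have h3 : 2 * ∑ v ∈ V, R v * R (v - h) ≤ ∑ v ∈ V, R v * R v + ∑ v ∈ V, R (v - h) * R (v - h) := by
    rw [Finset.mul_sum, ← Finset.sum_add_distrib]
    refine Finset.sum_le_sum fun v _ => ?_
    have := two_mul_le_add_sq (R v : ℤ) (R (v - h))
    zify
    linarith
  omega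

end VK

namespace VK

/-! ### The recursion for Vinogradov's mean value -/

noncomputable def mom (k : ℕ) (x : ℤ) : Fin k → ℤ := fun j => x ^ (j.1 + 1)

noncomputable def ms (k : ℕ) {ι : Type} [Fintype ι] (x : ι → ℤ) : Fin k → ℤ :=
  ∑ i, mom k (x i)

lemma ms_apply (k : ℕ) {ι : Type} [Fintype ι] (x : ι → ℤ) (j : Fin k) :
    ms k x j = ∑ i, x i ^ (j.1 + 1) := by simp [ms, mom]

/-- Vinogradov's mean value -/
noncomputable def J (k s N : ℕ) : ℕ :=
  En (Fintype.piFinset fun _ : Fin s => Finset.Icc (1 : ℤ) N) (ms k)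

lemma char_fsum {ι A : Type} [AddCommGroup A] (ψ : AddChar A ℂ) (I : Finset ι) (f : ι → A) :
    ψ (∑ i ∈ I, f i) = ∏ i ∈ I, ψ (f i) := by
  induction I using Finset.induction_on with
  | empty => simp
  | insert a s ha ih => rw [Finset.sum_insert ha, Finset.prod_insert ha, AddChar.map_add_eq_mul, ih]

lemma char_pi {k : ℕ} {ι : Type} [Fintype ι] [DecidableEq ι] (S : ι → Finset ℤ) (ψ : AddChar (Fin k → ℤ) ℂ) :
    ∑ x ∈ Fintype.piFinset S, ψ (ms k x) = ∏ i, ∑ a ∈ S i, ψ (mom k a) := by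
  rw [Finset.prod_univ_sum]
  refine Finset.sum_congr rfl fun x _ => ?_
  rw [ms, char_fsum]

lemma En_map {k k' : ℕ} {τ τ' : Type} {X : Finset τ} {Y : Finset τ'} {φ : τ → Fin k → ℤ}
    {φ' : τ' → Fin k' → ℤ} (f : τ → τ') (hf : ∀ x ∈ X, f x ∈ Y)
    (hinj : ∀ x ∈ X, ∀ y ∈ X, f x = f y → x = y)
    (h : ∀ x ∈ X, ∀ y ∈ X, φ x = φ y → φ' (f x) = φ' (f y)) : En X φ ≤ En Y φ' := by
  refine Finset.card_le_card_of_injOn (fun z => (f z.1, f z.2)) ?_ ?_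
  · intro z hz
    simp only [Finset.coe_filter, Finset.mem_product, Set.mem_setOf_eq] at hz ⊢
    exact ⟨⟨hf _ hz.1.1, hf _ hz.1.2⟩, h _ hz.1.1 _ hz.1.2 hz.2⟩
  · intro z hz w hw hzw
    simp only [Finset.coe_filter, Finset.mem_product, Set.mem_setOf_eq] at hz hw
    simp only [Prod.mk.injEq] at hzw
    exact Prod.ext (hinj _ hz.1.1 _ hw.1.1 hzw.1) (hinj _ hz.1.2 _ hw.1.2 hzw.2)

lemma En_mono {k : ℕ} {τ : Type} {X Y : Finset τ} {φ : τ → Fin k → ℤ} (h : X ⊆ Y) :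
    En X φ ≤ En Y φ := En_map id (fun _ hx => h hx) (fun _ _ _ _ h => h) (fun _ _ _ _ h => h)

lemma norm_sum_sq_le {ι : Type} (I : Finset ι) (f : ι → ℂ) :
    ‖∑ i ∈ I, f i‖ ^ 2 ≤ I.card * ∑ i ∈ I, ‖f i‖ ^ 2 :=
  (pow_le_pow_left₀ (norm_nonneg _) (norm_sum_le _ _) 2).trans sq_sum_le_card_mul_sum_sq

lemma En_union {k : ℕ} {τ ι : Type} (X : Finset τ) (φ : τ → Fin k → ℤ) (I : Finset ι)
    (Y : ι → Finset τ) (h : ∀ x ∈ X, ∃ i ∈ I, x ∈ Y i) :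
    (En X φ : ℝ) ≤ I.card * ∑ i ∈ I, (En (Y i) φ : ℝ) := by
  rcases X.eq_empty_or_nonempty with rfl | ⟨x0, hx0⟩
  · simp only [En]; simp; positivity
  obtain ⟨i0, -⟩ := h x0 hx0
  have : Inhabited ι := ⟨i0⟩
  let f : τ → ι := fun x => if hx : x ∈ X then (h x hx).choose else default
  have hf : ∀ x ∈ X, f x ∈ I ∧ x ∈ Y (f x) := by
    intro x hx
    simp only [f, dif_pos hx]
    exact (h x hx).choose_spec
  refine (En_le X φ I (fun i => X.filter fun x => f x = i) φ I.card fun ψ _ => ?_).trans ?_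
  · rw [← Finset.sum_fiberwise_of_maps_to (fun x hx => (hf x hx).1)]
    exact norm_sum_sq_le _ _
  · refine mul_le_mul_of_nonneg_left (Finset.sum_le_sum fun i _ => ?_) (by positivity)
    exact_mod_cast En_mono fun x hx => by
      obtain ⟨h1, h2⟩ := Finset.mem_filter.1 hx
      rw [← h2]; exact (hf x h1).2

lemma shift_pow {ι : Type} [Fintype ι] {k : ℕ} (x y : ι → ℤ)
    (h : ∀ j, 1 ≤ j → j ≤ k → ∑ i, x i ^ j = ∑ i, y i ^ j) (b : ℤ) :
    ∀ j ≤ k, ∑ i, (x i - b) ^ j = ∑ i, (y i - b) ^ j := by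
  intro j hj
  simp only [sub_eq_add_neg, add_pow]
  rw [Finset.sum_comm, Finset.sum_comm (s := Finset.univ)]
  refine Finset.sum_congr rfl fun m hm => ?_
  rw [← Finset.sum_mul, ← Finset.sum_mul, ← Finset.sum_mul, ← Finset.sum_mul]
  congr 2
  rcases Nat.eq_zero_or_pos m with rfl | hm0
  · simp
  · exact h m hm0 (by rw [Finset.mem_range] at hm; omega)

/-- residue class in `[1,N]` -/
noncomputable def cls (p N : ℕ) (a : ZMod p) : Finset ℤ :=
  (Finset.Icc (1 : ℤ) N).filter fun x => (x : ZMod p) = a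

noncomputable def star (p k N : ℕ) : Finset (Fin k → ℤ) :=
  (Fintype.piFinset fun _ : Fin k => Finset.Icc (1 : ℤ) N).filter fun x =>
    ∀ i j, i ≠ j → ¬ (p : ℤ) ∣ x i - x j

lemma cls_spec {p N : ℕ} (hp : 0 < p) (a : ZMod p) : ∃ b : ℤ, ∀ x ∈ cls p N a,
    x - b = p * (x / p + 1) ∧ x / p + 1 ∈ Finset.Icc (1 : ℤ) (N / p + 1 : ℕ) := by
  have : NeZero p := ⟨hp.ne'⟩
  have hp' : (0 : ℤ) < p := by exact_mod_cast hp
  refine ⟨a.val - p, fun x hx => ?_⟩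
  obtain ⟨h1, h2⟩ := Finset.mem_filter.1 hx
  rw [Finset.mem_Icc] at h1
  have h3 : x % p = a.val := by
    rw [← h2, ZMod.val_intCast]
  have h4 := Int.mul_ediv_add_emod x p
  refine ⟨by rw [h3] at h4; linear_combination -h4, ?_⟩
  rw [Finset.mem_Icc]
  constructor
  · have := Int.ediv_nonneg (by linarith : 0 ≤ x) hp'.le
    linarith
  · push_cast
    have := Int.ediv_le_ediv hp' h1.2
    linarith

lemma En_cls_star {p k s N : ℕ} (hp : p.Prime) (hk : 0 < k) (hkp : k < p) (hN : N ≤ p ^ k)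
    (a : ZMod p) :
    En (star p k N ×ˢ Fintype.piFinset fun _ : Fin s => cls p N a)
      (fun z => ms k z.1 + ms k z.2) ≤
      J k s (N / p + 1) * (N ^ k * (k.factorial * p ^ (k * (k - 1) / 2))) := by
  obtain ⟨b, hb⟩ := cls_spec (N := N) hp.pos a
  have hp0 : (p : ℤ) ≠ 0 := by exact_mod_cast hp.ne_zero
  have key : ∀ (x y : Fin k → ℤ) (u w : Fin s → ℤ), (∀ i, u i ∈ cls p N a) →
      (∀ i, w i ∈ cls p N a) → ms k x + ms k u = ms k y + ms k w → ∀ j : Fin k,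
      ∑ i, (x i - b) ^ (j.1 + 1) + p ^ (j.1 + 1) * ms k (fun i => u i / p + 1) j =
      ∑ i, (y i - b) ^ (j.1 + 1) + p ^ (j.1 + 1) * ms k (fun i => w i / p + 1) j := by
    intro x y u w hu hw h j
    have := shift_pow (k := k) (Sum.elim x u) (Sum.elim y w) (by
      intro j hj1 hj2
      have := congrFun h ⟨j - 1, by omega⟩
      simp only [Pi.add_apply, ms_apply, Nat.sub_add_cancel hj1] at this
      simpa [Fintype.sum_sum_type] using this) b (j.1 + 1) (by omega)
    simp only [Fintype.sum_sum_type, Sum.elim_inl, Sum.elim_inr] at this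
    have e1 : ∀ i, (p : ℤ) * (u i / p + 1) = u i - b := fun i => (hb _ (hu i)).1.symm
    have e2 : ∀ i, (p : ℤ) * (w i / p + 1) = w i - b := fun i => (hb _ (hw i)).1.symm
    simp only [ms_apply, Finset.mul_sum, ← mul_pow, e1, e2]
    exact this
  let f : ((Fin k → ℤ) × (Fin s → ℤ)) × ((Fin k → ℤ) × (Fin s → ℤ)) →
      (Fin k → ℤ) × (Fin k → ℤ) := fun z => (z.1.1, z.2.1)
  have hmem : ∀ z : (Fin k → ℤ) × (Fin s → ℤ),
      z ∈ (star p k N ×ˢ Fintype.piFinset fun _ : Fin s => cls p N a) ↔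
      z.1 ∈ star p k N ∧ ∀ i, z.2 i ∈ cls p N a := by
    intro z; rw [Finset.mem_product, Fintype.mem_piFinset]
  rw [En]
  refine (Finset.card_le_mul_card_image (f := f) _ (J k s (N / p + 1)) fun v _ => ?_).trans
    (Nat.mul_le_mul_left _ ?_)
  · by_cases hex : ∃ h : Fin k → ℤ, ∀ j : Fin k, ∑ i, (v.2 i - b) ^ (j.1 + 1) -
        ∑ i, (v.1 i - b) ^ (j.1 + 1) = p ^ (j.1 + 1) * h j
    · obtain ⟨h, hh⟩ := hex
      refine le_trans ?_ (shift_le (Fintype.piFinset fun _ : Fin s =>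
        Finset.Icc (1 : ℤ) (N / p + 1 : ℕ)) (ms k) h)
      refine Finset.card_le_card_of_injOn
        (fun z => ((fun i => z.1.2 i / p + 1), (fun i => z.2.2 i / p + 1))) ?_ ?_
      · intro z hz
        simp only [Finset.coe_filter, Finset.mem_product, Set.mem_setOf_eq, Finset.mem_filter,
          hmem, Fintype.mem_piFinset] at hz ⊢
        obtain ⟨⟨⟨⟨h1, h2⟩, h3, h4⟩, h5⟩, h6⟩ := hz
        refine ⟨⟨fun i => (hb _ (h2 i)).2, fun i => (hb _ (h4 i)).2⟩, ?_⟩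
        funext j
        have := key _ _ _ _ h2 h4 h5 j
        have h7 := hh j
        rw [← h6] at h7
        have hpj : (p : ℤ) ^ (j.1 + 1) ≠ 0 := pow_ne_zero _ hp0
        apply mul_left_cancel₀ hpj
        rw [Pi.add_apply, mul_add]
        simp only [f] at h7
        linarith
      · intro z hz w hw hzw
        simp only [Finset.coe_filter, Set.mem_setOf_eq, Finset.mem_filter,
          Finset.mem_product, hmem] at hz hw
        obtain ⟨⟨⟨⟨-, h2⟩, -, h4⟩, -⟩, h6⟩ := hz
        obtain ⟨⟨⟨⟨-, h2'⟩, -, h4'⟩, -⟩, h6'⟩ := hw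
        simp only [Prod.mk.injEq] at hzw
        have h7 := h6.trans h6'.symm
        simp only [f, Prod.mk.injEq] at h7
        have hcan : ∀ x ∈ cls p N a, ∀ y ∈ cls p N a, x / p + 1 = y / p + 1 → x = y := by
          intro x hx y hy hxy
          have e1 := (hb x hx).1
          have e2 := (hb y hy).1
          rw [hxy, ← e2] at e1
          linarith
        refine Prod.ext (Prod.ext h7.1 ?_) (Prod.ext h7.2 ?_)
        · funext i; exact hcan _ (h2 i) _ (h2' i) (congrFun hzw.1 i)
        · funext i; exact hcan _ (h4 i) _ (h4' i) (congrFun hzw.2 i)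
    · have : (Finset.filter (fun z => f z = v) (Finset.filter
          (fun z => (fun z : (Fin k → ℤ) × (Fin s → ℤ) => ms k z.1 + ms k z.2) z.1 =
            (fun z : (Fin k → ℤ) × (Fin s → ℤ) => ms k z.1 + ms k z.2) z.2)
          ((star p k N ×ˢ Fintype.piFinset fun _ : Fin s => cls p N a) ×ˢ
          (star p k N ×ˢ Fintype.piFinset fun _ : Fin s => cls p N a)))) = ∅ := by
        rw [Finset.filter_eq_empty_iff]
        intro z hz hzv
        simp only [Finset.mem_filter, Finset.mem_product, Fintype.mem_piFinset] at hz
        obtain ⟨⟨⟨h1, h2⟩, h3, h4⟩, h5⟩ := hz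
        refine hex ⟨fun j => ms k (fun i => z.1.2 i / p + 1) j -
          ms k (fun i => z.2.2 i / p + 1) j, fun j => ?_⟩
        have := key _ _ _ _ h2 h4 h5 j
        rw [← hzv]; simp only [f]
        linarith
      rw [this]; simp
  · have hsub : Finset.image f (Finset.filter
          (fun z => (fun z : (Fin k → ℤ) × (Fin s → ℤ) => ms k z.1 + ms k z.2) z.1 =
            (fun z : (Fin k → ℤ) × (Fin s → ℤ) => ms k z.1 + ms k z.2) z.2)
          ((star p k N ×ˢ Fintype.piFinset fun _ : Fin s => cls p N a) ×ˢ
          (star p k N ×ˢ Fintype.piFinset fun _ : Fin s => cls p N a))) ⊆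
        (Fintype.piFinset fun _ : Fin k => Finset.Icc (1 : ℤ) N).biUnion fun y =>
        (((Fintype.piFinset fun _ : Fin k => Finset.Icc (1 : ℤ) N).filter fun x =>
          (∀ i j, i ≠ j → ¬ (p : ℤ) ∣ x i - x j) ∧ ∀ j : Fin k, (p : ℤ) ^ (j.1 + 1) ∣
          ∑ i, (x i - b) ^ (j.1 + 1) - ∑ i, (y i - b) ^ (j.1 + 1))).image fun x => (x, y) := by
      intro v hv
      obtain ⟨z, hz, rfl⟩ := Finset.mem_image.1 hv
      simp only [Finset.mem_filter, Finset.mem_product, Fintype.mem_piFinset, star] at hz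
      obtain ⟨⟨⟨h1, h2⟩, h3, h4⟩, h5⟩ := hz
      refine Finset.mem_biUnion.2 ⟨z.2.1, Fintype.mem_piFinset.2 h3.1, Finset.mem_image.2
        ⟨z.1.1, Finset.mem_filter.2 ⟨Fintype.mem_piFinset.2 h1.1, h1.2, fun j => ?_⟩, rfl⟩⟩
      refine ⟨ms k (fun i => z.2.2 i / p + 1) j - ms k (fun i => z.1.2 i / p + 1) j, ?_⟩
      have := key _ _ _ _ h2 h4 h5 j
      linarith
    refine (Finset.card_le_card hsub).trans ((Finset.card_biUnion_le_card_mul _ _ _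
      fun y _ => Finset.card_image_le.trans (linnik hp hk hkp hN b _)).trans (le_of_eq ?_))
    simp [Fintype.card_piFinset]

end VK

namespace VK

lemma cls_sum {p N : ℕ} [NeZero p] {E : Type} [AddCommMonoid E] (f : ℤ → E) :
    ∑ x ∈ Finset.Icc (1 : ℤ) N, f x = ∑ a : ZMod p, ∑ x ∈ cls p N a, f x := by
  simp only [cls]
  rw [Finset.sum_fiberwise]

lemma En_star_le {p k s N : ℕ} (hp : p.Prime) (hk : 0 < k) (hs : 0 < s) (hkp : k < p)
    (hN : N ≤ p ^ k) :
    (En (star p k N ×ˢ Fintype.piFinset fun _ : Fin s => Finset.Icc (1 : ℤ) N)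
      (fun z => ms k z.1 + ms k z.2) : ℝ) ≤
      p ^ (2 * s) * (J k s (N / p + 1) * (N ^ k * (k.factorial * p ^ (k * (k - 1) / 2)))) := by
  have : NeZero p := ⟨hp.ne_zero⟩
  have hprod : ∀ (S : Finset ℤ) (ψ : AddChar (Fin k → ℤ) ℂ),
      ∑ z ∈ star p k N ×ˢ Fintype.piFinset (fun _ : Fin s => S), ψ (ms k z.1 + ms k z.2) =
      (∑ x ∈ star p k N, ψ (ms k x)) * (∑ a ∈ S, ψ (mom k a)) ^ s := by
    intro S ψ
    have : (∑ a ∈ S, ψ (mom k a)) ^ s =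
        ∑ x ∈ Fintype.piFinset (fun _ : Fin s => S), ψ (ms k x) := by
      rw [char_pi]; simp
    rw [this, Finset.sum_mul_sum, Finset.sum_product]
    simp only [AddChar.map_add_eq_mul]
  have h1 := En_le (star p k N ×ˢ Fintype.piFinset fun _ : Fin s => Finset.Icc (1 : ℤ) N)
    (fun z => ms k z.1 + ms k z.2) (Finset.univ : Finset (ZMod p))
    (fun a => star p k N ×ˢ Fintype.piFinset fun _ : Fin s => cls p N a)
    (fun z => ms k z.1 + ms k z.2) ((p : ℝ) ^ (2 * s - 1)) (by
      intro ψ _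
      simp only [hprod, norm_mul, norm_pow, mul_pow]
      rw [← Finset.mul_sum, mul_left_comm]
      refine mul_le_mul_of_nonneg_left ?_ (by positivity)
      simp only [← pow_mul]
      rw [cls_sum (p := p)]
      have h2 := pow_sum_div_card_le_sum_pow (n := 2 * s - 1) (s := (Finset.univ : Finset (ZMod p)))
        (f := fun a => ‖∑ x ∈ cls p N a, ψ (mom k x)‖) (fun _ _ => norm_nonneg _)
      rw [Nat.sub_add_cancel (by omega), Finset.card_univ, ZMod.card,
        div_le_iff₀ (by have := hp.pos; positivity)] at h2
      rw [mul_comm s 2, mul_comm ((p : ℝ) ^ _)]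
      exact (pow_le_pow_left₀ (norm_nonneg _) (norm_sum_le _ _) _).trans h2)
  refine h1.trans ?_
  have h3 : ∑ a : ZMod p, (En (star p k N ×ˢ Fintype.piFinset fun _ : Fin s => cls p N a)
      (fun z => ms k z.1 + ms k z.2) : ℝ) ≤
      p * (J k s (N / p + 1) * (N ^ k * (k.factorial * p ^ (k * (k - 1) / 2)))) := by
    refine (Finset.sum_le_card_nsmul _ _ ((J k s (N / p + 1) *
      (N ^ k * (k.factorial * p ^ (k * (k - 1) / 2))) : ℕ) : ℝ) fun a _ => ?_).trans (le_of_eq ?_)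
    · exact Nat.cast_le.2 (En_cls_star (s := s) hp hk hkp hN a)
    · rw [Finset.card_univ, ZMod.card, nsmul_eq_mul]; push_cast; rfl
  refine (mul_le_mul_of_nonneg_left h3 (by positivity)).trans (le_of_eq ?_)
  rw [← mul_assoc, ← pow_succ, Nat.sub_add_cancel (by omega)]

lemma En_cls {p k n N : ℕ} (hp : 0 < p) (a : ZMod p) :
    En (Fintype.piFinset fun _ : Fin n => cls p N a) (ms k) ≤ J k n (N / p + 1) := by
  obtain ⟨b, hb⟩ := cls_spec (N := N) hp a
  have hp0 : (p : ℤ) ≠ 0 := by exact_mod_cast hp.ne'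
  refine En_map (fun x i => x i / p + 1) ?_ ?_ ?_
  · intro x hx
    rw [Fintype.mem_piFinset] at hx ⊢
    exact fun i => (hb _ (hx i)).2
  · intro x hx y hy hxy
    rw [Fintype.mem_piFinset] at hx hy
    funext i
    have e1 := (hb _ (hx i)).1
    have e2 := (hb _ (hy i)).1
    rw [congrFun hxy i, ← e2] at e1
    linarith
  · intro x hx y hy hxy
    rw [Fintype.mem_piFinset] at hx hy
    funext j
    have := shift_pow (k := k) x y (by
      intro j hj1 hj2
      have := congrFun hxy ⟨j - 1, by omega⟩
      simpa only [ms_apply, Nat.sub_add_cancel hj1] using this) b (j.1 + 1) (by omega)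
    simp only [fun i => (hb _ (hx i)).1, fun i => (hb _ (hy i)).1, mul_pow, ← Finset.mul_sum] at this
    simp only [ms_apply]
    exact mul_left_cancel₀ (pow_ne_zero _ hp0) this

lemma En_cls_mixed {p k n N : ℕ} (hp : 0 < p) (hn : 0 < n) (a : Fin n → ZMod p) :
    (En (Fintype.piFinset fun i : Fin n => cls p N (a i)) (ms k) : ℝ) ≤
      n * J k n (N / p + 1) := by
  have h1 := En_le (Fintype.piFinset fun i : Fin n => cls p N (a i)) (ms k) Finset.univ
    (fun i => Fintype.piFinset fun _ : Fin n => cls p N (a i)) (ms k) 1 (by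
      intro ψ _
      simp only [char_pi, norm_prod, one_mul, ← Finset.prod_pow]
      have : Nonempty (Fin n) := ⟨⟨0, hn⟩⟩
      obtain ⟨i, hi⟩ := Finite.exists_max fun i => ‖∑ x ∈ cls p N (a i), ψ (mom k x)‖
      refine le_trans ?_ (Finset.single_le_sum (f := fun i => ∏ _j : Fin n,
        ‖∑ x ∈ cls p N (a i), ψ (mom k x)‖ ^ 2) (fun i _ => by positivity) (Finset.mem_univ i))
      exact Finset.prod_le_prod (fun _ _ => by positivity)
        fun j _ => pow_le_pow_left₀ (norm_nonneg _) (hi j) 2)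
  refine h1.trans ?_
  rw [one_mul]
  refine (Finset.sum_le_card_nsmul _ _ (J k n (N / p + 1) : ℝ) fun i _ => ?_).trans (le_of_eq ?_)
  · exact_mod_cast En_cls hp (a i)
  · simp

lemma J_add_le (k s m N : ℕ) : (J k (s + m) N : ℝ) ≤ N ^ (2 * m) * J k s N := by
  have h1 := En_le (Fintype.piFinset fun _ : Fin (s + m) => Finset.Icc (1 : ℤ) N) (ms k)
    (Finset.univ : Finset Unit)
    (fun _ => Fintype.piFinset fun _ : Fin s => Finset.Icc (1 : ℤ) N) (ms k)
    ((N : ℝ) ^ (2 * m)) (by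
      intro ψ hψ
      simp only [char_pi, Finset.prod_const, Finset.card_univ, Fintype.card_fin, norm_pow,
        Finset.sum_const, Fintype.card_unit, one_smul]
      have : ‖∑ a ∈ Finset.Icc (1 : ℤ) N, ψ (mom k a)‖ ≤ N := by
        refine (norm_sum_le _ _).trans ?_
        simp [hψ]
      rw [pow_add, mul_pow, mul_comm, ← pow_mul, mul_comm m 2]
      gcongr)
  simpa [J] using h1

lemma En_good {p k s N : ℕ} (e : Fin k ↪ Fin (s + k)) :
    En ((Fintype.piFinset fun _ : Fin (s + k) => Finset.Icc (1 : ℤ) N).filter fun x =>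
      ∀ i j, i ≠ j → ¬ (p : ℤ) ∣ x (e i) - x (e j)) (ms k) ≤
    En (star p k N ×ˢ Fintype.piFinset fun _ : Fin s => Finset.Icc (1 : ℤ) N)
      (fun z => ms k z.1 + ms k z.2) := by
  have hc : Fintype.card ↥((Set.range e)ᶜ : Set (Fin (s + k))) = s := by
    rw [Fintype.card_compl_set, Fintype.card_fin, Set.card_range_of_injective e.injective,
      Fintype.card_fin, Nat.add_sub_cancel]
  let e2 := (Fintype.equivFinOfCardEq hc).symm
  let E : Fin k ⊕ Fin s ≃ Fin (s + k) :=
    (Equiv.sumCongr (Equiv.ofInjective e e.injective) e2).trans (Equiv.Set.sumCompl (Set.range e))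
  have hE : ∀ i, E (Sum.inl i) = e i := fun i => rfl
  have hms : ∀ x : Fin (s + k) → ℤ,
      ms k x = ms k (fun i => x (e i)) + ms k (fun i => x (E (Sum.inr i))) := by
    intro x
    rw [ms, ← E.sum_comp, Fintype.sum_sum_type]
    rfl
  refine En_map (fun x => (fun i => x (e i), fun i => x (E (Sum.inr i)))) ?_ ?_ ?_
  · intro x hx
    obtain ⟨h1, h2⟩ := Finset.mem_filter.1 hx
    rw [Fintype.mem_piFinset] at h1
    exact Finset.mem_product.2 ⟨Finset.mem_filter.2 ⟨Fintype.mem_piFinset.2 fun i => h1 _, h2⟩,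
      Fintype.mem_piFinset.2 fun i => h1 _⟩
  · intro x _ y _ hxy
    simp only [Prod.mk.injEq] at hxy
    funext i
    obtain ⟨j, rfl⟩ := E.surjective i
    rcases j with j | j
    · exact congrFun hxy.1 j
    · exact congrFun hxy.2 j
  · intro x _ y _ hxy
    simp only
    rw [← hms, ← hms, hxy]

lemma good_or_bad {n k p : ℕ} (hk : 0 < k) (r : Fin n → ZMod p) :
    (∃ e : Fin k ↪ Fin n, ∀ i j, i ≠ j → r (e i) ≠ r (e j)) ∨
    ∃ (g : Fin n → Fin k) (c : Fin k → ZMod p), ∀ i, r i = c (g i) := by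
  by_cases h : k ≤ (Finset.univ.image r).card
  · left
    obtain ⟨e⟩ : Nonempty (Fin k ↪ ↥(Finset.univ.image r)) :=
      Function.Embedding.nonempty_of_card_le (by simpa using h)
    have : ∀ i, ∃ j, r j = e i := fun i => by
      obtain ⟨j, -, hj⟩ := Finset.mem_image.1 (e i).2
      exact ⟨j, hj⟩
    choose f hf using this
    have hne : ∀ i j, i ≠ j → r (f i) ≠ r (f j) := by
      intro i j hij h
      rw [hf, hf] at h
      exact hij (e.injective (Subtype.ext h))
    exact ⟨⟨f, fun i j hij => by_contra fun h => hne i j h (by rw [hij])⟩, hne⟩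
  · right
    obtain ⟨e⟩ : Nonempty (↥(Finset.univ.image r) ↪ Fin k) :=
      Function.Embedding.nonempty_of_card_le (by simpa using (not_le.1 h).le)
    let m : Fin n → ↥(Finset.univ.image r) :=
      fun i => ⟨r i, Finset.mem_image.2 ⟨i, Finset.mem_univ _, rfl⟩⟩
    refine ⟨fun i => e (m i), fun j => if h : ∃ i, e (m i) = j then r h.choose else 0, fun i => ?_⟩
    have h : ∃ i', e (m i') = e (m i) := ⟨i, rfl⟩
    beta_reduce
    rw [dif_pos h]
    exact (congrArg Subtype.val (e.injective h.choose_spec)).symm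

lemma J_rec {p k s N : ℕ} (hp : p.Prime) (hk : 0 < k) (hs : 0 < s) (hkp : k < p)
    (hN : N ≤ p ^ k) :
    (J k (s + k) N : ℝ) ≤ 2 * ((((k : ℝ) ^ (s + k) * p ^ k) ^ 2 * (s + k) *
        ((N / p + 1 : ℕ) : ℝ) ^ (2 * k)) +
      (((s + k : ℝ) ^ k) ^ 2 * p ^ (2 * s) * (N ^ k * (k.factorial * p ^ (k * (k - 1) / 2))))) *
      J k s (N / p + 1) := by
  have : NeZero p := ⟨hp.ne_zero⟩
  set X := Fintype.piFinset fun _ : Fin (s + k) => Finset.Icc (1 : ℤ) N with hX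
  let gd : (Fin k ↪ Fin (s + k)) → (Fin (s + k) → ℤ) → Prop :=
    fun e x => ∀ i j, i ≠ j → ¬ (p : ℤ) ∣ x (e i) - x (e j)
  have h0 := En_union X (ms k) (Finset.univ : Finset Bool)
    (fun b => X.filter fun x => (∃ e, gd e x) ↔ b = true)
    (fun x hx => ⟨decide (∃ e, gd e x), Finset.mem_univ _, Finset.mem_filter.2 ⟨hx, by simp⟩⟩)
  have hgood := En_union (X.filter fun x => (∃ e, gd e x) ↔ true = true) (ms k) Finset.univ
    (fun e => X.filter (gd e)) (by
      intro x hx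
      obtain ⟨h1, h2⟩ := Finset.mem_filter.1 hx
      obtain ⟨e, he⟩ := h2.2 rfl
      exact ⟨e, Finset.mem_univ _, Finset.mem_filter.2 ⟨h1, he⟩⟩)
  have hbad := En_union (X.filter fun x => (∃ e, gd e x) ↔ false = true) (ms k)
    (Finset.univ : Finset ((Fin (s + k) → Fin k) × (Fin k → ZMod p)))
    (fun u => Fintype.piFinset fun i => cls p N (u.2 (u.1 i))) (by
      intro x hx
      obtain ⟨h1, h2⟩ := Finset.mem_filter.1 hx
      have h3 : ¬ ∃ e, gd e x := fun h => by simpa using h2.1 h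
      rw [hX, Fintype.mem_piFinset] at h1
      rcases good_or_bad hk (fun i => (x i : ZMod p)) with ⟨e, he⟩ | ⟨g, c, hgc⟩
      · refine absurd ⟨e, fun i j hij hd => he i j hij ?_⟩ h3
        have := (ZMod.intCast_eq_intCast_iff_dvd_sub (x (e j)) (x (e i)) p).2 hd
        exact this.symm
      · exact ⟨(g, c), Finset.mem_univ _, Fintype.mem_piFinset.2 fun i =>
          Finset.mem_filter.2 ⟨h1 i, hgc i⟩⟩)
  have hS := En_star_le hp hk hs hkp hN
  have hgood2 : (En (X.filter fun x => (∃ e, gd e x) ↔ true = true) (ms k) : ℝ) ≤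
      ((s + k : ℝ) ^ k) ^ 2 * (p ^ (2 * s) * (J k s (N / p + 1) *
        (N ^ k * (k.factorial * p ^ (k * (k - 1) / 2))))) := by
    have hcard : ((Finset.univ : Finset (Fin k ↪ Fin (s + k))).card : ℝ) ≤ (s + k : ℝ) ^ k := by
      rw [Finset.card_univ, Fintype.card_embedding_eq, Fintype.card_fin, Fintype.card_fin]
      exact_mod_cast Nat.descFactorial_le_pow _ _
    refine hgood.trans ?_
    have h5 := Finset.sum_le_card_nsmul (Finset.univ : Finset (Fin k ↪ Fin (s + k)))
      (fun e => (En (X.filter (gd e)) (ms k) : ℝ)) _ (fun e _ => by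
        exact (Nat.cast_le.2 (En_good (p := p) (N := N) e)).trans hS)
    rw [nsmul_eq_mul] at h5
    refine (mul_le_mul_of_nonneg_left h5 (by positivity)).trans ?_
    rw [← mul_assoc, ← sq]
    gcongr
  have hbad2 : (En (X.filter fun x => (∃ e, gd e x) ↔ false = true) (ms k) : ℝ) ≤
      ((k : ℝ) ^ (s + k) * p ^ k) ^ 2 * ((s + k) * (((N / p + 1 : ℕ) : ℝ) ^ (2 * k) *
        J k s (N / p + 1))) := by
    have hcard : ((Finset.univ : Finset ((Fin (s + k) → Fin k) × (Fin k → ZMod p))).card : ℝ) =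
        (k : ℝ) ^ (s + k) * p ^ k := by
      simp [Fintype.card_prod, Fintype.card_pi, ZMod.card]
    refine hbad.trans ?_
    have h5 := Finset.sum_le_card_nsmul
      (Finset.univ : Finset ((Fin (s + k) → Fin k) × (Fin k → ZMod p)))
      (fun u => (En (Fintype.piFinset fun i => cls p N (u.2 (u.1 i))) (ms k) : ℝ))
      ((s + k) * (((N / p + 1 : ℕ) : ℝ) ^ (2 * k) * J k s (N / p + 1))) (fun u _ => by
        refine (En_cls_mixed hp.pos (by omega) _).trans ?_
        push_cast
        gcongr
        exact_mod_cast J_add_le k s k (N / p + 1))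
    rw [nsmul_eq_mul] at h5
    refine (mul_le_mul_of_nonneg_left h5 (by positivity)).trans ?_
    rw [← mul_assoc, ← sq, hcard]
  have e0 : (J k (s + k) N : ℝ) = En X (ms k) := rfl
  rw [e0]
  refine h0.trans ?_
  rw [Fintype.sum_bool, Finset.card_univ, Fintype.card_bool]
  refine (mul_le_mul_of_nonneg_left (add_le_add hgood2 hbad2) (by positivity)).trans (le_of_eq ?_)
  push_cast
  ring

end VK

namespace VK

lemma nat_le_exp (k : ℕ) : (k : ℝ) ≤ exp k := by
  have := add_one_le_exp (k : ℝ); linarith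

lemma J_step1 {p k s N : ℕ} (hp : p.Prime) (hk : 2 ≤ k) (hs : k ^ 2 ≤ s) (hs' : s ≤ 8 * k ^ 2)
    (hpk : k ^ 4 ≤ p) (hN : N ≤ p ^ k) (hpN : p ≤ N) :
    (J k (s + k) N : ℝ) ≤ exp (12 * k ^ 2) * p ^ (2 * s + k * (k - 1) / 2) * N ^ k *
      J k s (N / p + 1) := by
  have hkp : k < p := by
    have : k ^ 1 < k ^ 4 := Nat.pow_lt_pow_right (by omega) (by norm_num)
    rw [pow_one] at this; omega
  have hs0 : 0 < s := by have : 0 < k ^ 2 := by positivity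
                         omega
  refine (J_rec hp (by omega) hs0 hkp hN).trans ?_
  refine mul_le_mul_of_nonneg_right ?_ (by positivity)
  have hp0 : (0 : ℝ) < p := by exact_mod_cast hp.pos
  have hp1 : (1 : ℝ) ≤ p := by exact_mod_cast hp.pos
  have hkR : (2 : ℝ) ≤ k := by exact_mod_cast hk
  have hN' : ((N / p + 1 : ℕ) : ℝ) ≤ 2 * N / p := by
    push_cast
    have h1 : ((N / p : ℕ) : ℝ) ≤ N / p := Nat.cast_div_le
    have h2 : (1 : ℝ) ≤ N / p := by rw [le_div_iff₀ hp0, one_mul]; exact_mod_cast hpN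
    calc _ ≤ (N : ℝ) / p + N / p := add_le_add h1 h2
      _ = _ := by ring
  have hn : (s + k : ℝ) ≤ exp (4 * k) := by
    have h1 : (s : ℝ) ≤ 8 * k ^ 2 := by exact_mod_cast hs'
    have h2 : (9 : ℝ) ≤ exp (2 * k) := by
      have : (9 : ℝ) ≤ exp 4 := by
        have := add_one_le_exp (4 : ℝ)
        have h3 : exp (4 : ℝ) = exp 2 ^ 2 := by rw [← exp_nat_mul]; norm_num
        have := add_one_le_exp (2 : ℝ)
        nlinarith
      exact this.trans (exp_le_exp.2 (by linarith))
    have h3 : (k : ℝ) ^ 2 ≤ exp (2 * k) := by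
      have : exp (2 * k : ℝ) = exp k ^ 2 := by rw [← exp_nat_mul]; norm_num
      rw [this]; exact pow_le_pow_left₀ (by positivity) (nat_le_exp k) 2
    calc (s + k : ℝ) ≤ 9 * k ^ 2 := by nlinarith
      _ ≤ exp (2 * k) * exp (2 * k) := by gcongr
      _ = _ := by rw [← exp_add]; ring_nf
  have hbad : ((k : ℝ) ^ (s + k) * p ^ k) ^ 2 * (s + k) * ((N / p + 1 : ℕ) : ℝ) ^ (2 * k) ≤
      exp (9 * k ^ 2) * (p ^ (2 * s + k * (k - 1) / 2) * N ^ k) := by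
    have h1 : (p : ℝ) ^ (2 * k) * ((N / p + 1 : ℕ) : ℝ) ^ (2 * k) ≤ 4 ^ k * (p ^ (k ^ 2) * N ^ k) := by
      rw [← mul_pow]
      have : (p : ℝ) * ((N / p + 1 : ℕ) : ℝ) ≤ 2 * N := by
        calc (p : ℝ) * ((N / p + 1 : ℕ) : ℝ) ≤ p * (2 * N / p) := by gcongr
          _ = _ := by field_simp
      calc _ ≤ (2 * N : ℝ) ^ (2 * k) := by gcongr
        _ = 4 ^ k * ((N : ℝ) ^ k * N ^ k) := by
          rw [mul_pow, pow_mul]; norm_num; ring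
        _ ≤ _ := by
          gcongr
          rw [sq, pow_mul]
          exact pow_le_pow_left₀ (by positivity) (by exact_mod_cast hN) k
    have h2 : ((k : ℝ) ^ (s + k)) ^ 2 ≤ p ^ s := by
      calc ((k : ℝ) ^ (s + k)) ^ 2 = (k : ℝ) ^ (2 * (s + k)) := by rw [← pow_mul, mul_comm]
        _ ≤ (k : ℝ) ^ (4 * s) := pow_le_pow_right₀ (by linarith) (by nlinarith)
        _ = ((k : ℝ) ^ 4) ^ s := by rw [pow_mul]
        _ ≤ _ := pow_le_pow_left₀ (by positivity) (by exact_mod_cast hpk) s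
    have h4 : (4 : ℝ) ^ k * (s + k) ≤ exp (9 * k ^ 2) := by
      have : (4 : ℝ) ^ k ≤ exp (2 * k) := by
        rw [mul_comm, exp_nat_mul]
        refine pow_le_pow_left₀ (by norm_num) ?_ k
        have h3 : exp (2 : ℝ) = exp 1 ^ 2 := by rw [← exp_nat_mul]; norm_num
        have := add_one_le_exp (1 : ℝ)
        nlinarith
      calc _ ≤ exp (2 * k) * exp (4 * k) := by gcongr
        _ = exp (6 * k) := by rw [← exp_add]; ring_nf
        _ ≤ _ := exp_le_exp.2 (by nlinarith)
    calc _ = ((k : ℝ) ^ (s + k)) ^ 2 * ((p : ℝ) ^ (2 * k) * ((N / p + 1 : ℕ) : ℝ) ^ (2 * k)) *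
          (s + k) := by rw [mul_pow ((k : ℝ) ^ (s + k)), ← pow_mul (p : ℝ), mul_comm k 2]; ring
      _ ≤ p ^ s * (4 ^ k * (p ^ (k ^ 2) * N ^ k)) * (s + k) := by gcongr
      _ = (4 ^ k * (s + k)) * (p ^ (s + k ^ 2) * N ^ k) := by rw [pow_add]; ring
      _ ≤ _ := by
        gcongr ?_ * (?_ * ?_)
        exact pow_le_pow_right₀ hp1 (by omega)
  have hgood : ((s + k : ℝ) ^ k) ^ 2 * p ^ (2 * s) * (N ^ k * (k.factorial *
      p ^ (k * (k - 1) / 2))) ≤ exp (9 * k ^ 2) * (p ^ (2 * s + k * (k - 1) / 2) * N ^ k) := by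
    have h1 : ((s + k : ℝ) ^ k) ^ 2 ≤ exp (8 * k ^ 2) := by
      calc _ ≤ (exp (4 * k) ^ k) ^ 2 := by gcongr
        _ = _ := by rw [← exp_nat_mul, ← exp_nat_mul]; push_cast; ring_nf
    have h2 : (k.factorial : ℝ) ≤ exp (k ^ 2) := by
      calc (k.factorial : ℝ) ≤ (k : ℝ) ^ k := by exact_mod_cast Nat.factorial_le_pow k
        _ ≤ exp k ^ k := pow_le_pow_left₀ (by positivity) (nat_le_exp k) k
        _ = _ := by rw [← exp_nat_mul]; ring_nf
    calc _ = (((s + k : ℝ) ^ k) ^ 2 * k.factorial) * (p ^ (2 * s + k * (k - 1) / 2) * N ^ k) := by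
          rw [pow_add]; ring
      _ ≤ (exp (8 * k ^ 2) * exp (k ^ 2)) * (p ^ (2 * s + k * (k - 1) / 2) * N ^ k) := by gcongr
      _ = _ := by rw [← exp_add]; ring_nf
  have h4 : 4 * exp (9 * k ^ 2 : ℝ) ≤ exp (12 * k ^ 2) := by
    have : (4 : ℝ) ≤ exp (3 * k ^ 2) := by
      have := add_one_le_exp (3 * k ^ 2 : ℝ)
      nlinarith
    calc _ ≤ exp (3 * k ^ 2) * exp (9 * k ^ 2 : ℝ) := by gcongr
      _ = _ := by rw [← exp_add]; ring_nf
  calc _ ≤ 2 * (exp (9 * k ^ 2) * (p ^ (2 * s + k * (k - 1) / 2) * N ^ k) +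
        exp (9 * k ^ 2) * (p ^ (2 * s + k * (k - 1) / 2) * N ^ k)) := by gcongr
    _ = (4 * exp (9 * k ^ 2)) * (p ^ (2 * s + k * (k - 1) / 2) * N ^ k) := by ring
    _ ≤ exp (12 * k ^ 2) * (p ^ (2 * s + k * (k - 1) / 2) * N ^ k) := by gcongr
    _ = _ := by ring

lemma J_triv (k s N : ℕ) : (J k s N : ℝ) ≤ (N : ℝ) ^ (2 * s) := by
  have h := J_add_le k 0 s N
  have h0 : J k 0 N ≤ 1 := by
    rw [J, En]
    refine (Finset.card_filter_le _ _).trans ?_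
    simp
  rw [zero_add] at h
  calc (J k s N : ℝ) ≤ N ^ (2 * s) * J k 0 N := h
    _ ≤ N ^ (2 * s) * 1 := by gcongr; exact_mod_cast h0
    _ = _ := by ring

set_option maxHeartbeats 1000000 in
lemma J_bound {k : ℕ} (hk : 2 ≤ k) : ∀ l ≤ 7 * k, ∀ N : ℕ, 1 ≤ N →
    (J k (k ^ 2 + l * k) N : ℝ) ≤ exp (4 * k ^ 4 + 30 * k ^ 2 * l) *
      (N : ℝ) ^ (2 * (k ^ 2 + l * k : ℝ) - k * (k + 1) / 2 +
        k * (k + 1) / 2 * (1 - 1 / (k : ℝ)) ^ l) := by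
  have hkR : (2 : ℝ) ≤ k := by exact_mod_cast hk
  have hk0 : (0 : ℝ) < k := by linarith
  intro l
  induction l with
  | zero =>
    intro _ N hN
    have hN1 : (1 : ℝ) ≤ N := by exact_mod_cast hN
    refine (J_triv _ _ _).trans ?_
    rw [← rpow_natCast]
    push_cast
    simp only [zero_mul, add_zero, pow_zero, mul_one, mul_zero, sub_add_cancel]
    exact le_mul_of_one_le_left (by positivity) (one_le_exp (by positivity))
  | succ l ih =>
    intro hl N hN
    have hN1 : (1 : ℝ) ≤ N := by exact_mod_cast hN
    have hN0 : (0 : ℝ) < N := by linarith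
    set s := k ^ 2 + l * k with hs
    have hsR : (s : ℝ) = k ^ 2 + l * k := by rw [hs]; push_cast; ring
    have hs8 : s ≤ 8 * k ^ 2 := by rw [hs]; clear * - hl; nlinarith
    have es : k ^ 2 + (l + 1) * k = s + k := by rw [hs]; ring
    have hq0 : 0 ≤ 1 - 1 / (k : ℝ) := by
      rw [sub_nonneg, div_le_one hk0]; linarith
    have hq1 : 1 - 1 / (k : ℝ) ≤ 1 := by
      have : 0 ≤ 1 / (k : ℝ) := by positivity
      linarith
    set q := (1 - 1 / (k : ℝ)) ^ l with hq
    have hqq0 : 0 ≤ q := pow_nonneg hq0 l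
    have hqq1 : q ≤ 1 := pow_le_one₀ hq0 hq1
    rw [es]
    set E := 2 * (s : ℝ) - k * (k + 1) / 2 + k * (k + 1) / 2 * q with hE
    have hE' : 2 * ((k : ℝ) ^ 2 + ((l + 1 : ℕ) : ℝ) * k) - k * (k + 1) / 2 +
        k * (k + 1) / 2 * (1 - 1 / (k : ℝ)) ^ (l + 1) =
        E + 2 * k - (k + 1) / 2 * q := by
      rw [pow_succ (1 - 1 / (k : ℝ)), ← hq, hE, hsR]
      push_cast
      field_simp
      ring
    rw [hE']
    have hkk : (k : ℝ) * (k + 1) / 2 ≤ k ^ 2 := by nlinarith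
    have hkk0 : 0 ≤ (k : ℝ) * (k + 1) / 2 := by positivity
    have hs1 : (k : ℝ) ^ 2 ≤ s := by rw [hsR]; linarith [show (0 : ℝ) ≤ l * k by positivity]
    have hE0 : 0 ≤ E := by linarith [mul_nonneg hkk0 hqq0]
    have hE1 : E ≤ 2 * s := by linarith [mul_le_mul_of_nonneg_left hqq1 hkk0]
    by_cases hbig : ((16 * k ^ 4) ^ k : ℝ) ≤ N
    · obtain ⟨z, hz0, hzk⟩ : ∃ z : ℝ, 0 ≤ z ∧ z ^ k = N :=
        ⟨(N : ℝ) ^ (1 / (k : ℝ)), by positivity, by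
          rw [← rpow_natCast, ← rpow_mul (by positivity)]
          field_simp; simp⟩
      have hz : 16 * (k : ℝ) ^ 4 ≤ z := by
        rw [← hzk] at hbig
        exact le_of_pow_le_pow_left₀ (by omega) hz0 hbig
      have hk4 : (1 : ℝ) ≤ (k : ℝ) ^ 4 := one_le_pow₀ (by linarith)
      have hz1 : 16 ≤ z := by linarith
      obtain ⟨p, hp, hp1, hp2⟩ := Nat.exists_prime_lt_and_le_two_mul ⌈z⌉₊
        (Nat.ceil_pos.2 (by linarith)).ne'
      have hzp : z < p := (Nat.le_ceil z).trans_lt (by exact_mod_cast hp1)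
      have hpz : (p : ℝ) ≤ 4 * z := by
        have h1 : (p : ℝ) ≤ 2 * (⌈z⌉₊ : ℝ) := by exact_mod_cast hp2
        have := Nat.ceil_lt_add_one hz0
        linarith
      have hp0 : (0 : ℝ) < p := by linarith
      have hNp : N ≤ p ^ k := by
        have : (N : ℝ) ≤ (p : ℝ) ^ k := by rw [← hzk]; exact pow_le_pow_left₀ hz0 hzp.le k
        exact_mod_cast this
      have hpN : p ≤ N := by
        have h1 : z ^ 2 ≤ N := by rw [← hzk]; exact pow_le_pow_right₀ (by linarith) hk
        have : (p : ℝ) ≤ N := by nlinarith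
        exact_mod_cast this
      have hpk : k ^ 4 ≤ p := by
        have : (k : ℝ) ^ 4 ≤ p := by linarith
        exact_mod_cast this
      refine (J_step1 hp hk (by rw [hs]; exact Nat.le_add_right _ _) hs8 hpk hNp hpN).trans ?_
      have hN' : ((N / p + 1 : ℕ) : ℝ) ≤ 2 * N / p := by
        push_cast
        have h1 : ((N / p : ℕ) : ℝ) ≤ N / p := Nat.cast_div_le
        have h2 : (1 : ℝ) ≤ N / p := by rw [le_div_iff₀ hp0, one_mul]; exact_mod_cast hpN
        calc _ ≤ (N : ℝ) / p + N / p := add_le_add h1 h2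
          _ = _ := by ring
      have hJ := ih (by clear * - hl; omega) (N / p + 1) (Nat.le_add_left _ _)
      rw [← hsR, ← hE] at hJ
      have hJ2 : (J k s (N / p + 1) : ℝ) ≤ exp (4 * k ^ 4 + 30 * k ^ 2 * l) *
          (2 ^ (2 * s) * ((N : ℝ) ^ E * (p : ℝ) ^ (-E))) := by
        refine hJ.trans (mul_le_mul_of_nonneg_left ?_ (exp_pos _).le)
        calc (((N / p + 1 : ℕ) : ℝ)) ^ E ≤ (2 * N / p : ℝ) ^ E := rpow_le_rpow (by positivity) hN' hE0
          _ = 2 ^ E * ((N : ℝ) ^ E * (p : ℝ) ^ (-E)) := by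
            rw [div_rpow (by positivity) (by positivity), mul_rpow (by norm_num) (by positivity),
              rpow_neg hp0.le]; field_simp
          _ ≤ _ := by
            refine mul_le_mul_of_nonneg_right ?_ (by positivity)
            rw [← rpow_natCast]
            exact rpow_le_rpow_of_exponent_le (by norm_num) (by push_cast; linarith)
      have hpp : (p : ℝ) ^ (2 * s + k * (k - 1) / 2) * (p : ℝ) ^ (-E) ≤
          4 ^ (k ^ 2) * (N : ℝ) ^ (k - (k + 1) / 2 * q) := by
        have e1 : ((2 * s + k * (k - 1) / 2 : ℕ) : ℝ) = 2 * s + k * (k - 1) / 2 := by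
          have : 2 ∣ k * (k - 1) := (Nat.even_mul_pred_self k).two_dvd
          push_cast [Nat.cast_div this (by norm_num : ((2 : ℕ) : ℝ) ≠ 0), Nat.cast_sub (by omega : 1 ≤ k)]
          ring
        rw [← rpow_natCast, ← rpow_add hp0, e1]
        have e2 : 2 * (s : ℝ) + k * (k - 1) / 2 + -E = k * (k - (k + 1) / 2 * q) := by
          rw [hE]; ring
        rw [e2, rpow_mul hp0.le, rpow_natCast]
        have hex : 0 ≤ (k : ℝ) - (k + 1) / 2 * q := by
          have := mul_le_mul_of_nonneg_left hqq1 (show 0 ≤ ((k : ℝ) + 1) / 2 by positivity)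
          linarith
        have hex1 : (k : ℝ) - (k + 1) / 2 * q ≤ k := by
          have := mul_nonneg (show 0 ≤ ((k : ℝ) + 1) / 2 by positivity) hqq0
          linarith
        calc ((p : ℝ) ^ k) ^ ((k : ℝ) - (k + 1) / 2 * q) ≤
            (4 ^ k * (N : ℝ)) ^ ((k : ℝ) - (k + 1) / 2 * q) := by
              refine rpow_le_rpow (by positivity) ?_ hex
              rw [← hzk, ← mul_pow]
              exact pow_le_pow_left₀ hp0.le hpz k
          _ = (4 ^ k : ℝ) ^ ((k : ℝ) - (k + 1) / 2 * q) * (N : ℝ) ^ ((k : ℝ) - (k + 1) / 2 * q) := by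
            rw [mul_rpow (by positivity) (by positivity)]
          _ ≤ _ := by
            refine mul_le_mul_of_nonneg_right ?_ (by positivity)
            rw [sq, pow_mul, ← rpow_natCast (4 ^ k : ℝ) k]
            exact rpow_le_rpow_of_exponent_le (one_le_pow₀ (by norm_num)) hex1
      have hexp : exp (12 * (k : ℝ) ^ 2) * 2 ^ (2 * s) * 4 ^ (k ^ 2) ≤ exp (30 * (k : ℝ) ^ 2) := by
        have h2 : (2 : ℝ) ≤ exp 1 := by have := add_one_le_exp (1 : ℝ); linarith
        have h3 : (2 : ℝ) ^ (2 * s) * 4 ^ (k ^ 2) = 2 ^ (2 * s + 2 * k ^ 2) := by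
          rw [pow_add, pow_mul 2 2 (k ^ 2)]; norm_num
        rw [mul_assoc, h3]
        calc _ ≤ exp (12 * (k : ℝ) ^ 2) * 2 ^ (18 * k ^ 2) := by
              gcongr
              norm_num
              omega
          _ ≤ exp (12 * (k : ℝ) ^ 2) * exp 1 ^ (18 * k ^ 2) := by gcongr
          _ = _ := by rw [← exp_nat_mul, ← exp_add]; push_cast; ring_nf
      calc _ ≤ exp (12 * k ^ 2) * p ^ (2 * s + k * (k - 1) / 2) * N ^ k *
            (exp (4 * k ^ 4 + 30 * k ^ 2 * l) * (2 ^ (2 * s) * ((N : ℝ) ^ E * (p : ℝ) ^ (-E)))) := by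
            gcongr
        _ = exp (12 * k ^ 2) * 2 ^ (2 * s) * exp (4 * k ^ 4 + 30 * k ^ 2 * l) * ((N : ℝ) ^ k *
            (N : ℝ) ^ E) * ((p : ℝ) ^ (2 * s + k * (k - 1) / 2) * (p : ℝ) ^ (-E)) := by ring
        _ ≤ exp (12 * k ^ 2) * 2 ^ (2 * s) * exp (4 * k ^ 4 + 30 * k ^ 2 * l) * ((N : ℝ) ^ k *
            (N : ℝ) ^ E) * (4 ^ (k ^ 2) * (N : ℝ) ^ (k - (k + 1) / 2 * q)) := by gcongr
        _ = exp (12 * k ^ 2) * 2 ^ (2 * s) * 4 ^ (k ^ 2) * exp (4 * k ^ 4 + 30 * k ^ 2 * l) *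
            ((N : ℝ) ^ k * (N : ℝ) ^ E * (N : ℝ) ^ (k - (k + 1) / 2 * q)) := by ring
        _ ≤ exp (30 * k ^ 2) * exp (4 * k ^ 4 + 30 * k ^ 2 * l) *
            ((N : ℝ) ^ k * (N : ℝ) ^ E * (N : ℝ) ^ (k - (k + 1) / 2 * q)) := by gcongr
        _ = _ := by
          rw [← exp_add, ← rpow_natCast (N : ℝ) k, ← rpow_add hN0, ← rpow_add hN0]
          congr 2
          · push_cast; ring
          · ring
    · refine (J_triv _ _ _).trans ?_
      have h1 : (N : ℝ) ^ (k ^ 2) ≤ exp (4 * k ^ 4) := by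
        have h2 : (16 * k ^ 4 : ℝ) ≤ exp (4 * k) := by
          have e1 : (2 : ℝ) ≤ exp 1 := by have := add_one_le_exp (1 : ℝ); linarith
          have e2 : (2 : ℝ) * k ≤ exp k := by
            have := Real.add_one_le_exp ((k : ℝ) - 1)
            have e3 : exp (k : ℝ) = exp 1 * exp ((k : ℝ) - 1) := by rw [← exp_add]; ring_nf
            rw [e3]
            nlinarith
          calc (16 * k ^ 4 : ℝ) = (2 * k) ^ 4 := by ring
            _ ≤ exp k ^ 4 := by gcongr
            _ = _ := by rw [← exp_nat_mul]; norm_num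
        calc (N : ℝ) ^ (k ^ 2) ≤ ((16 * k ^ 4 : ℝ) ^ k) ^ (k ^ 2) := by
              gcongr; exact (not_le.1 hbig).le
          _ ≤ (exp (4 * k) ^ k) ^ (k ^ 2) := by gcongr
          _ = _ := by rw [← exp_nat_mul, ← exp_nat_mul]; push_cast; ring_nf
      calc (N : ℝ) ^ (2 * (s + k)) = (N : ℝ) ^ (2 * (s + k : ℝ)) := by
            rw [← rpow_natCast]; push_cast; rfl
        _ ≤ (N : ℝ) ^ (((k ^ 2 : ℕ) : ℝ) + (E + 2 * k - (k + 1) / 2 * q)) := by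
          refine rpow_le_rpow_of_exponent_le hN1 ?_
          rw [hE]; push_cast
          have := mul_nonneg (mul_nonneg (show 0 ≤ ((k : ℝ) + 1) / 2 by positivity) hqq0)
            (show 0 ≤ (k : ℝ) - 1 by linarith)
          linarith
        _ = (N : ℝ) ^ (k ^ 2) * (N : ℝ) ^ (E + 2 * k - (k + 1) / 2 * q) := by
          rw [rpow_add hN0, rpow_natCast]
        _ ≤ exp (4 * k ^ 4) * (N : ℝ) ^ (E + 2 * k - (k + 1) / 2 * q) := by gcongr
        _ ≤ _ := by
          gcongr
          have : 0 ≤ 30 * (k : ℝ) ^ 2 * ((l + 1 : ℕ) : ℝ) := by positivity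
          linarith

lemma J_final {k : ℕ} (hk : 2 ≤ k) {N : ℕ} (hN : 1 ≤ N) :
    (J k (8 * k ^ 2) N : ℝ) ≤ exp (109 * k ^ 4) *
      (N : ℝ) ^ (16 * (k : ℝ) ^ 2 - k * (k + 1) / 2 * (1 - 1 / 1000)) := by
  have hkR : (2 : ℝ) ≤ k := by exact_mod_cast hk
  have h := J_bound hk (7 * k) le_rfl N hN
  have e : k ^ 2 + 7 * k * k = 8 * k ^ 2 := by ring
  rw [e] at h
  refine h.trans ?_
  have hN1 : (1 : ℝ) ≤ N := by exact_mod_cast hN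
  have hq : (1 - 1 / (k : ℝ)) ^ (7 * k) ≤ 1 / 1000 := by
    have h0 : 0 ≤ 1 - 1 / (k : ℝ) := by
      rw [sub_nonneg, div_le_one (by linarith)]; linarith
    calc (1 - 1 / (k : ℝ)) ^ (7 * k) ≤ (exp (-(1 / (k : ℝ)))) ^ (7 * k) := by
          refine pow_le_pow_left₀ h0 ?_ _
          exact one_sub_le_exp_neg _
      _ = (exp 1 ^ 7)⁻¹ := by
        rw [← exp_nat_mul, ← exp_nat_mul, ← exp_neg]
        congr 1; push_cast; field_simp
      _ ≤ 1 / 1000 := by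
        rw [inv_eq_one_div]
        apply one_div_le_one_div_of_le (by norm_num)
        have := exp_one_gt_d9
        calc (1000 : ℝ) ≤ 2.7182818283 ^ 7 := by norm_num
          _ ≤ _ := by gcongr
  gcongr ?_ * ?_
  · apply exp_le_exp.2
    push_cast
    have : (k : ℝ) ^ 3 * 2 ≤ k ^ 4 := by nlinarith [pow_pos (by linarith : (0 : ℝ) < k) 3]
    nlinarith
  · refine rpow_le_rpow_of_exponent_le hN1 ?_
    push_cast
    have : 0 ≤ (k : ℝ) * (k + 1) / 2 := by positivity
    nlinarith

end VK

namespace VK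

/-! ### The double sum bound -/

noncomputable def e (x : ℝ) : ℂ := Complex.exp (x * Complex.I)

lemma e_add (x y : ℝ) : e (x + y) = e x * e y := by
  simp [e, add_mul, Complex.exp_add]

lemma norm_e (x : ℝ) : ‖e x‖ = 1 := Complex.norm_exp_ofReal_mul_I x

lemma e_sum {ι : Type} (I : Finset ι) (f : ι → ℝ) : e (∑ i ∈ I, f i) = ∏ i ∈ I, e (f i) := by
  simp [e, Finset.sum_mul, Complex.exp_sum]

noncomputable def chr {k : ℕ} (γ : Fin k → ℝ) : AddChar (Fin k → ℤ) ℂ where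
  toFun v := e (∑ j, γ j * v j)
  map_zero_eq_one' := by simp [e]
  map_add_eq_mul' v w := by
    rw [← e_add, ← Finset.sum_add_distrib]; simp [mul_add]

lemma chr_apply {k : ℕ} (γ : Fin k → ℝ) (v : Fin k → ℤ) : chr γ v = e (∑ j, γ j * v j) := rfl

lemma norm_chr {k : ℕ} (γ : Fin k → ℝ) (v : Fin k → ℤ) : ‖chr γ v‖ = 1 := norm_e _

noncomputable def fM {k : ℕ} (M : ℕ) (γ : Fin k → ℝ) : ℂ :=
  ∑ y ∈ Finset.Icc (1 : ℤ) M, chr γ (mom k y)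

noncomputable def UU (s M : ℕ) : Finset ((Fin s → ℤ) × (Fin s → ℤ)) :=
  (Fintype.piFinset fun _ : Fin s => Finset.Icc (1 : ℤ) M) ×ˢ
    (Fintype.piFinset fun _ : Fin s => Finset.Icc (1 : ℤ) M)

noncomputable def dl (k : ℕ) {s : ℕ} (u : (Fin s → ℤ) × (Fin s → ℤ)) : Fin k → ℤ :=
  ms k u.1 - ms k u.2

lemma fM_pow {k : ℕ} (M s : ℕ) (γ : Fin k → ℝ) :
    ((‖fM M γ‖ ^ (2 * s) : ℝ) : ℂ) = ∑ u ∈ UU s M, chr γ (dl k u) := by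
  have h1 : (fM M γ) ^ s = ∑ y ∈ Fintype.piFinset (fun _ : Fin s => Finset.Icc (1 : ℤ) M),
      chr γ (ms k y) := by
    rw [char_pi]; simp [fM]
  have h2 : (‖fM M γ‖ ^ (2 * s) : ℝ) = ‖fM M γ ^ s‖ ^ 2 := by
    rw [norm_pow, ← pow_mul, mul_comm]
  rw [h2, Complex.ofReal_pow, ← Complex.mul_conj', h1, map_sum, Finset.sum_mul_sum, UU,
    Finset.sum_product]
  refine Finset.sum_congr rfl fun x _ => Finset.sum_congr rfl fun y _ => ?_
  rw [dl, sub_eq_add_neg, AddChar.map_add_eq_mul, AddChar.map_neg_eq_inv,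
    Complex.inv_eq_conj (norm_chr _ _)]

lemma fib_sum {k s M : ℕ} (box : Finset (Fin k → ℤ)) (hbox : ∀ u ∈ UU s M, dl k u ∈ box)
    (h : (Fin k → ℤ) → ℝ) (hh : ∀ v, 0 ≤ h v) :
    ∑ u ∈ UU s M, h (dl k u) ≤ J k s M * ∑ v ∈ box, h v := by
  rw [← Finset.sum_fiberwise_of_maps_to hbox, Finset.mul_sum]
  refine Finset.sum_le_sum fun v _ => ?_
  rw [Finset.sum_congr rfl (g := fun _ => h v) fun u hu => by rw [(Finset.mem_filter.1 hu).2],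
    Finset.sum_const, nsmul_eq_mul]
  refine mul_le_mul_of_nonneg_right ?_ (hh v)
  refine Nat.cast_le.2 (le_trans (Finset.card_le_card ?_) (shift_le
    (Fintype.piFinset fun _ : Fin s => Finset.Icc (1 : ℤ) M) (ms k) v))
  intro u hu
  rw [Finset.mem_filter] at hu ⊢
  refine ⟨hu.1, ?_⟩
  rw [← hu.2, dl]; abel

lemma norm_sum_pow {ι : Type} (I : Finset ι) (f : ι → ℂ) {n : ℕ} (hn : 0 < n) :
    ‖∑ i ∈ I, f i‖ ^ n ≤ (I.card : ℝ) ^ (n - 1) * ∑ i ∈ I, ‖f i‖ ^ n := by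
  rcases I.eq_empty_or_nonempty with rfl | hI
  · simp [hn.ne']
  have h2 := pow_sum_div_card_le_sum_pow (n := n - 1) (s := I)
    (f := fun a => ‖f a‖) (fun _ _ => norm_nonneg _)
  have : 0 < (I.card : ℝ) := by exact_mod_cast hI.card_pos
  rw [Nat.sub_add_cancel (by omega), div_le_iff₀ (by positivity)] at h2
  rw [mul_comm]
  exact (pow_le_pow_left₀ (norm_nonneg _) (norm_sum_le _ _) _).trans h2

noncomputable def GG (β : ℝ) (W : ℕ) : ℝ :=
  ∑ w ∈ Finset.Icc (-(W : ℤ)) W, ‖∑ v ∈ Finset.Icc (-(W : ℤ)) W, e (β * w * v)‖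

lemma sum_chr_swap {k s M : ℕ} {ι : Type} (I : Finset ι) (γ : ι → Fin k → ℝ) :
    ∑ i ∈ I, ‖fM M (γ i)‖ ^ (2 * s) ≤ ∑ u ∈ UU s M, ‖∑ i ∈ I, chr (γ i) (dl k u)‖ := by
  have h1 : ((∑ i ∈ I, ‖fM M (γ i)‖ ^ (2 * s) : ℝ) : ℂ) =
      ∑ u ∈ UU s M, ∑ i ∈ I, chr (γ i) (dl k u) := by
    rw [Complex.ofReal_sum, Finset.sum_congr rfl fun i _ => fM_pow M s (γ i), Finset.sum_comm]
  have h2 : (∑ i ∈ I, ‖fM M (γ i)‖ ^ (2 * s) : ℝ) =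
      ‖((∑ i ∈ I, ‖fM M (γ i)‖ ^ (2 * s) : ℝ) : ℂ)‖ := by
    rw [Complex.norm_real, Real.norm_of_nonneg (by positivity)]
  rw [h2, h1]
  exact norm_sum_le _ _

lemma double_sum {k s M : ℕ} (hs : 0 < s) (β : Fin k → ℝ) :
    ‖∑ x ∈ Finset.Icc (1 : ℤ) M, ∑ y ∈ Finset.Icc (1 : ℤ) M,
      e (∑ j, β j * ((x * y : ℤ) : ℝ) ^ (j.1 + 1))‖ ^ (4 * s ^ 2) ≤
    (M : ℝ) ^ (8 * s ^ 2 - 4 * s) * (J k s M : ℝ) ^ 2 * ∏ j : Fin k, GG (β j) (s * M ^ (j.1 + 1)) := by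
  set W : Fin k → ℕ := fun j => s * M ^ (j.1 + 1) with hW
  set box : Finset (Fin k → ℤ) := Fintype.piFinset fun j => Finset.Icc (-(W j : ℤ)) (W j) with hb
  have hbox : ∀ u ∈ UU s M, dl k u ∈ box := by
    intro u hu
    rw [UU, Finset.mem_product, Fintype.mem_piFinset, Fintype.mem_piFinset] at hu
    rw [hb, Fintype.mem_piFinset]
    intro j
    have key : ∀ y : Fin s → ℤ, (∀ i, y i ∈ Finset.Icc (1 : ℤ) M) → 0 ≤ ms k y j ∧
        ms k y j ≤ W j := by
      intro y hy
      rw [ms_apply]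
      have hy' : ∀ i, 1 ≤ y i ∧ y i ≤ M := fun i => Finset.mem_Icc.1 (hy i)
      constructor
      · exact Finset.sum_nonneg fun i _ => pow_nonneg (by linarith [(hy' i).1]) _
      · refine (Finset.sum_le_card_nsmul _ _ ((M : ℤ) ^ (j.1 + 1)) fun i _ =>
          pow_le_pow_left₀ (by linarith [(hy' i).1]) (hy' i).2 _).trans (le_of_eq ?_)
        simp [hW]
    have h1 := key _ hu.1
    have h2 := key _ hu.2
    rw [Finset.mem_Icc, dl, Pi.sub_apply]
    constructor <;> linarith
  have hsw : ∀ x : ℤ, ∑ y ∈ Finset.Icc (1 : ℤ) M, e (∑ j, β j * ((x * y : ℤ) : ℝ) ^ (j.1 + 1)) =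
      fM M fun j => β j * (x : ℝ) ^ (j.1 + 1) := by
    intro x
    refine Finset.sum_congr rfl fun y _ => ?_
    rw [chr_apply]
    congr 1
    refine Finset.sum_congr rfl fun j _ => ?_
    simp only [mom]; push_cast; ring
  simp only [hsw]
  set T := ∑ x ∈ Finset.Icc (1 : ℤ) M, fM M fun j => β j * (x : ℝ) ^ (j.1 + 1) with hT
  have hcM : ((Finset.Icc (1 : ℤ) M).card : ℝ) = M := by simp
  have hcU : ((UU s M).card : ℝ) = (M : ℝ) ^ (2 * s) := by
    simp [UU, Fintype.card_piFinset]; ring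
  have s1 : ‖T‖ ^ (2 * s) ≤ (M : ℝ) ^ (2 * s - 1) *
      ∑ u ∈ UU s M, ‖fM M fun j => β j * (dl k u j : ℝ)‖ := by
    have := norm_sum_pow (Finset.Icc (1 : ℤ) M)
      (fun x => fM M fun j => β j * (x : ℝ) ^ (j.1 + 1)) (n := 2 * s) (by omega)
    rw [hcM] at this
    refine this.trans (mul_le_mul_of_nonneg_left ((sum_chr_swap _ _).trans (le_of_eq ?_))
      (by positivity))
    refine Finset.sum_congr rfl fun u _ => ?_
    congr 1
    refine Finset.sum_congr rfl fun x _ => ?_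
    rw [chr_apply, chr_apply]
    congr 1
    refine Finset.sum_congr rfl fun j _ => ?_
    simp only [mom]; push_cast; ring
  have s2 : (∑ u ∈ UU s M, ‖fM M fun j => β j * (dl k u j : ℝ)‖) ^ (2 * s) ≤
      ((M : ℝ) ^ (2 * s)) ^ (2 * s - 1) * (J k s M * ∑ v ∈ box,
        ‖fM M fun j => β j * (v j : ℝ)‖ ^ (2 * s)) := by
    have := norm_sum_pow (UU s M)
      (fun u => ((‖fM M fun j => β j * (dl k u j : ℝ)‖ : ℝ) : ℂ)) (n := 2 * s) (by omega)
    rw [hcU, ← Complex.ofReal_sum, Complex.norm_real, Real.norm_of_nonneg (by positivity)] at this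
    simp only [Complex.norm_real, norm_norm] at this
    refine this.trans (mul_le_mul_of_nonneg_left ?_ (by positivity))
    exact fib_sum box hbox (fun v => ‖fM M fun j => β j * (v j : ℝ)‖ ^ (2 * s))
      fun v => by positivity
  have s3 : ∑ v ∈ box, ‖fM M fun j => β j * (v j : ℝ)‖ ^ (2 * s) ≤
      J k s M * ∏ j : Fin k, GG (β j) (W j) := by
    refine (sum_chr_swap _ _).trans ((fib_sum box hbox
      (fun w => ‖∑ v ∈ box, chr (fun j => β j * (v j : ℝ)) w‖) fun w => norm_nonneg _).trans
      (le_of_eq ?_))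
    congr 1
    have : ∀ w : Fin k → ℤ, ‖∑ v ∈ box, chr (fun j => β j * (v j : ℝ)) w‖ =
        ∏ j, ‖∑ v ∈ Finset.Icc (-(W j : ℤ)) (W j), e (β j * w j * v)‖ := by
      intro w
      rw [← norm_prod, Finset.prod_univ_sum]
      congr 1
      refine Finset.sum_congr rfl fun v _ => ?_
      rw [chr_apply, e_sum]
      refine Finset.prod_congr rfl fun j _ => ?_
      congr 1; ring
    simp only [this, GG]
    rw [Finset.prod_univ_sum]
  have hJ : (0 : ℝ) ≤ J k s M := by positivity
  calc ‖T‖ ^ (4 * s ^ 2) = (‖T‖ ^ (2 * s)) ^ (2 * s) := by rw [← pow_mul]; ring_nf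
    _ ≤ ((M : ℝ) ^ (2 * s - 1) *
      ∑ u ∈ UU s M, ‖fM M fun j => β j * (dl k u j : ℝ)‖) ^ (2 * s) :=
        pow_le_pow_left₀ (by positivity) s1 _
    _ = ((M : ℝ) ^ (2 * s - 1)) ^ (2 * s) *
      (∑ u ∈ UU s M, ‖fM M fun j => β j * (dl k u j : ℝ)‖) ^ (2 * s) := mul_pow _ _ _
    _ ≤ ((M : ℝ) ^ (2 * s - 1)) ^ (2 * s) * (((M : ℝ) ^ (2 * s)) ^ (2 * s - 1) *
        (J k s M * (J k s M * ∏ j : Fin k, GG (β j) (W j)))) := by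
        refine mul_le_mul_of_nonneg_left (s2.trans ?_) (by positivity)
        exact mul_le_mul_of_nonneg_left (mul_le_mul_of_nonneg_left s3 hJ) (by positivity)
    _ = _ := by
      have e1 : ((M : ℝ) ^ (2 * s - 1)) ^ (2 * s) * ((M : ℝ) ^ (2 * s)) ^ (2 * s - 1) =
          (M : ℝ) ^ (8 * s ^ 2 - 4 * s) := by
        rw [← pow_mul, ← pow_mul, ← pow_add]
        congr 1
        rcases s with _ | s
        · omega
        · have h1 : 2 * (s + 1) - 1 = 2 * s + 1 := by omega
          rw [h1]
          have h2 : 8 * (s + 1) ^ 2 = (2 * s + 1) * (2 * (s + 1)) + 2 * (s + 1) * (2 * s + 1) +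
            4 * (s + 1) := by ring
          omega
      rw [← e1]; ring

end VK

namespace VK

lemma sum_Icc_e (θ : ℝ) (W : ℕ) :
    (∑ v ∈ Finset.Icc (-(W : ℤ)) W, e (θ * v)) * (e θ - 1) = e (θ * (W + 1)) - e (θ * -W) := by
  have h1 : ∑ v ∈ Finset.Icc (-(W : ℤ)) W, e (θ * v) =
      ∑ i ∈ Finset.range (2 * W + 1), e (θ * ((i : ℝ) - W)) := by
    symm
    refine Finset.sum_bij (fun i _ => (i : ℤ) - W) ?_ ?_ ?_ ?_
    · intro i hi
      rw [Finset.mem_range] at hi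
      rw [Finset.mem_Icc]; omega
    · intro i _ j _ h; omega
    · intro v hv
      rw [Finset.mem_Icc] at hv
      exact ⟨(v + W).toNat, by rw [Finset.mem_range]; omega, by omega⟩
    · intro i _; push_cast; rfl
  rw [h1, Finset.sum_mul, Finset.sum_congr rfl (g := fun i : ℕ => e (θ * (((i + 1 : ℕ) : ℝ) - W)) -
    e (θ * ((i : ℝ) - W))) fun i _ => by
      rw [mul_sub, ← e_add, mul_one]; congr 2; push_cast; ring,
    Finset.sum_range_sub (fun i : ℕ => e (θ * ((i : ℝ) - W)))]
  push_cast
  congr 2 <;> ring_nf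

lemma norm_e_sub_one {θ : ℝ} (h : |θ| ≤ 1) : |θ| / 2 ≤ ‖e θ - 1‖ := by
  have h1 : |Real.sin θ| ≤ ‖e θ - 1‖ := by
    have := Complex.abs_im_le_norm (e θ - 1)
    rwa [Complex.sub_im, e, Complex.exp_ofReal_mul_I_im, Complex.one_im, sub_zero] at this
  have h2 := Real.mul_abs_le_abs_sin (x := θ) (h.trans (by have := pi_gt_three; linarith))
  refine le_trans ?_ (h2.trans h1)
  have : (1 : ℝ) / 2 ≤ 2 / π := by
    rw [div_le_div_iff₀ (by norm_num) pi_pos]; have := pi_lt_four; linarith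
  have := mul_le_mul_of_nonneg_right this (abs_nonneg θ)
  linarith

lemma card_sym (W : ℕ) : ((Finset.Icc (-(W : ℤ)) W).card : ℝ) = 2 * W + 1 := by
  rw [Int.card_Icc]
  have : ((W : ℤ) + 1 - -(W : ℤ)).toNat = 2 * W + 1 := by omega
  rw [this]; push_cast; ring

lemma inner_triv (θ : ℝ) (W : ℕ) : ‖∑ v ∈ Finset.Icc (-(W : ℤ)) W, e (θ * v)‖ ≤ 2 * W + 1 := by
  refine (norm_sum_le _ _).trans ?_
  simp only [norm_e, Finset.sum_const, nsmul_eq_mul, mul_one, card_sym, le_refl]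

lemma GG_triv (β : ℝ) {W : ℕ} (hW : 1 ≤ W) : GG β W ≤ 9 * (W : ℝ) ^ 2 := by
  have h1 : (1 : ℝ) ≤ W := by exact_mod_cast hW
  refine (Finset.sum_le_card_nsmul _ _ (2 * (W : ℝ) + 1) fun w _ => inner_triv _ _).trans ?_
  rw [nsmul_eq_mul, card_sym]
  nlinarith

lemma GG_good {β : ℝ} (hβ : 0 < |β|) {W : ℕ} (hW : 1 ≤ W) (hβW : |β| * W ≤ 1) :
    GG β W ≤ 9 * (W : ℝ) ^ 2 * (3 / (W * √|β|)) := by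
  have hW1 : (1 : ℝ) ≤ W := by exact_mod_cast hW
  have hs0 : 0 < √|β| := Real.sqrt_pos.2 hβ
  have hss : √|β| * √|β| = |β| := Real.mul_self_sqrt hβ.le
  have hβ1 : |β| ≤ 1 := (le_mul_of_one_le_right hβ.le hW1).trans hβW
  have hs1 : √|β| ≤ 1 := Real.sqrt_le_one.2 hβ1
  set Y := 1 / √|β| with hY
  have hY1 : 1 ≤ Y := by rw [hY, le_div_iff₀ hs0]; linarith
  have hp : ∀ w ∈ Finset.Icc (-(W : ℤ)) W, ‖∑ v ∈ Finset.Icc (-(W : ℤ)) W, e (β * w * v)‖ ≤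
      (if |(w : ℝ)| ≤ Y then 3 * (W : ℝ) else 0) + 4 * Y := by
    intro w hw
    rw [Finset.mem_Icc] at hw
    split_ifs with h
    · refine (inner_triv _ _).trans ?_
      linarith
    · rw [zero_add]
      push Not at h
      have hwW : |(w : ℝ)| ≤ W := by
        rw [abs_le]; constructor
        · exact_mod_cast hw.1
        · exact_mod_cast hw.2
      have h1 : |β * w| ≤ 1 := by
        rw [abs_mul]; exact (mul_le_mul_of_nonneg_left hwW hβ.le).trans hβW
      have h2 := norm_e_sub_one h1
      have h3 := congrArg norm (sum_Icc_e (β * w) W)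
      rw [norm_mul] at h3
      have h4 : ‖e (β * w * (W + 1)) - e (β * w * -W)‖ ≤ 2 :=
        (norm_sub_le _ _).trans (by rw [norm_e, norm_e]; norm_num)
      have h5 : √|β| / 2 ≤ ‖e (β * w) - 1‖ := by
        refine le_trans ?_ h2
        rw [abs_mul]
        have : √|β| ≤ |β| * |(w : ℝ)| := by
          calc √|β| = |β| * Y := by rw [hY, mul_one_div, eq_div_iff hs0.ne', hss]
            _ ≤ _ := mul_le_mul_of_nonneg_left h.le hβ.le
        linarith
      have h6 : ‖∑ v ∈ Finset.Icc (-(W : ℤ)) W, e (β * w * v)‖ * (√|β| / 2) ≤ 2 :=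
        (mul_le_mul_of_nonneg_left h5 (norm_nonneg _)).trans (h3.trans_le h4)
      rw [hY, mul_one_div, le_div_iff₀ hs0]
      linarith
  refine (Finset.sum_le_sum hp).trans ?_
  rw [Finset.sum_add_distrib, ← Finset.sum_filter, Finset.sum_const, Finset.sum_const,
    nsmul_eq_mul, nsmul_eq_mul, card_sym]
  have hcard : (((Finset.Icc (-(W : ℤ)) W).filter fun w : ℤ => |(w : ℝ)| ≤ Y).card : ℝ) ≤ 3 * Y := by
    have : ((Finset.Icc (-(W : ℤ)) W).filter fun w : ℤ => |(w : ℝ)| ≤ Y) ⊆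
        Finset.Icc (-((⌊Y⌋₊ : ℕ) : ℤ)) (⌊Y⌋₊ : ℕ) := by
      intro w hw
      have h := (Finset.mem_filter.1 hw).2
      have h2 : w.natAbs ≤ ⌊Y⌋₊ := by
        apply Nat.le_floor
        rwa [Nat.cast_natAbs, Int.cast_abs]
      rw [Finset.mem_Icc]; omega
    have h3 : (((Finset.Icc (-(W : ℤ)) W).filter fun w : ℤ => |(w : ℝ)| ≤ Y).card : ℝ) ≤
        2 * (⌊Y⌋₊ : ℝ) + 1 := by
      rw [← card_sym]; exact_mod_cast Finset.card_le_card this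
    have := Nat.floor_le (by linarith : 0 ≤ Y)
    linarith
  have e1 : 9 * (W : ℝ) ^ 2 * (3 / (W * √|β|)) = 27 * W * Y := by
    rw [hY]; field_simp; norm_num
  rw [e1]
  have h7 := mul_le_mul_of_nonneg_right hcard (by linarith : 0 ≤ 3 * (W : ℝ))
  have h8 : 0 ≤ Y * (W - 1) := mul_nonneg (by linarith) (by linarith)
  have h9 : 0 ≤ Y * W := mul_nonneg (by linarith) (by linarith)
  linarith

lemma good_card {a : ℕ} (ha : 4 ≤ a) : (a : ℝ) / 8 ≤ (((Finset.range (a + 1)).filter fun j =>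
    a ≤ 2 * (j + 1) ∧ 4 * (j + 1) ≤ 3 * a).card : ℝ) := by
  have h : Finset.Ico ((a + 1) / 2 - 1) (3 * a / 4) ⊆ (Finset.range (a + 1)).filter fun j =>
    a ≤ 2 * (j + 1) ∧ 4 * (j + 1) ≤ 3 * a := by
    intro j hj
    rw [Finset.mem_Ico] at hj
    rw [Finset.mem_filter, Finset.mem_range]
    omega
  have h2 := Finset.card_le_card h
  rw [Nat.card_Ico] at h2
  have h3 : a ≤ 8 * (3 * a / 4 - ((a + 1) / 2 - 1)) := by omega
  have h4 : a ≤ 8 * ((Finset.range (a + 1)).filter fun j =>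
    a ≤ 2 * (j + 1) ∧ 4 * (j + 1) ≤ 3 * a).card := by omega
  have h5 : (a : ℝ) ≤ 8 * (((Finset.range (a + 1)).filter fun j =>
    a ≤ 2 * (j + 1) ∧ 4 * (j + 1) ≤ 3 * a).card : ℝ) := by exact_mod_cast h4
  linarith

lemma good_saving {P a s n J : ℕ} {t β : ℝ} (ha : 4 ≤ a) (hP : 1 ≤ P) (hs : s ≤ P) (has : a ≤ s)
    (ht : (P : ℝ) ^ a ≤ t) (ht' : t < (P : ℝ) ^ (a + 1)) (hn : P ^ 5 ≤ n) (hn' : n ≤ 32 * P ^ 5)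
    (hβ : |β| = t / (J * (n : ℝ) ^ J)) (hJ1 : a ≤ 2 * J) (hJ2 : 4 * J ≤ 3 * a) :
    GG β (s * (P ^ 2) ^ J) ≤ 9 * ((s * (P ^ 2) ^ J : ℕ) : ℝ) ^ 2 *
      exp (2 + 2 * a - a / 8 * log P) := by
  have hPR : (1 : ℝ) ≤ P := by exact_mod_cast hP
  have hP0 : (0 : ℝ) < P := by linarith
  have hnR : (P : ℝ) ^ 5 ≤ n := by exact_mod_cast hn
  have hnR' : (n : ℝ) ≤ 32 * (P : ℝ) ^ 5 := by exact_mod_cast hn'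
  have hJ0 : 1 ≤ J := by omega
  have hJR : (1 : ℝ) ≤ J := by exact_mod_cast hJ0
  have hn0 : (0 : ℝ) < n := lt_of_lt_of_le (by positivity) hnR
  have ht0 : 0 < t := lt_of_lt_of_le (by positivity) ht
  have hβ0 : 0 < |β| := by rw [hβ]; positivity
  have hs1 : 1 ≤ s := by omega
  have hW : 1 ≤ s * (P ^ 2) ^ J := Nat.one_le_iff_ne_zero.2 (by positivity)
  have hWR : ((s * (P ^ 2) ^ J : ℕ) : ℝ) = s * (P : ℝ) ^ (2 * J) := by
    push_cast; rw [← pow_mul]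
  have hsR : (s : ℝ) ≤ P := by exact_mod_cast hs
  have hβW : |β| * ((s * (P ^ 2) ^ J : ℕ) : ℝ) ≤ 1 := by
    rw [hWR, hβ, div_mul_eq_mul_div, div_le_one (by positivity)]
    calc t * (s * (P : ℝ) ^ (2 * J)) ≤ (P : ℝ) ^ (a + 1) * (P * (P : ℝ) ^ (2 * J)) := by gcongr
      _ = (P : ℝ) ^ (a + 2 + 2 * J) := by ring
      _ ≤ (P : ℝ) ^ (5 * J) := pow_le_pow_right₀ hPR (by omega)
      _ = 1 * ((P : ℝ) ^ 5) ^ J := by rw [one_mul, pow_mul]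
      _ ≤ J * (n : ℝ) ^ J := by gcongr
  refine (GG_good hβ0 hW hβW).trans ?_
  gcongr ?_ * ?_
  set W := ((s * (P ^ 2) ^ J : ℕ) : ℝ) with hWdef
  have hW1 : 1 ≤ W := by rw [hWdef]; exact_mod_cast hW
  have key : exp (a / 4 * log P - 4 * a) ≤ W ^ 2 * |β| := by
    rw [hWR, hβ]
    have h1 : exp (a / 4 * log P - 4 * a) ≤ (P : ℝ) ^ (a - J) / 32 ^ J := by
      rw [exp_sub]
      have h32 : (32 : ℝ) ^ J ≤ exp (4 * a) := by
        calc (32 : ℝ) ^ J ≤ (exp 4) ^ J := by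
              gcongr
              have : (32 : ℝ) ≤ 2.7182818283 ^ 4 := by norm_num
              calc (32 : ℝ) ≤ 2.7182818283 ^ 4 := this
                _ ≤ exp 1 ^ 4 := by gcongr; exact exp_one_gt_d9.le
                _ = _ := by rw [← exp_nat_mul]; norm_num
          _ = exp (4 * J) := by rw [← exp_nat_mul]; ring_nf
          _ ≤ _ := by
            apply exp_le_exp.2
            have : (J : ℝ) ≤ a := by exact_mod_cast (by omega : J ≤ a)
            linarith
      have hPp : exp (a / 4 * log P) ≤ (P : ℝ) ^ (a - J) := by
        rw [← exp_log (pow_pos hP0 (a - J)), log_pow]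
        apply exp_le_exp.2
        refine mul_le_mul_of_nonneg_right ?_ (log_nonneg hPR)
        have : (a : ℝ) ≤ 4 * ((a - J : ℕ) : ℝ) := by exact_mod_cast (by omega : a ≤ 4 * (a - J))
        linarith
      gcongr
    refine h1.trans ?_
    have e1 : ((s : ℝ) * P ^ (2 * J)) ^ 2 * (t / (J * (n : ℝ) ^ J)) =
        (s : ℝ) ^ 2 / J * (P ^ (4 * J) * t / (n : ℝ) ^ J) := by
      field_simp; ring
    rw [e1]
    have h2 : (P : ℝ) ^ (a - J) / 32 ^ J ≤ P ^ (4 * J) * t / (n : ℝ) ^ J := by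
      rw [div_le_div_iff₀ (by positivity) (by positivity)]
      calc (P : ℝ) ^ (a - J) * (n : ℝ) ^ J ≤ (P : ℝ) ^ (a - J) * (32 * (P : ℝ) ^ 5) ^ J := by gcongr
        _ = (P : ℝ) ^ (a - J) * P ^ J * P ^ (4 * J) * 32 ^ J := by rw [mul_pow, ← pow_mul]; ring
        _ = (P : ℝ) ^ a * P ^ (4 * J) * 32 ^ J := by
          rw [← pow_add, Nat.sub_add_cancel (by omega)]
        _ ≤ t * P ^ (4 * J) * 32 ^ J := by gcongr
        _ = _ := by ring
    refine h2.trans (le_mul_of_one_le_left (by positivity) ?_)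
    rw [le_div_iff₀ (by linarith), one_mul]
    have h3 : (J : ℝ) ≤ s := by exact_mod_cast (by omega : J ≤ s)
    have h4 : (1 : ℝ) ≤ s := by exact_mod_cast hs1
    exact h3.trans (le_self_pow₀ h4 two_ne_zero)
  have h5 : exp (a / 8 * log P - 2 * a) ≤ W * √|β| := by
    have : W * √|β| = √(W ^ 2 * |β|) := by
      rw [Real.sqrt_mul (by positivity), Real.sqrt_sq (by linarith)]
    rw [this]
    apply Real.le_sqrt_of_sq_le
    refine le_trans (le_of_eq ?_) key
    rw [← exp_nat_mul]; congr 1; push_cast; ring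
  have h6 : (3 : ℝ) ≤ exp 2 := by have := add_one_le_exp (2 : ℝ); linarith
  calc 3 / (W * √|β|) ≤ exp 2 / exp (a / 8 * log P - 2 * a) := by gcongr
    _ = _ := by rw [← exp_sub]; ring_nf

lemma T_prod {P a n s k : ℕ} {t : ℝ} (hk : k = a + 1) (ha : 4 ≤ a) (hP1 : 1 ≤ P) (hP : 48 ≤ log P)
    (hs : s ≤ P) (has : a ≤ s)
    (ht : (P : ℝ) ^ a ≤ t) (ht' : t < (P : ℝ) ^ (a + 1)) (hn : P ^ 5 ≤ n) (hn' : n ≤ 32 * P ^ 5)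
    (β : Fin k → ℝ) (hβ : ∀ j, |β j| = t / ((j.1 + 1 : ℕ) * (n : ℝ) ^ (j.1 + 1))) :
    ∏ j : Fin k, GG (β j) (s * (P ^ 2) ^ (j.1 + 1)) ≤
      (9 * (s : ℝ) ^ 2) ^ k * ((P : ℝ) ^ 2) ^ (k * (k + 1)) *
        exp ((2 + 2 * a - a / 8 * log P) * ((a : ℝ) / 8)) := by
  have haR : (4 : ℝ) ≤ a := by exact_mod_cast ha
  have hs0 : 0 < s := by omega
  rw [exp_mul]
  set Sv := exp (2 + 2 * a - a / 8 * log P) with hSv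
  have hSv1 : Sv ≤ 1 := by
    rw [hSv, exp_le_one_iff]
    have : a * (log P - 48) ≥ 0 := mul_nonneg (by linarith) (by linarith)
    linarith
  have h1 : ∏ j : Fin k, GG (β j) (s * (P ^ 2) ^ (j.1 + 1)) ≤
      ∏ j : Fin k, (9 * ((s * (P ^ 2) ^ (j.1 + 1) : ℕ) : ℝ) ^ 2 *
        if a ≤ 2 * (j.1 + 1) ∧ 4 * (j.1 + 1) ≤ 3 * a then Sv else 1) := by
    refine Finset.prod_le_prod (fun j _ => ?_) fun j _ => ?_
    · exact Finset.sum_nonneg fun _ _ => norm_nonneg _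
    · split_ifs with h
      · exact good_saving ha hP1 hs has ht ht' hn hn' (hβ j) h.1 h.2
      · rw [mul_one]
        exact GG_triv _ (Nat.one_le_iff_ne_zero.2 (by positivity))
  refine h1.trans ?_
  rw [← Finset.prod_range (fun j => 9 * ((s * (P ^ 2) ^ (j + 1) : ℕ) : ℝ) ^ 2 *
        if a ≤ 2 * (j + 1) ∧ 4 * (j + 1) ≤ 3 * a then Sv else 1), Finset.prod_mul_distrib]
  have h2 : ∀ m : ℕ, ∏ j ∈ Finset.range m, 9 * ((s * (P ^ 2) ^ (j + 1) : ℕ) : ℝ) ^ 2 =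
      (9 * (s : ℝ) ^ 2) ^ m * ((P : ℝ) ^ 2) ^ (m * (m + 1)) := by
    intro m
    induction m with
    | zero => simp
    | succ m ih => rw [Finset.prod_range_succ, ih]; push_cast; ring
  rw [h2]
  refine mul_le_mul_of_nonneg_left ?_ (by positivity)
  rw [← Finset.prod_filter, Finset.prod_const, ← rpow_natCast]
  refine rpow_le_rpow_of_exponent_ge (exp_pos _) hSv1 ?_
  rw [hk]; exact good_card ha

lemma T_arith {P s k a Jn : ℕ} {G T : ℝ} (ha : 4 ≤ a) (hkR : (k : ℝ) = a + 1)
    (hsR : (s : ℝ) = 8 * (k : ℝ) ^ 2) (hP0 : (0 : ℝ) < P) (hp : 0 ≤ log P) (hT0 : 0 ≤ T) (hG0 : 0 ≤ G)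
    (hJ : (Jn : ℝ) ≤ exp (109 * k ^ 4) * ((P ^ 2 : ℕ) : ℝ) ^
            (16 * (k : ℝ) ^ 2 - k * (k + 1) / 2 * (1 - 1 / 1000)))
    (hG : G ≤ (9 * (s : ℝ) ^ 2) ^ k * ((P : ℝ) ^ 2) ^ (k * (k + 1)) *
        exp ((2 + 2 * a - a / 8 * log P) * ((a : ℝ) / 8)))
    (hmain : T ^ (4 * s ^ 2) ≤ ((P ^ 2 : ℕ) : ℝ) ^ (8 * s ^ 2 - 4 * s) * (Jn : ℝ) ^ 2 * G) :
    T ≤ (P : ℝ) ^ 4 * exp (1 - log P / (70000 * a ^ 2)) := by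
  have haR : (4 : ℝ) ≤ a := by exact_mod_cast ha
  have hk0 : (5 : ℝ) ≤ k := by rw [hkR]; linarith
  have hs1 : 1 ≤ s := by
    have : (0 : ℝ) < s := by rw [hsR]; positivity
    exact_mod_cast this
  generalize hpd : log P = p at *
  have hPexp : (P : ℝ) = exp p := by rw [← hpd, exp_log hP0]
  have hk4 : (k : ℝ) ^ 4 ≤ 5 / 2 * (a : ℝ) ^ 4 := by
    have : (k : ℝ) ≤ 5 / 4 * a := by rw [hkR]; linarith
    calc (k : ℝ) ^ 4 ≤ (5 / 4 * (a : ℝ)) ^ 4 := by gcongr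
      _ = 625 / 256 * (a : ℝ) ^ 4 := by ring
      _ ≤ _ := mul_le_mul_of_nonneg_right (by norm_num) (by positivity)
  have h9 : (9 * (s : ℝ) ^ 2) ^ k ≤ exp (8 * (k : ℝ) ^ 2) := by
    have e1 : 9 * (s : ℝ) ^ 2 ≤ exp (8 * (k : ℝ)) := by
      have h2 : (5 : ℝ) * k ≤ exp (2 * (k : ℝ)) := by
        have := Real.quadratic_le_exp_of_nonneg (x := 2 * (k : ℝ)) (by positivity)
        nlinarith
      calc 9 * (s : ℝ) ^ 2 = 576 * (k : ℝ) ^ 4 := by rw [hsR]; ring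
        _ ≤ (5 * k : ℝ) ^ 4 := by rw [mul_pow]; gcongr; norm_num
        _ ≤ exp (2 * (k : ℝ)) ^ 4 := by gcongr
        _ = _ := by rw [← exp_nat_mul]; ring_nf
    calc _ ≤ exp (8 * (k : ℝ)) ^ k := by gcongr
      _ = _ := by rw [← exp_nat_mul]; ring_nf
  have hJ2 : (Jn : ℝ) ^ 2 ≤ exp (218 * (k : ℝ) ^ 4 + 2 * (2 * p *
        (2 * s - k * (k + 1) / 2 * (1 - 1 / 1000)))) := by
    calc (Jn : ℝ) ^ 2 ≤ (exp (109 * (k : ℝ) ^ 4) * ((P ^ 2 : ℕ) : ℝ) ^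
            (16 * (k : ℝ) ^ 2 - k * (k + 1) / 2 * (1 - 1 / 1000))) ^ 2 := by gcongr
      _ = _ := by
        push_cast
        rw [hPexp, ← exp_nat_mul, ← exp_mul, ← exp_add, ← exp_nat_mul]
        congr 1; rw [hsR]; push_cast; ring
  have e2 : ((P ^ 2 : ℕ) : ℝ) ^ (8 * s ^ 2 - 4 * s) = exp (2 * p * (8 * (s : ℝ) ^ 2 - 4 * s)) := by
    push_cast
    rw [hPexp, ← exp_nat_mul, ← exp_nat_mul, Nat.cast_sub (by nlinarith)]
    congr 1; push_cast; ring
  have e3 : ((P : ℝ) ^ 2) ^ (k * (k + 1)) = exp (2 * p * (k * (k + 1))) := by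
    rw [hPexp, ← exp_nat_mul, ← exp_nat_mul]; congr 1; push_cast; ring
  have e4 : ((P : ℝ) ^ 4 * exp (1 - p / (70000 * a ^ 2))) ^ (4 * s ^ 2) =
      exp (16 * (s : ℝ) ^ 2 * p + 256 * (k : ℝ) ^ 4 - 256 * (k : ℝ) ^ 4 * p / (70000 * (a : ℝ) ^ 2)) := by
    rw [hPexp, ← exp_nat_mul, ← exp_add, ← exp_nat_mul]
    congr 1; push_cast; rw [hsR]; ring
  have hbound : T ^ (4 * s ^ 2) ≤ ((P : ℝ) ^ 4 * exp (1 - p / (70000 * a ^ 2))) ^ (4 * s ^ 2) := by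
    refine hmain.trans ?_
    rw [e2, e4]
    rw [e3] at hG
    refine (mul_le_mul (mul_le_mul_of_nonneg_left hJ2 (exp_pos _).le) (hG.trans
      (mul_le_mul_of_nonneg_right (mul_le_mul_of_nonneg_right h9 (exp_pos _).le) (exp_pos _).le))
      hG0 (by positivity)).trans ?_
    rw [← exp_add, ← exp_add, ← exp_add, ← exp_add]
    apply exp_le_exp.2
    have i1 : 8 * (k : ℝ) ^ 2 + (2 + 2 * a) * (a / 8) ≤ 38 * (k : ℝ) ^ 4 := by
      have : (a : ℝ) ≤ k := by rw [hkR]; linarith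
      have h2 : (k : ℝ) ^ 2 ≤ (k : ℝ) ^ 4 := pow_le_pow_right₀ (by linarith) (by norm_num)
      clear * - this h2 hk0 haR
      nlinarith
    have i2 : 2 * (k : ℝ) * (k + 1) / 1000 - (a : ℝ) ^ 2 / 64 ≤ - ((a : ℝ) ^ 2 / 100) := by
      rw [hkR]; clear * - haR; nlinarith
    have i3 := mul_le_mul_of_nonneg_left i2 hp
    have i4 : 256 * (k : ℝ) ^ 4 * p / (70000 * (a : ℝ) ^ 2) ≤ p * (a : ℝ) ^ 2 / 100 := by
      rw [div_le_div_iff₀ (by positivity) (by norm_num)]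
      have := mul_le_mul_of_nonneg_right hk4 hp
      have h0 : 0 ≤ (a : ℝ) ^ 4 * p := by positivity
      clear * - this h0
      linarith
    clear * - i1 i3 i4
    linarith
  refine le_of_pow_le_pow_left₀ ?_ (by positivity) hbound
  positivity

lemma T_bound {P a n : ℕ} {t : ℝ} (ha : 4 ≤ a) (hP : 48 ≤ log P) (hs : 8 * (a + 1) ^ 2 ≤ P)
    (ht : (P : ℝ) ^ a ≤ t) (ht' : t < (P : ℝ) ^ (a + 1)) (hn : P ^ 5 ≤ n) (hn' : n ≤ 32 * P ^ 5)
    (β : Fin (a + 1) → ℝ) (hβ : ∀ j, |β j| = t / ((j.1 + 1 : ℕ) * (n : ℝ) ^ (j.1 + 1))) :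
    ‖∑ x ∈ Finset.Icc (1 : ℤ) (P ^ 2 : ℕ), ∑ y ∈ Finset.Icc (1 : ℤ) (P ^ 2 : ℕ),
      e (∑ j, β j * ((x * y : ℤ) : ℝ) ^ (j.1 + 1))‖ ≤
    (P : ℝ) ^ 4 * exp (1 - log P / (70000 * a ^ 2)) := by
  have hP1 : 1 ≤ P := by nlinarith
  obtain ⟨s, hsd⟩ : ∃ s, s = 8 * (a + 1) ^ 2 := ⟨_, rfl⟩
  have hJ := J_final (k := a + 1) (by omega) (N := P ^ 2) (Nat.one_le_pow _ _ hP1)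
  rw [← hsd] at hs hJ
  have hs0 : 0 < s := by rw [hsd]; positivity
  have has : a ≤ s := by rw [hsd]; nlinarith
  exact T_arith ha (by push_cast; ring) (by rw [hsd]; push_cast; ring) (by exact_mod_cast hP1)
    (by linarith) (norm_nonneg _)
    (Finset.prod_nonneg fun j _ => Finset.sum_nonneg fun _ _ => norm_nonneg _) hJ
    (T_prod rfl ha hP1 hP hs has ht ht' hn hn' β hβ) (double_sum (M := P ^ 2) hs0 β)

end VK

namespace VK

lemma norm_e_sub_e (x y : ℝ) : ‖e x - e y‖ ≤ |x - y| := by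
  have h : e x - e y = e y * (e (x - y) - 1) := by
    rw [mul_sub, ← e_add, mul_one]; congr 2; ring
  rw [h, norm_mul, norm_e, one_mul]
  have := Real.norm_exp_I_mul_ofReal_sub_one_le (x := x - y)
  rwa [mul_comm, Real.norm_eq_abs] at this

lemma shift_sum {f : ℕ → ℂ} (hf : ∀ n, ‖f n‖ ≤ 1) (A B h : ℕ) (hAB : A ≤ B) :
    ‖∑ n ∈ Finset.Ioc A B, f n - ∑ n ∈ Finset.Ioc A B, f (n + h)‖ ≤ 2 * h := by
  have h1 : ∀ C D : ℕ, C ≤ D → ‖∑ n ∈ Finset.Ioc C D, f n‖ ≤ (D : ℝ) - C := fun C D hCD => by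
    refine (norm_sum_le_of_le _ fun n _ => hf n).trans ?_
    rw [Finset.sum_const, Nat.card_Ioc, nsmul_eq_mul, Nat.cast_sub hCD, mul_one]
  have h2 : ∑ n ∈ Finset.Ioc A B, f (n + h) = ∑ n ∈ Finset.Ioc (A + h) (B + h), f n := by
    rw [← Finset.map_add_right_Ioc, Finset.sum_map]; rfl
  have h3 := Finset.sum_Ioc_consecutive f hAB (Nat.le_add_right B h)
  have h4 := Finset.sum_Ioc_consecutive f (Nat.le_add_right A h) (by omega : A + h ≤ B + h)
  have e1 : ∑ n ∈ Finset.Ioc A B, f n - ∑ n ∈ Finset.Ioc A B, f (n + h) =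
      ∑ n ∈ Finset.Ioc A (A + h), f n - ∑ n ∈ Finset.Ioc B (B + h), f n := by
    rw [h2, sub_eq_sub_iff_add_eq_add, h3, ← h4]
  rw [e1]
  have h5 := h1 A (A + h) (by omega)
  have h6 := h1 B (B + h) (by omega)
  push_cast at h5 h6
  refine (norm_sub_le _ _).trans ?_
  linarith

lemma taylor_e {P a n : ℕ} {t : ℝ} (hP : 2 ≤ P) (ht0 : 0 ≤ t) (ht' : t < (P : ℝ) ^ (a + 1))
    (hn : P ^ 5 ≤ n) (h : ℕ) (hh : h ≤ P ^ 4) :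
    ‖e (-t * log ((n + h : ℕ) : ℝ)) - e (-t * log n) * e (∑ j : Fin (a + 1),
      (t * (-1) ^ (j.1 + 1) / ((j.1 + 1 : ℕ) * (n : ℝ) ^ (j.1 + 1))) * (h : ℝ) ^ (j.1 + 1))‖ ≤ 2 / P := by
  have hPR : (2 : ℝ) ≤ P := by exact_mod_cast hP
  have hP0 : (0 : ℝ) < P := by linarith
  have hnR : (P : ℝ) ^ 5 ≤ n := by exact_mod_cast hn
  have hn0 : (0 : ℝ) < n := lt_of_lt_of_le (by positivity) hnR
  have hhR : (h : ℝ) ≤ (P : ℝ) ^ 4 := by exact_mod_cast hh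
  rw [← e_add]
  refine (norm_e_sub_e _ _).trans ?_
  set u : ℝ := h / n with hu
  have hu0 : 0 ≤ u := by positivity
  have hu1 : u ≤ 1 / P := by
    rw [hu, div_le_div_iff₀ hn0 hP0]
    calc (h : ℝ) * P ≤ (P : ℝ) ^ 4 * P := by gcongr
      _ = (P : ℝ) ^ 5 := by ring
      _ ≤ _ := by linarith
  have hu2 : u ≤ 1 / 2 := hu1.trans (by gcongr)
  have hlog : log ((n + h : ℕ) : ℝ) = log n + log (1 + u) := by
    rw [← log_mul hn0.ne' (by positivity)]
    congr 1; rw [hu]; push_cast; field_simp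
  have hT := Real.abs_log_sub_add_sum_range_le (x := -u) (by rw [abs_neg, abs_of_nonneg hu0]; linarith)
    (a + 1)
  rw [abs_neg, abs_of_nonneg hu0, sub_neg_eq_add] at hT
  have e1 : ∑ j : Fin (a + 1), (t * (-1) ^ (j.1 + 1) / ((j.1 + 1 : ℕ) * (n : ℝ) ^ (j.1 + 1))) *
      (h : ℝ) ^ (j.1 + 1) = t * ∑ i ∈ Finset.range (a + 1), (-u) ^ (i + 1) / ((i : ℝ) + 1) := by
    rw [Finset.mul_sum, Finset.sum_range]
    refine Finset.sum_congr rfl fun j _ => ?_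
    rw [neg_pow u, hu, div_pow]; push_cast; field_simp
  rw [e1, hlog]
  have e2 : -t * (log n + log (1 + u)) - (-t * log n + t * ∑ i ∈ Finset.range (a + 1),
      (-u) ^ (i + 1) / ((i : ℝ) + 1)) = -(t * (∑ i ∈ Finset.range (a + 1), (-u) ^ (i + 1) / ((i : ℝ) + 1)
        + log (1 + u))) := by ring
  rw [e2, abs_neg, abs_mul, abs_of_nonneg ht0]
  calc _ ≤ (P : ℝ) ^ (a + 1) * (u ^ (a + 1 + 1) / (1 - u)) := by gcongr
    _ ≤ (P : ℝ) ^ (a + 1) * ((1 / P) ^ (a + 1 + 1) / (1 / 2)) := by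
      gcongr; linarith
    _ = 2 / P := by rw [div_pow, one_pow, pow_succ _ (a + 1)]; field_simp

lemma Tn_bound {P a n : ℕ} {t : ℝ} (ha : 4 ≤ a) (hP : 48 ≤ log P) (hs : 8 * (a + 1) ^ 2 ≤ P)
    (ht : (P : ℝ) ^ a ≤ t) (ht' : t < (P : ℝ) ^ (a + 1)) (hn : P ^ 5 ≤ n) (hn' : n ≤ 32 * P ^ 5) :
    ‖∑ x ∈ Finset.Icc 1 (P ^ 2), ∑ y ∈ Finset.Icc 1 (P ^ 2), e (-t * log ((n + x * y : ℕ) : ℝ))‖ ≤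
    (P : ℝ) ^ 4 * (2 * exp (1 - log P / (70000 * a ^ 2))) := by
  have hP1 : 2 ≤ P := by nlinarith
  have hPR : (2 : ℝ) ≤ P := by exact_mod_cast hP1
  have hP0 : (0 : ℝ) < P := by linarith
  have ht0 : 0 ≤ t := le_trans (by positivity) ht
  have hn0 : (0 : ℝ) < n := by
    have : 0 < n := lt_of_lt_of_le (by positivity) hn
    exact_mod_cast this
  have haR : (4 : ℝ) ≤ a := by exact_mod_cast ha
  set β : Fin (a + 1) → ℝ := fun j => t * (-1) ^ (j.1 + 1) / ((j.1 + 1 : ℕ) * (n : ℝ) ^ (j.1 + 1)) with hβ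
  have hT := T_bound ha hP hs ht ht' hn hn' β fun j => by
    rw [hβ]; simp only
    rw [abs_div, abs_mul, abs_pow, abs_neg, abs_one, one_pow, mul_one, abs_of_nonneg ht0,
      abs_of_nonneg (by positivity : (0 : ℝ) ≤ (j.1 + 1 : ℕ) * (n : ℝ) ^ (j.1 + 1))]
  have hcast : ∀ F : ℤ → ℂ, ∑ x ∈ Finset.Icc (1 : ℤ) (P ^ 2 : ℕ), F x =
      ∑ x ∈ Finset.Icc 1 (P ^ 2), F ((x : ℕ) : ℤ) := fun F => by
    symm
    refine Finset.sum_bij (fun i _ => (i : ℤ)) (fun i hi => ?_) (fun i _ j _ h => by omega)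
      (fun v hv => ?_) fun i _ => rfl
    · rw [Finset.mem_Icc] at hi ⊢; omega
    · rw [Finset.mem_Icc] at hv
      exact ⟨v.toNat, by rw [Finset.mem_Icc]; omega, by omega⟩
  rw [hcast] at hT
  simp only [hcast] at hT
  have hd : ‖∑ x ∈ Finset.Icc 1 (P ^ 2), ∑ y ∈ Finset.Icc 1 (P ^ 2),
      (e (-t * log ((n + x * y : ℕ) : ℝ)) - e (-t * log n) *
        e (∑ j, β j * ((((x : ℕ) : ℤ) * ((y : ℕ) : ℤ) : ℤ) : ℝ) ^ (j.1 + 1)))‖ ≤ (P : ℝ) ^ 4 * (2 / P) := by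
    have h1 : ∀ x ∈ Finset.Icc 1 (P ^ 2), ‖∑ y ∈ Finset.Icc 1 (P ^ 2),
      (e (-t * log ((n + x * y : ℕ) : ℝ)) - e (-t * log n) *
        e (∑ j, β j * ((((x : ℕ) : ℤ) * ((y : ℕ) : ℤ) : ℤ) : ℝ) ^ (j.1 + 1)))‖ ≤ (P : ℝ) ^ 2 * (2 / P) := by
      intro x hx
      refine (norm_sum_le_of_le (n := fun _ => 2 / (P : ℝ)) _ fun y hy => ?_).trans ?_
      · rw [Finset.mem_Icc] at hx hy
        have := taylor_e (h := x * y) hP1 ht0 ht' hn (by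
          calc x * y ≤ P ^ 2 * P ^ 2 := Nat.mul_le_mul hx.2 hy.2
            _ = _ := by ring)
        simp only [hβ]
        push_cast at this ⊢
        exact this
      · rw [Finset.sum_const, Nat.card_Icc, nsmul_eq_mul]; push_cast; simp
    refine (norm_sum_le_of_le _ h1).trans ?_
    rw [Finset.sum_const, Nat.card_Icc, nsmul_eq_mul]; simp only [Nat.add_sub_cancel]
    push_cast; apply le_of_eq; ring
  simp only [Finset.sum_sub_distrib, ← Finset.mul_sum] at hd
  have h2 := (norm_sub_norm_le _ _).trans hd
  rw [norm_mul, norm_e, one_mul] at h2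
  have h3 : 2 / (P : ℝ) ≤ exp (1 - log P / (70000 * a ^ 2)) := by
    calc 2 / (P : ℝ) ≤ exp 1 / exp (log P) := by
          rw [exp_log hP0]; gcongr; have := add_one_le_exp (1 : ℝ); linarith
      _ = exp (1 - log P) := by rw [exp_sub]
      _ ≤ _ := by
        apply exp_le_exp.2
        have := div_le_self (a := log P) (b := 70000 * (a : ℝ) ^ 2) (by linarith) (by nlinarith)
        linarith
  have h4 := mul_le_mul_of_nonneg_left h3 (by positivity : 0 ≤ (P : ℝ) ^ 4)
  linarith

/-- Vinogradov's bound for dyadic-type blocks. -/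
theorem expsum {P a A B : ℕ} {t : ℝ} (ha : 4 ≤ a) (hP1 : 1 ≤ P)
    (ht : (P : ℝ) ^ a ≤ t) (ht' : t < (P : ℝ) ^ (a + 1)) (hA : P ^ 5 ≤ A) (hB : B ≤ 32 * P ^ 5) :
    ‖∑ n ∈ Finset.Ioc A B, e (-t * log n)‖ ≤
    200 * (P : ℝ) ^ 5 * exp (-(log P / (70000 * a ^ 2))) := by
  have hPR : (1 : ℝ) ≤ P := by exact_mod_cast hP1
  have hP0 : (0 : ℝ) < P := by linarith
  have haR : (4 : ℝ) ≤ a := by exact_mod_cast ha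
  rcases le_total B A with hBA | hAB
  · rw [Finset.Ioc_eq_empty (by omega), Finset.sum_empty, norm_zero]; positivity
  have hcard : (B : ℝ) - A ≤ 31 * (P : ℝ) ^ 5 := by
    have h1 : (P : ℝ) ^ 5 ≤ A := by exact_mod_cast hA
    have h2 : (B : ℝ) ≤ 32 * (P : ℝ) ^ 5 := by exact_mod_cast hB
    linarith
  have he3 : exp 1 < 3 := by have := exp_one_lt_d9; linarith
  by_cases hc : 48 ≤ log P ∧ 8 * (a + 1) ^ 2 ≤ P
  · obtain ⟨hP, hs⟩ := hc
    set E := exp (-(log P / (70000 * a ^ 2))) with hE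
    have hE1 : 1 / (P : ℝ) ≤ E := by
      rw [hE, ← exp_log (by positivity : 0 < 1 / (P : ℝ)), log_div one_ne_zero hP0.ne', log_one]
      apply exp_le_exp.2
      have := div_le_self (a := log P) (b := 70000 * (a : ℝ) ^ 2) (by linarith) (by nlinarith)
      linarith
    have hE2 : exp (1 - log P / (70000 * a ^ 2)) = exp 1 * E := by rw [hE, ← exp_add]; ring_nf
    set S := ‖∑ n ∈ Finset.Ioc A B, e (-t * log n)‖ with hS
    have key : (P : ℝ) ^ 4 * S ≤ 31 * (P : ℝ) ^ 5 * ((P : ℝ) ^ 4 * (2 * (exp 1 * E))) +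
        (P : ℝ) ^ 4 * (2 * (P : ℝ) ^ 4) := by
      have h1 : ‖∑ x ∈ Finset.Icc 1 (P ^ 2), ∑ y ∈ Finset.Icc 1 (P ^ 2),
          ((∑ n ∈ Finset.Ioc A B, e (-t * log n)) -
            ∑ n ∈ Finset.Ioc A B, e (-t * log ((n + x * y : ℕ) : ℝ)))‖ ≤
          (P : ℝ) ^ 4 * (2 * (P : ℝ) ^ 4) := by
        have h2 : ∀ x ∈ Finset.Icc 1 (P ^ 2), ‖∑ y ∈ Finset.Icc 1 (P ^ 2),
          ((∑ n ∈ Finset.Ioc A B, e (-t * log n)) -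
            ∑ n ∈ Finset.Ioc A B, e (-t * log ((n + x * y : ℕ) : ℝ)))‖ ≤
          (P : ℝ) ^ 2 * (2 * (P : ℝ) ^ 4) := by
          intro x hx
          refine (norm_sum_le_of_le (n := fun _ => 2 * (P : ℝ) ^ 4) _ fun y hy => ?_).trans ?_
          · rw [Finset.mem_Icc] at hx hy
            refine (shift_sum (f := fun n => e (-t * log n)) (fun n => (norm_e _).le) A B (x * y)
              hAB).trans ?_
            have : x * y ≤ P ^ 4 := by
              calc x * y ≤ P ^ 2 * P ^ 2 := Nat.mul_le_mul hx.2 hy.2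
                _ = _ := by ring
            have : ((x * y : ℕ) : ℝ) ≤ (P : ℝ) ^ 4 := by exact_mod_cast this
            linarith
          · rw [Finset.sum_const, Nat.card_Icc, nsmul_eq_mul]; push_cast; simp
        refine (norm_sum_le_of_le _ h2).trans ?_
        rw [Finset.sum_const, Nat.card_Icc, nsmul_eq_mul]; simp only [Nat.add_sub_cancel]
        push_cast; apply le_of_eq; ring
      have h3 : ‖∑ x ∈ Finset.Icc 1 (P ^ 2), ∑ y ∈ Finset.Icc 1 (P ^ 2),
            ∑ n ∈ Finset.Ioc A B, e (-t * log ((n + x * y : ℕ) : ℝ))‖ ≤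
          31 * (P : ℝ) ^ 5 * ((P : ℝ) ^ 4 * (2 * (exp 1 * E))) := by
        have : ∑ x ∈ Finset.Icc 1 (P ^ 2), ∑ y ∈ Finset.Icc 1 (P ^ 2),
            ∑ n ∈ Finset.Ioc A B, e (-t * log ((n + x * y : ℕ) : ℝ)) = ∑ n ∈ Finset.Ioc A B,
            ∑ x ∈ Finset.Icc 1 (P ^ 2), ∑ y ∈ Finset.Icc 1 (P ^ 2),
              e (-t * log ((n + x * y : ℕ) : ℝ)) := by
          rw [Finset.sum_comm]
          conv_rhs => rw [Finset.sum_comm]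
          rw [Finset.sum_comm]
          exact Finset.sum_congr rfl fun x _ => Finset.sum_comm
        rw [this]
        refine (norm_sum_le_of_le (n := fun _ => (P : ℝ) ^ 4 * (2 * (exp 1 * E))) _
          fun n hn => ?_).trans ?_
        · rw [Finset.mem_Ioc] at hn
          rw [← hE2]
          exact Tn_bound ha hP hs ht ht' (by omega) (by omega)
        · rw [Finset.sum_const, Nat.card_Ioc, nsmul_eq_mul, Nat.cast_sub hAB]
          gcongr
      simp only [Finset.sum_sub_distrib, Finset.sum_const, Nat.card_Icc, Nat.add_sub_cancel] at h1
      have h4 := (norm_sub_norm_le _ _).trans h1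
      rw [nsmul_eq_mul, nsmul_eq_mul, norm_mul, norm_mul, ← hS, Complex.norm_natCast] at h4
      push_cast at h4 h3
      linarith
    have h5 : (P : ℝ) ^ 4 * S ≤ (P : ℝ) ^ 4 * (200 * (P : ℝ) ^ 5 * E) := by
      refine key.trans ?_
      have h6 : (P : ℝ) ^ 4 ≤ (P : ℝ) ^ 5 * E := by
        calc (P : ℝ) ^ 4 = (P : ℝ) ^ 5 * (1 / P) := by field_simp
          _ ≤ _ := by gcongr
      have h7 : 0 ≤ (P : ℝ) ^ 4 * ((P : ℝ) ^ 5 * E) := by positivity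
      have h8 := mul_le_mul_of_nonneg_right he3.le h7
      have h9 := mul_le_mul_of_nonneg_left h6 (by positivity : 0 ≤ (P : ℝ) ^ 4)
      linarith
    exact le_of_mul_le_mul_left h5 (by positivity)
  · have h1 : ‖∑ n ∈ Finset.Ioc A B, e (-t * log n)‖ ≤ 31 * (P : ℝ) ^ 5 := by
      refine (norm_sum_le_of_le (n := fun _ => (1 : ℝ)) _ fun n _ => (norm_e _).le).trans ?_
      rw [Finset.sum_const, Nat.card_Ioc, nsmul_eq_mul, Nat.cast_sub hAB, mul_one]
      exact hcard
    have h2 : log P ≤ 70000 * (a : ℝ) ^ 2 := by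
      rw [not_and_or] at hc
      rcases hc with hc | hc
      · push Not at hc; nlinarith
      · push Not at hc
        have h3 : (P : ℝ) < 8 * ((a : ℝ) + 1) ^ 2 := by exact_mod_cast hc
        have := log_le_self hP0.le
        nlinarith
    have h4 : exp (-1) ≤ exp (-(log P / (70000 * a ^ 2))) := by
      apply exp_le_exp.2
      have := (div_le_one (by positivity : 0 < 70000 * (a : ℝ) ^ 2)).2 h2
      linarith
    have h5 : 1 / 3 ≤ exp (-1) := by
      rw [exp_neg, ← one_div]; gcongr
    have := mul_le_mul_of_nonneg_left (h5.trans h4) (by positivity : 0 ≤ (P : ℝ) ^ 5)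
    have h6 : 0 ≤ (P : ℝ) ^ 5 := by positivity
    linarith

end VK

namespace VK

lemma cpow_deriv (r : ℂ) {x : ℝ} (hx : 0 < x) :
    HasDerivAt (fun y : ℝ => (y : ℂ) ^ r) (r * (x : ℂ) ^ (r - 1)) x := by
  have := ((hasDerivAt_id (x : ℂ)).cpow_const (c := r)
    (Or.inl (by simpa using hx))).comp_ofReal
  simpa using this

lemma cpow_diff {s : ℂ} (hs : 0 < s.re) {n u v : ℝ} (hn : 0 < n) (hu : n ≤ u) (hv : n ≤ v) (huv : |v - u| ≤ 1) :
    ‖(v : ℂ) ^ (-s) - (u : ℂ) ^ (-s)‖ ≤ ‖s‖ * n ^ (-s.re - 1) := by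
  have := Convex.norm_image_sub_le_of_norm_hasDerivWithin_le (s := Set.Ici n)
    (f := fun y : ℝ => (y : ℂ) ^ (-s)) (f' := fun y : ℝ => -s * (y : ℂ) ^ (-s - 1))
    (C := ‖s‖ * n ^ (-s.re - 1)) (x := u) (y := v)
    (fun y hy => (cpow_deriv (-s) (hn.trans_le hy)).hasDerivWithinAt) (fun y hy => by
      have hy0 : 0 < y := hn.trans_le hy
      rw [norm_mul, norm_neg, Complex.norm_cpow_eq_rpow_re_of_pos hy0]
      have : (-s - 1).re = -s.re - 1 := by simp
      rw [this]
      exact mul_le_mul_of_nonneg_left (rpow_le_rpow_of_nonpos hn hy (by linarith)) (norm_nonneg _))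
    (convex_Ici n) hu hv
  refine this.trans (mul_le_of_le_one_right (by positivity) huv)

/-- Euler–Maclaurin error term. -/
noncomputable def Gt (n : ℕ) (s : ℂ) : ℂ :=
  (s - 1) * ((n + 1 : ℕ) : ℂ) ^ (-s) - (n : ℂ) ^ (1 - s) + ((n + 1 : ℕ) : ℂ) ^ (1 - s)

lemma Gt_le {n : ℕ} (hn : 1 ≤ n) {s : ℂ} (hs : 0 < s.re) :
    ‖Gt n s‖ ≤ ‖s - 1‖ * (‖s‖ * (n : ℝ) ^ (-s.re - 1)) := by
  have hn0 : (0 : ℝ) < n := by exact_mod_cast hn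
  have := Convex.norm_image_sub_le_of_norm_hasDerivWithin_le (s := Set.Icc (n : ℝ) (n + 1))
    (f := fun y : ℝ => (s - 1) * ((n + 1 : ℕ) : ℂ) ^ (-s) * y + (y : ℂ) ^ (1 - s))
    (f' := fun y : ℝ => (s - 1) * ((n + 1 : ℕ) : ℂ) ^ (-s) * 1 + (1 - s) * (y : ℂ) ^ (1 - s - 1))
    (C := ‖s - 1‖ * (‖s‖ * (n : ℝ) ^ (-s.re - 1))) (x := n) (y := n + 1)
    (fun y hy => ((((hasDerivAt_id (y : ℂ)).comp_ofReal).const_mul _).add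
      (cpow_deriv (1 - s) (hn0.trans_le hy.1))).hasDerivWithinAt) (fun y hy => by
      have e1 : (s - 1) * ((n + 1 : ℕ) : ℂ) ^ (-s) * 1 + (1 - s) * (y : ℂ) ^ (1 - s - 1) =
        (s - 1) * ((((n + 1 : ℝ)) : ℂ) ^ (-s) - (y : ℂ) ^ (-s)) := by
          rw [show 1 - s - 1 = -s by ring]; push_cast; ring
      rw [e1, norm_mul]
      refine mul_le_mul_of_nonneg_left (cpow_diff hs hn0 hy.1 (by linarith) ?_) (norm_nonneg _)
      rw [abs_of_nonneg] <;> linarith [hy.1, hy.2])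
    (convex_Icc _ _) ⟨le_refl _, by linarith⟩ ⟨by linarith, le_refl _⟩
  simp only [add_sub_cancel_left, norm_one, mul_one] at this
  refine le_of_eq_of_le (congrArg norm ?_) this
  unfold Gt; push_cast; ring

lemma Gt_diff {n : ℕ} (hn : 1 ≤ n) : Differentiable ℂ (Gt n) := by
  unfold Gt
  have h1 : ((n : ℕ) : ℂ) ≠ 0 := by exact_mod_cast (by omega : n ≠ 0)
  have h2 : (((n + 1 : ℕ) : ℕ) : ℂ) ≠ 0 := by exact_mod_cast (by omega : n + 1 ≠ 0)
  have d1 : Differentiable ℂ fun s : ℂ => ((n + 1 : ℕ) : ℂ) ^ (-s) := fun s =>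
    (differentiableAt_id.neg).const_cpow (Or.inl h2)
  have d2 : Differentiable ℂ fun s : ℂ => ((n + 1 : ℕ) : ℂ) ^ (1 - s) := fun s =>
    ((differentiableAt_const _).sub differentiableAt_id).const_cpow (Or.inl h2)
  have d3 : Differentiable ℂ fun s : ℂ => (n : ℂ) ^ (1 - s) := fun s =>
    ((differentiableAt_const _).sub differentiableAt_id).const_cpow (Or.inl h1)
  fun_prop

lemma Gt_sum (N K : ℕ) (s : ℂ) : ∑ m ∈ Finset.range K, Gt (N + m) s =
    (s - 1) * ∑ m ∈ Finset.range K, ((N + m + 1 : ℕ) : ℂ) ^ (-s) - (N : ℂ) ^ (1 - s) +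
      ((N + K : ℕ) : ℂ) ^ (1 - s) := by
  induction K with
  | zero => simp
  | succ K ih =>
    rw [Finset.sum_range_succ, ih, Finset.sum_range_succ, Gt]
    simp only [Nat.add_assoc]; ring

lemma zeta1_formula {N : ℕ} (hN : 1 ≤ N) {s : ℂ} (hs : 0 < s.re) :
    riemannZeta₁ s = (s - 1) * ∑ n ∈ Finset.range N, ((n + 1 : ℕ) : ℂ) ^ (-s) + (N : ℂ) ^ (1 - s) +
      ∑' m, Gt (N + m) s := by
  set H : ℂ → ℂ := fun s => (s - 1) * ∑ n ∈ Finset.range N, ((n + 1 : ℕ) : ℂ) ^ (-s) + (N : ℂ) ^ (1 - s) +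
      ∑' m, Gt (N + m) s with hH
  have hopen : IsOpen {s : ℂ | 0 < s.re} := isOpen_lt continuous_const Complex.continuous_re
  have hsum : ∀ {c : ℝ}, 0 < c → Summable fun m : ℕ => ((N + m : ℕ) : ℝ) ^ (-c - 1) := fun {c} hc => by
    have := (Real.summable_nat_rpow (p := -c - 1)).2 (by linarith)
    exact ((summable_nat_add_iff N).2 this).congr fun m => by rw [add_comm]
  have hdiff : DifferentiableOn ℂ H {s : ℂ | 0 < s.re} := by
    have d0 : Differentiable ℂ fun s : ℂ => (s - 1) * ∑ n ∈ Finset.range N, ((n + 1 : ℕ) : ℂ) ^ (-s) +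
        (N : ℂ) ^ (1 - s) := by
      have h1 : ((N : ℕ) : ℂ) ≠ 0 := by exact_mod_cast (by omega : N ≠ 0)
      have d3 : Differentiable ℂ fun s : ℂ => (N : ℂ) ^ (1 - s) := fun s =>
        ((differentiableAt_const _).sub differentiableAt_id).const_cpow (Or.inl h1)
      have d4 : Differentiable ℂ fun s : ℂ => ∑ n ∈ Finset.range N, ((n + 1 : ℕ) : ℂ) ^ (-s) := by
        refine Differentiable.fun_sum fun n _ => fun s => ?_
        exact (differentiableAt_id.neg).const_cpow (Or.inl (by exact_mod_cast (by omega : n + 1 ≠ 0)))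
      fun_prop
    refine d0.differentiableOn.add fun z hz => ?_
    have hz' : 0 < z.re := hz
    refine DifferentiableAt.differentiableWithinAt ?_
    have hU : IsOpen ({s : ℂ | z.re / 2 < s.re} ∩ Metric.ball 0 (‖z‖ + 1)) :=
      (isOpen_lt continuous_const Complex.continuous_re).inter Metric.isOpen_ball
    refine (Complex.differentiableOn_tsum_of_summable_norm
      (u := fun m => (‖z‖ + 2) * ((‖z‖ + 1) * ((N + m : ℕ) : ℝ) ^ (-(z.re / 2) - 1)))
      (((hsum (half_pos hz')).mul_left _).mul_left _)
      (fun m => (Gt_diff (n := N + m) (by omega)).differentiableOn) hU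
      fun m w hw => ?_).differentiableAt (hU.mem_nhds ⟨by simp; linarith, by simp⟩)
    obtain ⟨hw1, hw2⟩ := hw
    have hw1' : z.re / 2 < w.re := hw1
    rw [mem_ball_zero_iff] at hw2
    have hNm : (1 : ℝ) ≤ ((N + m : ℕ) : ℝ) := by exact_mod_cast (by omega : 1 ≤ N + m)
    refine (Gt_le (by omega) (by linarith)).trans ?_
    gcongr
    · refine (norm_sub_le _ _).trans ?_
      rw [norm_one]; linarith
  have hpre : IsPreconnected {s : ℂ | 0 < s.re} := (convex_halfSpace_re_gt 0).isPreconnected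
  refine AnalyticOnNhd.eqOn_of_preconnected_of_eventuallyEq (f := riemannZeta₁) (g := H)
    (differentiable_riemannZeta₁.differentiableOn.analyticOnNhd hopen)
    (hdiff.analyticOnNhd hopen) hpre (z₀ := 2) (by simp) ?_ hs
  have h2 : {s : ℂ | 1 < s.re} ∈ nhds (2 : ℂ) :=
    (isOpen_lt continuous_const Complex.continuous_re).mem_nhds (by simp)
  filter_upwards [h2] with w hw
  have hw' : 1 < w.re := hw
  have hw1 : w ≠ 1 := fun h => by rw [h] at hw'; simp at hw'
  have hz : riemannZeta₁ w = (w - 1) * riemannZeta w := by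
    rw [riemannZeta_eq_inv_sub_mul hw1, mul_inv_cancel_left₀ (sub_ne_zero.2 hw1)]
  have hs1 : Summable fun n : ℕ => ((n + 1 : ℕ) : ℂ) ^ (-w) := by
    have := (summable_nat_add_iff 1).2 (Complex.summable_one_div_nat_cpow.2 hw')
    exact this.congr fun n => by rw [Complex.cpow_neg, one_div]
  have hz2 : riemannZeta w = ∑' n : ℕ, ((n + 1 : ℕ) : ℂ) ^ (-w) := by
    rw [zeta_eq_tsum_one_div_nat_add_one_cpow hw']
    exact tsum_congr fun n => by rw [Complex.cpow_neg, one_div]; push_cast; rfl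
  have hlim : Tendsto (fun K => ∑ m ∈ Finset.range K, Gt (N + m) w) atTop
      (nhds ((w - 1) * (∑' m : ℕ, ((N + m + 1 : ℕ) : ℂ) ^ (-w)) - (N : ℂ) ^ (1 - w) + 0)) := by
    simp only [Gt_sum]
    have hs2 : Summable fun m : ℕ => ((N + m + 1 : ℕ) : ℂ) ^ (-w) :=
      ((summable_nat_add_iff N).2 hs1).congr fun m => by congr 2; omega
    refine ((hs2.hasSum.tendsto_sum_nat.const_mul _).sub_const _).add ?_
    rw [tendsto_zero_iff_norm_tendsto_zero]
    have : Tendsto (fun K : ℕ => ((N + K : ℕ) : ℝ) ^ (-(w.re - 1))) atTop (nhds 0) :=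
      (tendsto_rpow_neg_atTop (by linarith)).comp (tendsto_natCast_atTop_atTop.comp
        (tendsto_add_atTop_nat N |>.congr fun m => by omega))
    refine this.congr fun K => ?_
    rw [Complex.norm_natCast_cpow_of_pos (by omega)]
    congr 1; simp
  have hG : Summable fun m => Gt (N + m) w := by
    refine Summable.of_norm_bounded (((hsum (c := w.re) (by linarith)).mul_left _).mul_left _)
      fun m => Gt_le (by omega) (by linarith)
  have := tendsto_nhds_unique hG.hasSum.tendsto_sum_nat hlim
  simp only [hH]
  rw [this, hz, hz2, ← hs1.sum_add_tsum_nat_add N]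
  have : ∀ m, ((m + N + 1 : ℕ) : ℂ) = ((N + m + 1 : ℕ) : ℂ) := fun m => by congr 1; omega
  simp only [this]
  ring

lemma zeta_approx : ∃ C0 > (0 : ℝ), ∀ (s : ℂ) (N : ℕ), 9 / 10 ≤ s.re → s ≠ 1 → 1 ≤ N →
    ‖riemannZeta s‖ ≤ ‖∑ n ∈ Finset.range N, ((n + 1 : ℕ) : ℂ) ^ (-s)‖ +
      (N : ℝ) ^ (1 - s.re) / ‖s - 1‖ + C0 * ‖s‖ * (N : ℝ) ^ (-(17 / 20) : ℝ) := by
  have hS : Summable fun m : ℕ => (m : ℝ) ^ (-(21 / 20) : ℝ) := Real.summable_nat_rpow.2 (by norm_num)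
  refine ⟨∑' m : ℕ, (m : ℝ) ^ (-(21 / 20) : ℝ) + 1, by positivity, fun s N hs hs1 hN => ?_⟩
  have hN1 : (1 : ℝ) ≤ N := by exact_mod_cast hN
  have hS' : Summable fun m : ℕ => ((N + m : ℕ) : ℝ) ^ (-(21 / 20) : ℝ) :=
    ((summable_nat_add_iff N).2 hS).congr fun m => by rw [add_comm]
  have hs0 : 0 < ‖s - 1‖ := norm_pos_iff.2 (sub_ne_zero.2 hs1)
  have hG : ‖∑' m, Gt (N + m) s‖ ≤ ‖s - 1‖ * (‖s‖ * ((N : ℝ) ^ (-(17 / 20) : ℝ) *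
      ∑' m : ℕ, ((N + m : ℕ) : ℝ) ^ (-(21 / 20) : ℝ))) := by
    refine tsum_of_norm_bounded (((hS'.hasSum.mul_left _).mul_left _).mul_left _) fun m => ?_
    refine (Gt_le (by omega) (by linarith)).trans ?_
    have hNm : (1 : ℝ) ≤ ((N + m : ℕ) : ℝ) := by exact_mod_cast (by omega : 1 ≤ N + m)
    gcongr
    calc ((N + m : ℕ) : ℝ) ^ (-s.re - 1) ≤ ((N + m : ℕ) : ℝ) ^ (-(17 / 20) + -(21 / 20) : ℝ) :=
          rpow_le_rpow_of_exponent_le hNm (by linarith)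
      _ = ((N + m : ℕ) : ℝ) ^ (-(17 / 20) : ℝ) * ((N + m : ℕ) : ℝ) ^ (-(21 / 20) : ℝ) :=
          rpow_add (by linarith) _ _
      _ ≤ _ := mul_le_mul_of_nonneg_right
          (rpow_le_rpow_of_nonpos (by linarith) (by push_cast; linarith [m.cast_nonneg (α := ℝ)])
            (by norm_num)) (by positivity)
  have hle : ∑' m : ℕ, ((N + m : ℕ) : ℝ) ^ (-(21 / 20) : ℝ) ≤ ∑' m : ℕ, (m : ℝ) ^ (-(21 / 20) : ℝ) + 1 := by
    have h1 := hS.sum_add_tsum_nat_add N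
    have h2 : 0 ≤ ∑ i ∈ Finset.range N, (i : ℝ) ^ (-(21 / 20) : ℝ) :=
      Finset.sum_nonneg fun i _ => by positivity
    have h3 : ∑' m : ℕ, ((N + m : ℕ) : ℝ) ^ (-(21 / 20) : ℝ) = ∑' m : ℕ, ((m + N : ℕ) : ℝ) ^ (-(21 / 20) : ℝ) :=
      tsum_congr fun m => by rw [add_comm]
    linarith
  rw [riemannZeta_eq_inv_sub_mul hs1, zeta1_formula hN (by linarith), mul_add, mul_add,
    inv_mul_cancel_left₀ (sub_ne_zero.2 hs1)]
  refine (norm_add₃_le).trans ?_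
  rw [norm_mul, norm_mul, norm_inv, Complex.norm_natCast_cpow_of_pos (by omega)]
  refine add_le_add (add_le_add le_rfl ?_) ?_
  · rw [div_eq_inv_mul]; simp
  · rw [inv_mul_le_iff₀ hs0]
    refine hG.trans ?_
    calc _ ≤ ‖s - 1‖ * (‖s‖ * ((N : ℝ) ^ (-(17 / 20) : ℝ) * (∑' m : ℕ, (m : ℝ) ^ (-(21 / 20) : ℝ) + 1))) := by
          gcongr
      _ = _ := by ring

end VK

namespace VK

lemma abel_le {w : ℕ → ℝ} (hw : ∀ n, w (n + 1) ≤ w n) (hw0 : ∀ n, 0 ≤ w n) (z : ℕ → ℂ) {A : ℕ} {D : ℝ}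
    (B : ℕ) (hAB : A ≤ B) (hD : ∀ B' ≤ B, ‖∑ n ∈ Finset.Ioc A B', z n‖ ≤ D) :
    ‖∑ n ∈ Finset.Ioc A B, (w n : ℂ) * z n‖ ≤ w (A + 1) * D := by
  have key : ∀ B, A ≤ B → (∀ B' ≤ B, ‖∑ n ∈ Finset.Ioc A B', z n‖ ≤ D) →
      ‖∑ n ∈ Finset.Ioc A B, (w n : ℂ) * z n - w (B + 1) * ∑ n ∈ Finset.Ioc A B, z n‖ ≤
        D * (w (A + 1) - w (B + 1)) := by
    intro B hB
    induction B, hB using Nat.le_induction with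
    | base => intro _; simp
    | succ B hB ih =>
      intro hD
      have h1 := ih fun B' h => hD B' (by omega)
      have h2 := hD (B + 1) le_rfl
      have e1 : ∑ n ∈ Finset.Ioc A (B + 1), (w n : ℂ) * z n - w (B + 1 + 1) * ∑ n ∈ Finset.Ioc A (B + 1), z n =
        (∑ n ∈ Finset.Ioc A B, (w n : ℂ) * z n - w (B + 1) * ∑ n ∈ Finset.Ioc A B, z n) +
          ((w (B + 1) - w (B + 1 + 1) : ℝ) : ℂ) * ∑ n ∈ Finset.Ioc A (B + 1), z n := by
        rw [Finset.sum_Ioc_succ_top (by omega), Finset.sum_Ioc_succ_top (by omega)]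
        push_cast; ring
      rw [e1]
      refine (norm_add_le _ _).trans ?_
      rw [norm_mul, Complex.norm_real, Real.norm_of_nonneg (by linarith [hw (B + 1)])]
      have h3 := mul_le_mul_of_nonneg_left h2 (by linarith [hw (B + 1)] : 0 ≤ w (B + 1) - w (B + 1 + 1))
      linarith
  have h1 := key B hAB hD
  have h2 := hD B le_rfl
  have h3 := norm_sub_norm_le (∑ n ∈ Finset.Ioc A B, (w n : ℂ) * z n) (w (B + 1) * ∑ n ∈ Finset.Ioc A B, z n)
  rw [norm_mul (w (B + 1) : ℂ), Complex.norm_real, Real.norm_of_nonneg (hw0 _)] at h3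
  have h4 := mul_le_mul_of_nonneg_left h2 (hw0 (B + 1))
  linarith

lemma cpow_eq_e {n : ℕ} (hn : 1 ≤ n) (σ t : ℝ) :
    (n : ℂ) ^ (-(σ + t * Complex.I)) = ((n : ℝ) ^ (-σ) : ℝ) * e (-t * log n) := by
  have hn0 : (0 : ℝ) < n := by exact_mod_cast hn
  have hn1 : (n : ℂ) ≠ 0 := by exact_mod_cast hn0.ne'
  rw [neg_add, Complex.cpow_add _ _ hn1]
  congr 1
  · rw [Complex.ofReal_cpow hn0.le]; push_cast; rfl
  · rw [e, Complex.cpow_def_of_ne_zero hn1, ← Complex.natCast_log]; congr 1; push_cast; ring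

lemma cubic_bound {η ρ L : ℝ} (hL : 1 ≤ L) (hη : η ≤ L ^ (-(2 / 3) : ℝ)) (hρ : 0 ≤ ρ) :
    5 * ρ * η - ρ ^ 3 / (70000 * L ^ 2) ≤ 3000 := by
  have hL0 : 0 < L := by linarith
  set v := L ^ (-(2 / 3) : ℝ) with hv
  have hv0 : 0 < v := by positivity
  have hv3 : v ^ 3 = 1 / L ^ 2 := by
    rw [hv, ← rpow_natCast, ← rpow_mul hL0.le, one_div, ← rpow_natCast, ← rpow_neg hL0.le]; norm_num
  have e1 : ρ ^ 3 / (70000 * L ^ 2) = (ρ * v) ^ 3 / 70000 := by rw [mul_pow, hv3]; field_simp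
  have h1 : ρ * η ≤ ρ * v := mul_le_mul_of_nonneg_left hη hρ
  have hy : 0 ≤ ρ * v := by positivity
  rw [e1]
  set y := ρ * v
  rcases le_total y 600 with h | h
  · have : 0 ≤ y ^ 3 / 70000 := by positivity
    linarith
  · have : y * 600 ^ 2 ≤ y ^ 3 := by
      calc y * 600 ^ 2 ≤ y * y ^ 2 := by gcongr
        _ = _ := by ring
    linarith

lemma block_bound {r : ℕ} (hr : 1 ≤ r) {σ t : ℝ} (ht : (16 : ℝ) ^ r ≤ t) (hL : 1 ≤ log t) (hσ0 : 0 ≤ σ)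
    (hσ : 1 - (log t) ^ (-(2 / 3) : ℝ) ≤ σ) :
    ‖∑ n ∈ Finset.Ioc (32 ^ r : ℕ) (32 ^ (r + 1) : ℕ), (n : ℂ) ^ (-(σ + t * Complex.I))‖ ≤ 200 * exp 3000 := by
  have hP1 : 1 < 2 ^ r := Nat.one_lt_pow (by omega) (by norm_num)
  set P := 2 ^ r with hP
  have hPR : (1 : ℝ) < P := by exact_mod_cast hP1
  have hP0 : (0 : ℝ) < P := by linarith
  have ht1 : 1 ≤ t := le_trans (one_le_pow₀ (by norm_num)) ht
  obtain ⟨a, ha1, ha2⟩ := exists_nat_pow_near ht1 hPR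
  have hP4 : (P : ℝ) ^ 4 = 16 ^ r := by
    rw [hP]; push_cast; rw [← pow_mul, mul_comm, pow_mul]; norm_num
  have hP5 : P ^ 5 = 32 ^ r := by rw [hP, ← pow_mul, mul_comm, pow_mul]; norm_num
  have ha : 4 ≤ a := by
    have h1 : (P : ℝ) ^ 4 < (P : ℝ) ^ (a + 1) := by rw [hP4]; linarith
    have := (pow_lt_pow_iff_right₀ hPR).1 h1
    omega
  have haR : (4 : ℝ) ≤ a := by exact_mod_cast ha
  have hlP : 0 < log P := log_pos hPR
  have haL : a * log P ≤ log t := by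
    rw [← log_pow]; exact log_le_log (by positivity) ha1
  have hsum : ∀ B' : ℕ, B' ≤ 32 ^ (r + 1) → ‖∑ n ∈ Finset.Ioc (32 ^ r : ℕ) B', e (-t * log n)‖ ≤
      200 * (P : ℝ) ^ 5 * exp (-(log P / (70000 * a ^ 2))) := fun B' hB' => by
    rw [← hP5]
    exact expsum ha hP1.le ha1 ha2 le_rfl (by rw [hP5]; rw [pow_succ] at hB'; linarith)
  have h1 : ∑ n ∈ Finset.Ioc (32 ^ r : ℕ) (32 ^ (r + 1) : ℕ), (n : ℂ) ^ (-(σ + t * Complex.I)) =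
      ∑ n ∈ Finset.Ioc (32 ^ r : ℕ) (32 ^ (r + 1) : ℕ), (((if n = 0 then 1 else (n : ℝ) ^ (-σ)) : ℝ) : ℂ) * e (-t * log n) := by
    refine Finset.sum_congr rfl fun n hn => ?_
    rw [Finset.mem_Ioc] at hn
    rw [if_neg (by omega), cpow_eq_e (by omega)]
  rw [h1]
  refine (abel_le (w := fun n => if n = 0 then 1 else (n : ℝ) ^ (-σ)) (fun n => ?_) (fun n => ?_) _ _
    (pow_le_pow_right₀ (by norm_num) (by omega)) hsum).trans ?_
  · rw [if_neg (by omega)]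
    split_ifs with h
    · rw [h]; simp
    · exact rpow_le_rpow_of_nonpos (by exact_mod_cast (by omega : 0 < n)) (by push_cast; linarith) (by linarith)
  · split_ifs <;> positivity
  · rw [if_neg (by omega)]
    have h2 : ((32 ^ r + 1 : ℕ) : ℝ) ^ (-σ) ≤ ((P : ℝ) ^ 5) ^ (-σ) := by
      refine rpow_le_rpow_of_nonpos (by positivity) ?_ (by linarith)
      rw [← hP5]; push_cast; linarith
    have e3 : ((P : ℝ) ^ 5) ^ (-σ) * (200 * (P : ℝ) ^ 5 * exp (-(log P / (70000 * a ^ 2)))) =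
        200 * exp (5 * log P * (1 - σ) - log P / (70000 * a ^ 2)) := by
      have : (P : ℝ) ^ 5 = exp (5 * log P) := by
        rw [mul_comm, exp_mul, exp_log hP0]; norm_cast
      rw [this, ← exp_mul, show 5 * log P * (1 - σ) - log P / (70000 * (a : ℝ) ^ 2) =
        5 * log P * (-σ) + 5 * log P + -(log P / (70000 * (a : ℝ) ^ 2)) by ring, exp_add, exp_add]; ring
    refine (mul_le_mul_of_nonneg_right h2 (by positivity)).trans ?_
    rw [e3]
    gcongr
    have h4 := cubic_bound (η := 1 - σ) (ρ := log P) hL (by linarith) hlP.le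
    have h5 : log P ^ 3 / (70000 * log t ^ 2) ≤ log P / (70000 * a ^ 2) := by
      rw [div_le_div_iff₀ (by positivity) (by positivity)]
      have : (a * log P) ^ 2 ≤ log t ^ 2 := by gcongr
      have := mul_le_mul_of_nonneg_left this hlP.le
      linarith
    linarith

lemma zeta_bound : ∃ C > (0 : ℝ), ∀ σ t : ℝ, 1000 ≤ log t → 0 < t → 1 - (log t) ^ (-(2 / 3) : ℝ) ≤ σ → σ ≤ 3 →
    ‖riemannZeta (σ + t * Complex.I)‖ ≤ C * log t := by
  obtain ⟨C0, hC0, hz⟩ := zeta_approx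
  refine ⟨38 + 200 * exp 3000 + 4 * C0, by positivity, fun σ t hL ht0 hσ hσ3 => ?_⟩
  have hL0 : 0 < log t := by linarith
  have ht3 : 3 ≤ t := by
    have := log_le_sub_one_of_pos ht0
    linarith
  have hη : (log t) ^ (-(2 / 3) : ℝ) ≤ 1 / 10 := by
    calc (log t) ^ (-(2 / 3) : ℝ) ≤ ((10 : ℝ) ^ (3 : ℝ)) ^ (-(2 / 3) : ℝ) :=
          rpow_le_rpow_of_nonpos (by positivity) (by norm_num; exact hL) (by norm_num)
      _ = (10 : ℝ) ^ (-2 : ℝ) := by rw [← rpow_mul (by norm_num)]; norm_num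
      _ ≤ _ := by rw [rpow_neg (by norm_num)]; norm_num
  have hσ9 : 9 / 10 ≤ σ := by linarith
  set s : ℂ := σ + t * Complex.I with hs
  have hsre : s.re = σ := by simp [hs]
  have hsim : s.im = t := by simp [hs]
  have hs1 : s ≠ 1 := fun h => by rw [h] at hsim; simp at hsim; linarith
  obtain ⟨R, hR1, hR2⟩ := exists_nat_pow_near (by linarith : 1 ≤ t) (by norm_num : (1 : ℝ) < 16)
  have hRL : (R : ℝ) ≤ log t := by
    have h1 : R * log 16 ≤ log t := by rw [← log_pow]; exact log_le_log (by positivity) hR1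
    have h2 : 1 ≤ log 16 := by
      rw [le_log_iff_exp_le (by norm_num)]; have := exp_one_lt_d9; linarith
    nlinarith [R.cast_nonneg (α := ℝ)]
  have h := hz s (32 ^ (R + 1)) (by rw [hsre]; exact hσ9) hs1 (Nat.one_le_pow _ _ (by norm_num))
  have hsum : ‖∑ n ∈ Finset.range (32 ^ (R + 1)), ((n + 1 : ℕ) : ℂ) ^ (-s)‖ ≤ 32 + R * (200 * exp 3000) := by
    have e1 : ∑ n ∈ Finset.range (32 ^ (R + 1)), ((n + 1 : ℕ) : ℂ) ^ (-s) =
        ∑ n ∈ Finset.Ioc 0 (32 ^ (R + 1) : ℕ), (n : ℂ) ^ (-s) := by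
      rw [Finset.range_eq_Ico, Finset.sum_Ico_add' (fun n : ℕ => (n : ℂ) ^ (-s)) 0 _ 1]
      refine Finset.sum_congr (by ext; simp; omega) fun _ _ => rfl
    rw [e1]
    have : ∀ R' ≤ R, ‖∑ n ∈ Finset.Ioc 0 (32 ^ (R' + 1) : ℕ), (n : ℂ) ^ (-s)‖ ≤ 32 + R' * (200 * exp 3000) := by
      intro R' hR'
      induction R' with
      | zero =>
        refine (norm_sum_le_of_le (n := fun _ => (1 : ℝ)) _ fun n hn => ?_).trans (by simp)
        rw [Finset.mem_Ioc] at hn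
        rw [Complex.norm_natCast_cpow_of_pos hn.1, Complex.neg_re, hsre]
        exact rpow_le_one_of_one_le_of_nonpos (by exact_mod_cast hn.1) (by linarith)
      | succ r ih =>
        rw [← Finset.sum_Ioc_consecutive _ (Nat.zero_le (32 ^ (r + 1)))
          (pow_le_pow_right₀ (by norm_num) (by omega))]
        refine (norm_add_le _ _).trans ?_
        have h1 := block_bound (r := r + 1) (by omega) (σ := σ) (t := t)
          (le_trans (pow_le_pow_right₀ (by norm_num) hR') hR1) (by linarith) (by linarith) hσ
        have h2 := ih (by omega)
        push_cast; linarith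
    exact this R le_rfl
  have hNle : ((32 ^ (R + 1) : ℕ) : ℝ) ≤ (6 * t) ^ 2 := by
    push_cast
    calc (32 : ℝ) ^ (R + 1) = 32 * 32 ^ R := by ring
      _ ≤ 36 * (16 ^ 2) ^ R := by gcongr <;> norm_num
      _ = 36 * (16 ^ R) ^ 2 := by rw [← pow_mul, ← pow_mul, mul_comm 2 R]
      _ ≤ 36 * t ^ 2 := by gcongr
      _ = _ := by ring
  have hN1 : (1 : ℝ) ≤ ((32 ^ (R + 1) : ℕ) : ℝ) := by exact_mod_cast Nat.one_le_pow _ _ (by norm_num)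
  have h2 : ((32 ^ (R + 1) : ℕ) : ℝ) ^ (1 - s.re) / ‖s - 1‖ ≤ 6 := by
    have h3 : t ≤ ‖s - 1‖ := by
      have := Complex.abs_im_le_norm (s - 1)
      rw [Complex.sub_im, hsim, Complex.one_im, sub_zero, abs_of_pos ht0] at this
      exact this
    rw [div_le_iff₀ (by linarith), hsre]
    calc ((32 ^ (R + 1) : ℕ) : ℝ) ^ (1 - σ) ≤ ((32 ^ (R + 1) : ℕ) : ℝ) ^ (1 / 2 : ℝ) :=
          rpow_le_rpow_of_exponent_le hN1 (by linarith)
      _ ≤ ((6 * t) ^ 2) ^ (1 / 2 : ℝ) := by gcongr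
      _ = 6 * t := by rw [← sqrt_eq_rpow, sqrt_sq (by linarith)]
      _ ≤ _ := by linarith
  have h3 : C0 * ‖s‖ * ((32 ^ (R + 1) : ℕ) : ℝ) ^ (-(17 / 20) : ℝ) ≤ 4 * C0 := by
    have h4 : ‖s‖ ≤ 4 * t := by
      refine (Complex.norm_le_abs_re_add_abs_im s).trans ?_
      rw [hsre, hsim, abs_of_pos ht0, abs_of_nonneg (by linarith)]; linarith
    have h5 : ((32 ^ (R + 1) : ℕ) : ℝ) ^ (-(17 / 20) : ℝ) ≤ 1 / t := by
      rw [rpow_neg (by linarith), ← one_div]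
      apply one_div_le_one_div_of_le ht0
      refine hR2.le.trans ?_
      have : ((32 ^ (R + 1) : ℕ) : ℝ) = ((2 : ℝ) ^ (5 : ℝ)) ^ (R + 1) := by push_cast; norm_num
      rw [this, ← rpow_natCast (_ ^ _), ← rpow_mul (by norm_num), ← rpow_mul (by norm_num)]
      have : (16 : ℝ) ^ (R + 1) = (2 : ℝ) ^ (4 * ((R + 1 : ℕ) : ℝ)) := by
        rw [rpow_mul (by norm_num), rpow_natCast]; norm_num
      rw [this]
      refine rpow_le_rpow_of_exponent_le (by norm_num) ?_
      push_cast; nlinarith [R.cast_nonneg (α := ℝ)]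
    calc _ ≤ C0 * (4 * t) * (1 / t) := by gcongr
      _ = _ := by field_simp
  have h6 : (R : ℝ) * (200 * exp 3000) ≤ log t * (200 * exp 3000) := by gcongr
  have h7 : 4 * C0 * 1 ≤ 4 * C0 * log t := by gcongr; linarith
  linarith

end VK

namespace VK

lemma logder_bound {f : ℂ → ℂ} {R M : ℝ} (hf : Differentiable ℂ f) (hR : 0 < R) (hM : 0 < M)
    (h0 : ∀ z ∈ Metric.ball (0 : ℂ) R, f z ≠ 0) (hb : ∀ z ∈ Metric.ball (0 : ℂ) R, ‖f z‖ ≤ exp M * ‖f 0‖)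
    {z : ℂ} (hz : ‖z‖ ≤ R / 2) : ‖deriv f z / f z‖ ≤ 24 * M / R := by
  have hd : Differentiable ℂ (deriv f) := hf.contDiff.differentiable_deriv_two
  have hq : DifferentiableOn ℂ (fun z => deriv f z / f z) (Metric.ball 0 R) := fun w hw =>
    ((hd w).div (hf w) (h0 w hw)).differentiableWithinAt
  obtain ⟨h, hh0, hh⟩ := hq.isExactOn_ball.with_val_at 0 0
  have h00 : (0 : ℂ) ∈ Metric.ball (0 : ℂ) R := by simpa using hR
  have hconst : ∀ w ∈ Metric.ball (0 : ℂ) R, f w * Complex.exp (-h w) = f 0 := by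
    intro w hw
    have hder : ∀ u ∈ Metric.ball (0 : ℂ) R, HasDerivAt (fun u => f u * Complex.exp (-h u)) 0 u := by
      intro u hu
      have h8 := (hf u).hasDerivAt.mul ((hh u hu).neg.cexp)
      have hu0 := h0 u hu
      have h9 : deriv f u * Complex.exp ((-h) u) + f u * (Complex.exp ((-h) u) * -(deriv f u / f u)) = 0 := by
        field_simp; ring
      rw [h9] at h8
      exact h8
    have := Metric.isOpen_ball.is_const_of_deriv_eq_zero (convex_ball (0 : ℂ) R).isPreconnected
      (fun u hu => (hder u hu).differentiableAt.differentiableWithinAt)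
      (fun u hu => (hder u hu).deriv) hw h00
    rw [this, hh0]; simp
  have hre : Set.MapsTo h (Metric.ball 0 R) {z | z.re ≤ M} := by
    intro w hw
    have h1 : f w = f 0 * Complex.exp (h w) := by
      rw [← hconst w hw, mul_assoc, ← Complex.exp_add]; simp
    have h2 := hb w hw
    rw [h1, norm_mul, Complex.norm_exp, mul_comm] at h2
    have := le_of_mul_le_mul_right h2 (norm_pos_iff.2 (h0 0 h00))
    exact exp_le_exp.1 this
  have hdh : DifferentiableOn ℂ h (Metric.ball 0 R) := fun w hw => (hh w hw).differentiableAt.differentiableWithinAt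
  have hsub : Metric.closedBall z (R / 4) ⊆ Metric.ball 0 R := by
    intro w hw
    rw [mem_closedBall_iff_norm] at hw
    have := norm_le_norm_sub_add w z
    rw [mem_ball_zero_iff]; linarith
  have hzb : z ∈ Metric.ball (0 : ℂ) R := hsub (Metric.mem_closedBall_self (by positivity))
  have hC := Complex.norm_deriv_le_of_forall_mem_sphere_norm_le (f := h) (c := z) (R := R / 4) (C := 6 * M) (by positivity)
    (DifferentiableOn.diffContOnCl_ball hdh hsub) (fun w hw => by
      have hwb : w ∈ Metric.ball (0 : ℂ) R := hsub (Metric.sphere_subset_closedBall hw)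
      refine (Complex.borelCaratheodory_zero hM hdh hre hR hwb hh0).trans ?_
      have : ‖w‖ ≤ 3 * R / 4 := by
        have h1 := norm_le_norm_sub_add w z
        rw [mem_sphere_iff_norm] at hw
        linarith
      rw [div_le_iff₀ (by linarith)]
      nlinarith)
  rw [(hh z hzb).deriv] at hC
  refine hC.trans (le_of_eq ?_)
  field_simp; ring

lemma divide_zero {f : ℂ → ℂ} {R K : ℝ} {ρ : ℂ} (hf : Differentiable ℂ f) (hR : 0 < R) (hρR : ‖ρ‖ ≤ R / 2)
    (hρ : f ρ = 0) (h0 : f 0 ≠ 0) (hb : ∀ z, ‖z‖ ≤ R → ‖f z‖ ≤ K) :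
    ∃ g : ℂ → ℂ, Differentiable ℂ g ∧ (∀ z, ‖z‖ ≤ R → ‖g z‖ ≤ K) ∧ 2 * ‖f 0‖ ≤ ‖g 0‖ ∧
      (∀ z, ‖z‖ ≤ R → g z = 0 → f z = 0) ∧
      (deriv f 0 / f 0).re = (deriv g 0 / g 0).re - ρ.re * (1 / ‖ρ‖ ^ 2 - 1 / R ^ 2) := by
  have hρ0 : ρ ≠ 0 := fun h => h0 (h ▸ hρ)
  have hRc : (R : ℂ) ≠ 0 := by exact_mod_cast hR.ne'
  set q := dslope f ρ with hq
  have hqd : Differentiable ℂ q := by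
    rw [← differentiableOn_univ, hq, Complex.differentiableOn_dslope univ_mem]
    exact hf.differentiableOn
  set b : ℂ → ℂ := fun z => (R ^ 2 - (starRingEnd ℂ) ρ * z) / R with hbdef
  have hbd : Differentiable ℂ b := by fun_prop
  have hfq : ∀ z, f z = (z - ρ) * q z := fun z => by
    have := sub_smul_dslope f ρ z
    rw [hρ, sub_zero, smul_eq_mul] at this
    exact this.symm
  have hbz : ∀ z, ‖z‖ ≤ R → b z ≠ 0 := fun z hz h => by
    rw [hbdef, div_eq_zero_iff, or_iff_left hRc, sub_eq_zero] at h
    have := congrArg norm h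
    rw [norm_mul, norm_pow, Complex.norm_real, norm_of_nonneg hR.le, RCLike.norm_conj] at this
    have h2 : ‖ρ‖ * ‖z‖ ≤ R / 2 * R := by gcongr
    nlinarith
  have hbq : ∀ z, ‖z‖ ≤ R → b z * q z = 0 → f z = 0 := fun z hz h => by
    rw [mul_eq_zero, or_iff_right (hbz z hz)] at h
    rw [hfq, h, mul_zero]
  have hq0 : q 0 ≠ 0 := fun h => h0 (by rw [hfq, h, mul_zero])
  have hb0 : b 0 = R := by simp [hbdef, pow_two, hRc]
  refine ⟨fun z => b z * q z, hbd.mul hqd, ?_, ?_, hbq, ?_⟩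
  · intro z hz
    have hcl : closure (Metric.ball (0 : ℂ) R) = Metric.closedBall 0 R := closure_ball _ hR.ne'
    refine Complex.norm_le_of_forall_mem_frontier_norm_le (U := Metric.ball (0 : ℂ) R) Metric.isBounded_ball
      (hbd.mul hqd).diffContOnCl (fun w hw => ?_) (by rw [hcl]; simpa using hz)
    rw [frontier_ball _ hR.ne', mem_sphere_zero_iff_norm] at hw
    have hw2 : (R : ℂ) ^ 2 = w * (starRingEnd ℂ) w := by
      rw [Complex.mul_conj, Complex.normSq_eq_norm_sq, hw]; push_cast; rfl
    have h1 : ‖b w‖ = ‖w - ρ‖ := by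
      rw [hbdef]
      simp only
      rw [hw2, mul_comm _ w, ← mul_sub, ← map_sub, norm_div, norm_mul, RCLike.norm_conj, Complex.norm_real, hw, norm_of_nonneg hR.le]
      field_simp
    calc ‖b w * q w‖ = ‖f w‖ := by rw [hfq, norm_mul, norm_mul, h1]
      _ ≤ K := hb w hw.le
  · simp only
    rw [hfq 0, hb0, norm_mul, norm_mul, zero_sub, norm_neg, Complex.norm_real, norm_of_nonneg hR.le, ← mul_assoc]
    gcongr; linarith
  · have h1 : HasDerivAt f (1 * q 0 + (0 - ρ) * deriv q 0) 0 := by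
      have := ((hasDerivAt_id (0 : ℂ)).sub_const ρ).mul (hqd 0).hasDerivAt
      exact this.congr_of_eventuallyEq (Eventually.of_forall fun z => hfq z)
    have h2 : HasDerivAt (fun z => b z * q z) ((0 - (starRingEnd ℂ) ρ * 1) / R * q 0 + b 0 * deriv q 0) 0 := by
      have h3 : HasDerivAt b ((0 - (starRingEnd ℂ) ρ * 1) / R) 0 :=
        ((hasDerivAt_const _ _).sub ((hasDerivAt_id (0 : ℂ)).const_mul _)).div_const _
      exact h3.mul (hqd 0).hasDerivAt
    rw [h1.deriv, h2.deriv, hfq 0]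
    simp only [hb0]
    have h4 : ((1 : ℂ) * q 0 + (0 - ρ) * deriv q 0) / ((0 - ρ) * q 0) = deriv q 0 / q 0 - ρ⁻¹ := by
      field_simp; ring
    have h5 : ((0 - (starRingEnd ℂ) ρ * 1) / R * q 0 + R * deriv q 0) / (R * q 0) =
        deriv q 0 / q 0 - (starRingEnd ℂ) ρ / ((R ^ 2 : ℝ) : ℂ) := by
      push_cast; field_simp; ring
    rw [h4, h5, Complex.sub_re, Complex.sub_re, Complex.inv_re, Complex.div_ofReal_re, Complex.conj_re,
      Complex.normSq_eq_norm_sq]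
    ring

lemma re_logder {R K : ℝ} (hR : 0 < R) (n : ℕ) : ∀ f : ℂ → ℂ, Differentiable ℂ f → f 0 ≠ 0 →
    (∀ z, ‖z‖ ≤ R → ‖f z‖ ≤ K) → K ≤ 2 ^ n * ‖f 0‖ → (∀ z, ‖z‖ ≤ R → f z = 0 → z.re ≤ 0) → ∀ M > 0,
    K ≤ exp M * ‖f 0‖ → -(deriv f 0 / f 0).re ≤ 48 * M / R := by
  induction n with
  | zero =>
    intro f hf h0 hb hK hz M hM hKM
    have hno : ∀ z ∈ Metric.ball (0 : ℂ) (R / 2), f z ≠ 0 := by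
      intro ρ hρ hfρ
      rw [mem_ball_zero_iff] at hρ
      obtain ⟨g, -, h1, h2, -⟩ := divide_zero hf hR hρ.le hfρ h0 hb
      have := h1 0 (by simpa using hR.le)
      have := norm_pos_iff.2 h0
      linarith
    have := logder_bound (z := 0) hf (by positivity) hM hno (fun z hz => (hb z (by
      rw [mem_ball_zero_iff] at hz; linarith)).trans hKM) (by simp; positivity)
    have h2 := (abs_le.1 (Complex.abs_re_le_norm (deriv f 0 / f 0))).1
    have h3 : 24 * M / (R / 2) = 48 * M / R := by field_simp; ring
    linarith
  | succ n ih =>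
    intro f hf h0 hb hK hz M hM hKM
    by_cases hno : ∀ z ∈ Metric.ball (0 : ℂ) (R / 2), f z ≠ 0
    · have := logder_bound (z := 0) hf (by positivity) hM hno (fun z hz => (hb z (by
        rw [mem_ball_zero_iff] at hz; linarith)).trans hKM) (by simp; positivity)
      have h2 := (abs_le.1 (Complex.abs_re_le_norm (deriv f 0 / f 0))).1
      have h3 : 24 * M / (R / 2) = 48 * M / R := by field_simp; ring
      linarith
    · push Not at hno
      obtain ⟨ρ, hρ, hfρ⟩ := hno
      rw [mem_ball_zero_iff] at hρ
      obtain ⟨g, hg, h1, h2, h3, h4⟩ := divide_zero hf hR hρ.le hfρ h0 hb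
      have hf0 := norm_pos_iff.2 h0
      have hg0 : g 0 ≠ 0 := norm_pos_iff.1 (by linarith)
      have h5 := ih g hg hg0 h1 (hK.trans (by rw [pow_succ, mul_assoc]; gcongr)) (fun z hz1 hz2 => hz z hz1 (h3 z hz1 hz2)) M hM
        (hKM.trans (by gcongr; linarith))
      have h6 : ρ.re * (1 / ‖ρ‖ ^ 2 - 1 / R ^ 2) ≤ 0 := by
        apply mul_nonpos_of_nonpos_of_nonneg (hz ρ (by linarith) hfρ)
        have : 0 < ‖ρ‖ := norm_pos_iff.2 fun h => h0 (h ▸ hfρ)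
        rw [sub_nonneg]
        apply one_div_le_one_div_of_le (by positivity)
        gcongr; linarith
      linarith

lemma re_logder' {f : ℂ → ℂ} {R M : ℝ} (hR : 0 < R) (hf : Differentiable ℂ f) (h0 : f 0 ≠ 0) (hM : 0 < M)
    (hb : ∀ z, ‖z‖ ≤ R → ‖f z‖ ≤ exp M * ‖f 0‖) (hz : ∀ z, ‖z‖ ≤ R → f z = 0 → z.re ≤ 0) :
    -(deriv f 0 / f 0).re ≤ 48 * M / R ∧
    ∀ d : ℝ, 0 < d → d ≤ R / 2 → f (-d : ℝ) = 0 → -(deriv f 0 / f 0).re ≤ 48 * M / R - 1 / d + d / R ^ 2 := by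
  obtain ⟨n, hn⟩ := pow_unbounded_of_one_lt (exp M) (by norm_num : (1 : ℝ) < 2)
  refine ⟨re_logder hR n f hf h0 hb (by gcongr) hz M hM le_rfl, fun d hd hdR hfd => ?_⟩
  have hnd : ‖((-d : ℝ) : ℂ)‖ = d := by rw [Complex.norm_real, norm_neg, norm_of_nonneg hd.le]
  obtain ⟨g, hg, h1, h2, h3, h4⟩ := divide_zero hf hR (by rw [hnd]; exact hdR) hfd h0 hb
  have hf0 := norm_pos_iff.2 h0
  have hg0 : g 0 ≠ 0 := norm_pos_iff.1 (by linarith)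
  have h5 := re_logder hR n g hg hg0 h1 (by gcongr; linarith) (fun z hz1 hz2 => hz z hz1 (h3 z hz1 hz2)) M hM
    (by gcongr; linarith)
  rw [hnd, Complex.ofReal_re] at h4
  have : -d * (1 / d ^ 2 - 1 / R ^ 2) = -(1 / d) + d / R ^ 2 := by field_simp; ring
  linarith

end VK

namespace VK

local notation "Λ" => ArithmeticFunction.vonMangoldt

lemma term_eq {σ : ℝ} (t : ℝ) (hσ : 0 < σ) (f : ℕ → ℂ) (n : ℕ) :
    LSeries.term f (σ + t * Complex.I) n = f n * (((n : ℝ) ^ (-σ) : ℝ) : ℂ) * e (-t * log n) := by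
  rcases Nat.eq_zero_or_pos n with rfl | hn
  · rw [LSeries.term_zero, Nat.cast_zero, zero_rpow (by linarith)]; simp
  · rw [LSeries.term_of_ne_zero (by omega), mul_assoc, ← cpow_eq_e hn, Complex.cpow_neg]; rfl

lemma re_e (x : ℝ) : (e x).re = cos x := by rw [e, Complex.exp_ofReal_mul_I_re]

lemma re_s (σ t : ℝ) : ((σ : ℂ) + t * Complex.I).re = σ := by simp
lemma im_s (σ t : ℝ) : ((σ : ℂ) + t * Complex.I).im = t := by simp

noncomputable def LD (s : ℂ) : ℂ := -deriv riemannZeta s / riemannZeta s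

lemma LD_sum {σ : ℝ} (t : ℝ) (hσ : 1 < σ) :
    HasSum (fun n : ℕ => ((Λ n : ℝ) : ℂ) * (((n : ℝ) ^ (-σ) : ℝ) : ℂ) * e (-t * log n)) (LD (σ + t * Complex.I)) := by
  have hs : 1 < ((σ : ℂ) + t * Complex.I).re := by rw [re_s]; exact hσ
  have h := (ArithmeticFunction.LSeriesSummable_vonMangoldt hs).LSeriesHasSum
  rw [ArithmeticFunction.LSeries_vonMangoldt_eq_deriv_riemannZeta_div hs] at h
  have h2 : LSeries.term (fun n => ((Λ n : ℝ) : ℂ)) (σ + t * Complex.I) = _ :=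
    funext fun n => term_eq t (by linarith) _ n
  rw [LSeriesHasSum, h2] at h
  exact h

lemma zeta_sum {σ : ℝ} (t : ℝ) (hσ : 1 < σ) :
    HasSum (fun n : ℕ => (((n : ℝ) ^ (-σ) : ℝ) : ℂ) * e (-t * log n)) (riemannZeta (σ + t * Complex.I)) := by
  have hs : 1 < ((σ : ℂ) + t * Complex.I).re := by rw [re_s]; exact hσ
  refine (LSeriesHasSum_one hs).congr_fun (fun n => ?_)
  rw [term_eq t (by linarith)]; simp

lemma LD_re {σ : ℝ} (t : ℝ) (hσ : 1 < σ) :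
    HasSum (fun n : ℕ => Λ n * (n : ℝ) ^ (-σ) * cos (t * log n)) (LD (σ + t * Complex.I)).re := by
  refine (Complex.hasSum_re (LD_sum t hσ)).congr_fun fun n => ?_
  rw [← Complex.ofReal_mul, Complex.re_ofReal_mul, re_e, neg_mul, cos_neg]

lemma LD_real {σ : ℝ} (hσ : 1 < σ) : HasSum (fun n : ℕ => Λ n * (n : ℝ) ^ (-σ)) (LD σ).re := by
  have := LD_re 0 hσ
  simpa using this

lemma zeta_real {σ : ℝ} (hσ : 1 < σ) : HasSum (fun n : ℕ => (n : ℝ) ^ (-σ)) (riemannZeta σ).re := by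
  have := Complex.hasSum_re (zeta_sum 0 hσ)
  simpa [e] using this

lemma three_four_one {σ : ℝ} (t : ℝ) (hσ : 1 < σ) :
    0 ≤ 3 * (LD σ).re + 4 * (LD (σ + t * Complex.I)).re + (LD (σ + (2 * t : ℝ) * Complex.I)).re := by
  have h := (((LD_real hσ).mul_left 3).add ((LD_re t hσ).mul_left 4)).add (LD_re (2 * t) hσ)
  refine h.nonneg fun n => ?_
  have h1 : 0 ≤ Λ n * (n : ℝ) ^ (-σ) := mul_nonneg ArithmeticFunction.vonMangoldt_nonneg (by positivity)
  have h2 : cos (2 * t * log n) = 2 * cos (t * log n) ^ 2 - 1 := by rw [mul_assoc, cos_two_mul]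
  have h3 : 0 ≤ Λ n * (n : ℝ) ^ (-σ) * (2 * (1 + cos (t * log n)) ^ 2) := by positivity
  simp only [h2]
  linarith

lemma zeta1_eq {s : ℂ} (hs : s ≠ 1) : riemannZeta₁ s = (s - 1) * riemannZeta s := by
  rw [riemannZeta_eq_inv_sub_mul hs, mul_inv_cancel_left₀ (sub_ne_zero.2 hs)]

lemma zeta1_ne {s : ℂ} (hs : 1 ≤ s.re) : riemannZeta₁ s ≠ 0 := by
  by_cases h : s = 1
  · rw [h]; simp
  · rw [zeta1_eq h]
    exact mul_ne_zero (sub_ne_zero.2 h) (riemannZeta_ne_zero_of_one_le_re hs)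

noncomputable def Q (s : ℂ) : ℂ := deriv riemannZeta₁ s / riemannZeta₁ s

lemma LD_eq {s : ℂ} (hs : s ≠ 1) (h0 : riemannZeta₁ s ≠ 0) : LD s = (s - 1)⁻¹ - Q s := by
  have h1 := sub_ne_zero.2 hs
  rw [LD, Q, deriv_riemannZeta_eq_neg_inv_sub_sq_mul_add hs, riemannZeta_eq_inv_sub_mul hs]
  field_simp; ring

lemma cont_Q {K : Set ℂ} (h : ∀ s ∈ K, riemannZeta₁ s ≠ 0) : ContinuousOn Q K := by
  have hd : Differentiable ℂ (deriv riemannZeta₁) := differentiable_riemannZeta₁.contDiff.differentiable_deriv_two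
  exact hd.continuous.continuousOn.div differentiable_riemannZeta₁.continuous.continuousOn h

lemma compact_region (T : ℝ) : ∃ δ > 0, ∃ C > 0, ∀ s : ℂ, 1 - δ ≤ s.re → s.re ≤ 2 → |s.im| ≤ T →
    riemannZeta₁ s ≠ 0 ∧ ‖Q s‖ ≤ C ∧ ‖riemannZeta₀ s‖ ≤ C ∧ ‖riemannZeta₁ s‖ ≤ C := by
  set K : Set ℂ := Set.Icc 1 2 ×ℂ Set.Icc (-T) T
  have hK : IsCompact K := isCompact_Icc.reProdIm isCompact_Icc
  have hU : IsOpen {s : ℂ | riemannZeta₁ s ≠ 0} :=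
    isOpen_ne_fun differentiable_riemannZeta₁.continuous continuous_const
  obtain ⟨δ, hδ, hsub⟩ := hK.exists_cthickening_subset_open hU (fun s hs => zeta1_ne hs.1.1)
  have hcp : IsCompact (Metric.cthickening δ K) := hK.cthickening
  obtain ⟨C1, hC1⟩ := hcp.exists_bound_of_continuousOn (cont_Q (fun s hs => hsub hs))
  obtain ⟨C2, hC2⟩ := hcp.exists_bound_of_continuousOn (differentiable_riemannZeta₀.continuous.continuousOn)
  obtain ⟨C3, hC3⟩ := hcp.exists_bound_of_continuousOn (differentiable_riemannZeta₁.continuous.continuousOn)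
  refine ⟨δ, hδ, max (max C1 C2) (max C3 1), by positivity, fun s h1 h2 h3 => ?_⟩
  have hs : s ∈ Metric.cthickening δ K := by
    refine Metric.mem_cthickening_of_dist_le s ((max s.re 1 : ℝ) + s.im * Complex.I) δ K ?_ ?_
    · rw [Complex.mem_reProdIm, re_s, im_s]
      exact ⟨⟨le_max_right _ _, max_le h2 (by norm_num)⟩, abs_le.1 h3⟩
    · have : s - (((max s.re 1 : ℝ) : ℂ) + s.im * Complex.I) = ((s.re - max s.re 1 : ℝ) : ℂ) := by
        apply Complex.ext <;> simp
      rw [dist_eq_norm, this, Complex.norm_real, norm_eq_abs, abs_le]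
      constructor
      · have : max s.re 1 ≤ s.re + δ := max_le (by linarith) (by linarith)
        linarith
      · have := le_max_left s.re 1
        linarith
  exact ⟨hsub hs, (hC1 s hs).trans (by simp), (hC2 s hs).trans (by simp), (hC3 s hs).trans (by simp)⟩

/-- bounds on the real axis -/
lemma real_bounds : ∃ C > 0, ∀ a : ℝ, 0 < a → a ≤ 1 → (riemannZeta ((1 + a : ℝ) : ℂ)).re ≤ C / a ∧
    (LD ((1 + a : ℝ) : ℂ)).re ≤ 1 / a + C := by
  obtain ⟨δ, hδ, C, hC, h⟩ := compact_region 1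
  refine ⟨C, hC, fun a ha ha1 => ?_⟩
  have hs : ((1 + a : ℝ) : ℂ) ≠ 1 := by
    intro h; have : (1 + a : ℝ) = 1 := by exact_mod_cast h
    linarith
  obtain ⟨h1, h2, h3, h4⟩ := h ((1 + a : ℝ) : ℂ) (by rw [Complex.ofReal_re]; linarith) (by rw [Complex.ofReal_re]; linarith) (by simp)
  have e1 : (((1 + a : ℝ) : ℂ) - 1)⁻¹ = ((a⁻¹ : ℝ) : ℂ) := by push_cast; rw [add_sub_cancel_left]
  constructor
  · rw [riemannZeta_eq_inv_sub_mul hs, e1, Complex.re_ofReal_mul, div_eq_inv_mul]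
    gcongr
    exact (Complex.re_le_norm _).trans h4
  · rw [LD_eq hs h1, e1, Complex.sub_re, Complex.ofReal_re, one_div]
    have := (abs_le.1 ((Complex.abs_re_le_norm (Q ((1 + a : ℝ) : ℂ))).trans h2)).1
    linarith

lemma zeta_lower : ∃ c > 0, ∀ a t : ℝ, 0 < a → a ≤ 1 → c * a ≤ ‖riemannZeta ((1 + a : ℝ) + t * Complex.I)‖ := by
  obtain ⟨C, hC, h⟩ := real_bounds
  refine ⟨1 / C, by positivity, fun a t ha ha1 => ?_⟩
  have hσ : 1 < 1 + a := by linarith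
  have hs : 1 < (((1 + a : ℝ) : ℂ) + t * Complex.I).re := by rw [re_s]; exact hσ
  have h1 := LSeries_one_mul_Lseries_moebius hs
  rw [LSeries_one_eq_riemannZeta hs] at h1
  have h2 : ‖LSeries (fun n => ((ArithmeticFunction.moebius n : ℤ) : ℂ)) (((1 + a : ℝ) : ℂ) + t * Complex.I)‖ ≤ C / a := by
    refine le_trans (tsum_of_norm_bounded (zeta_real hσ) fun n => ?_) (h a ha ha1).1
    rw [term_eq t (by linarith), norm_mul, norm_mul, norm_e, mul_one, Complex.norm_real, norm_of_nonneg (by positivity)]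
    apply mul_le_of_le_one_left (by positivity)
    rw [Complex.norm_intCast]
    exact_mod_cast ArithmeticFunction.abs_moebius_le_one
  have h3 := congrArg norm h1
  rw [norm_mul, norm_one] at h3
  have h4 := mul_le_mul_of_nonneg_left h2 (norm_nonneg (riemannZeta ((1 + a : ℝ) + t * Complex.I)))
  rw [h3, ← mul_div_assoc, le_div_iff₀ ha] at h4
  rw [div_mul_eq_mul_div, div_le_iff₀ hC]
  exact h4

end VK

namespace VK

lemma zeta_bound' : ∃ C > (0 : ℝ), ∀ σ t : ℝ, 1000 ≤ log t → 1 - (log t) ^ (-(2 / 3) : ℝ) ≤ σ → σ ≤ 3 →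
    ‖riemannZeta (σ + t * Complex.I)‖ ≤ C * log t := by
  obtain ⟨C, hC, h⟩ := zeta_bound
  refine ⟨C, hC, fun σ t ht h1 h2 => ?_⟩
  rcases lt_trichotomy t 0 with h0 | h0 | h0
  · have h3 := h σ (-t) (by rwa [log_neg_eq_log]) (by linarith) (by rwa [log_neg_eq_log]) h2
    rw [log_neg_eq_log] at h3
    have e1 : (σ : ℂ) + (-t : ℝ) * Complex.I = (starRingEnd ℂ) (σ + t * Complex.I) := by
      apply Complex.ext <;> simp
    rwa [e1, riemannZeta_conj, RCLike.norm_conj] at h3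
  · rw [h0, log_zero] at ht; linarith
  · exact h σ t ht h0 h1 h2

lemma abs_ge_of_log {t : ℝ} (ht : 1000 ≤ log t) : 1001 ≤ |t| := by
  have : 0 < |t| := abs_pos.2 fun h => by rw [h, log_zero] at ht; linarith
  have := log_le_sub_one_of_pos this
  rw [log_abs] at this
  linarith

lemma log_near {t t' : ℝ} (ht : 1000 ≤ log t) (h1 : |t'| ≤ 2 * |t|) (h2 : |t| ≤ 2 * |t'|) :
    log t' ≤ log t + 1 ∧ log t - 1 ≤ log t' := by
  have h3 := abs_ge_of_log ht
  have h4 : 0 < |t'| := by linarith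
  have h2' : log 2 ≤ 1 := by linarith [log_two_lt_d9]
  constructor
  · have := log_le_log h4 h1
    rw [log_mul (by norm_num) (by linarith), log_abs, log_abs] at this
    linarith
  · have := log_le_log (by linarith) h2
    rw [log_mul (by norm_num) (by linarith), log_abs, log_abs] at this
    linarith

lemma log_near' {t u : ℝ} (ht : 1000 ≤ log t) (hu : |u| ≤ 1) :
    log (t + u) ≤ log t + 1 ∧ log t - 1 ≤ log (t + u) := by
  have h3 := abs_ge_of_log ht
  have h1 := abs_add_le t u
  have h2 := abs_sub_abs_le_abs_sub t (-u)
  rw [abs_neg, sub_neg_eq_add] at h2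
  exact log_near ht (by linarith) (by linarith)

lemma rpow_ratio {L L' p : ℝ} (hL : 1 ≤ L) (h : L' ≤ L + 1) (hL' : 1 ≤ L') (hp0 : 0 ≤ p) (hp : p ≤ 1) : L ^ (-p) / 2 ≤ L' ^ (-p) := by
  have h1 : (2 * L) ^ (-p) ≤ L' ^ (-p) := rpow_le_rpow_of_nonpos (by linarith) (by linarith) (by linarith)
  refine le_trans ?_ h1
  rw [mul_rpow (by norm_num) (by linarith), mul_comm, div_eq_mul_inv]
  gcongr
  rw [← rpow_neg_one]
  exact rpow_le_rpow_of_exponent_le (by norm_num) (by linarith)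

lemma center : ∃ L1 ≥ (1000 : ℝ), ∀ a t : ℝ, L1 ≤ log t → (log t)⁻¹ ≤ a → a ≤ 1 → ∀ z : ℂ,
    ‖z‖ ≤ (log t) ^ (-(2 / 3) : ℝ) / 2 →
    ‖riemannZeta₁ ((1 + a : ℝ) + t * Complex.I + z)‖ ≤
      exp (3 * log (log t)) * ‖riemannZeta₁ ((1 + a : ℝ) + t * Complex.I)‖ := by
  obtain ⟨C, hC, hz⟩ := zeta_bound'
  obtain ⟨c, hc, hlow⟩ := zeta_lower
  refine ⟨max 1001 (4 * C / c), le_trans (by norm_num) (le_max_left _ _), fun a t hL1 ha ha1 z hzn => ?_⟩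
  have hL : 1001 ≤ log t := (le_max_left _ _).trans hL1
  have hLC : 4 * C / c ≤ log t := (le_max_right _ _).trans hL1
  have hL0 : 0 < log t := by linarith
  have ha0 : 0 < a := lt_of_lt_of_le (by positivity) ha
  have ht := abs_ge_of_log (by linarith : 1000 ≤ log t)
  have hp1 : (log t) ^ (-(2 / 3) : ℝ) ≤ 1 := rpow_le_one_of_one_le_of_nonpos (by linarith) (by norm_num)
  have hzre := (abs_le.1 ((Complex.abs_re_le_norm z).trans hzn))
  have hzim : |z.im| ≤ 1 := ((Complex.abs_im_le_norm z).trans hzn).trans (by linarith)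
  obtain ⟨hn1, hn2⟩ := log_near' (by linarith : 1000 ≤ log t) hzim
  have hrat := rpow_ratio (L := log t) (L' := log (t + z.im)) (p := 2 / 3) (by linarith) hn1 (by linarith) (by norm_num) (by norm_num)
  set s0 : ℂ := (1 + a : ℝ) + t * Complex.I with hs0
  have hs : s0 + z = ((1 + a + z.re : ℝ) : ℂ) + (t + z.im : ℝ) * Complex.I := by
    apply Complex.ext <;> simp [hs0]
  have him : |t| ≤ ‖s0 - 1‖ := by
    have := Complex.abs_im_le_norm (s0 - 1)
    rwa [Complex.sub_im, hs0, im_s, Complex.one_im, sub_zero] at this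
  have hs01 : s0 ≠ 1 := fun h => by rw [h, sub_self, norm_zero] at him; linarith
  have hsz1 : s0 + z ≠ 1 := fun h => by
    have := congrArg Complex.im h
    rw [hs, im_s, Complex.one_im] at this
    rw [this, log_zero] at hn2; linarith
  have h1 := hz (1 + a + z.re) (t + z.im) (by linarith) (by linarith) (by linarith)
  rw [← hs] at h1
  have h2 := hlow a t ha0 ha1
  rw [← hs0] at h2
  rw [zeta1_eq hs01, zeta1_eq hsz1, norm_mul, norm_mul]
  have h3 : ‖s0 + z - 1‖ ≤ 2 * ‖s0 - 1‖ := by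
    rw [add_sub_right_comm]
    refine (norm_add_le _ _).trans ?_
    linarith
  have h4 : exp (3 * log (log t)) = (log t) ^ 3 := by
    rw [mul_comm, exp_mul, exp_log hL0]; norm_cast
  have h5 : ‖riemannZeta (s0 + z)‖ ≤ C * (2 * log t) := h1.trans (by gcongr; linarith)
  have h6 : 2 * (C * (2 * log t)) ≤ (log t) ^ 3 * ‖riemannZeta s0‖ := by
    have h7 : (log t) ^ 3 * (c * (log t)⁻¹) ≤ (log t) ^ 3 * ‖riemannZeta s0‖ := by
      gcongr
      exact le_trans (by gcongr) h2
    refine le_trans ?_ h7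
    rw [show (log t) ^ 3 * (c * (log t)⁻¹) = (log t * c) * log t by field_simp]
    rw [div_le_iff₀ hc] at hLC
    nlinarith
  rw [h4]
  calc ‖s0 + z - 1‖ * ‖riemannZeta (s0 + z)‖ ≤ (2 * ‖s0 - 1‖) * (C * (2 * log t)) := by gcongr
    _ = ‖s0 - 1‖ * (2 * (C * (2 * log t))) := by ring
    _ ≤ ‖s0 - 1‖ * ((log t) ^ 3 * ‖riemannZeta s0‖) := by gcongr
    _ = _ := by ring

lemma Q_shift (s0 : ℂ) (z : ℂ) : deriv (fun w => riemannZeta₁ (s0 + w)) z / riemannZeta₁ (s0 + z) = Q (s0 + z) := by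
  rw [Q, deriv_comp_const_add]

lemma re_Q : ∃ L1 ≥ (1000 : ℝ), ∀ a t : ℝ, L1 ≤ log t → (log t)⁻¹ ≤ a → a ≤ 1 →
    -(Q ((1 + a : ℝ) + t * Complex.I)).re ≤ 288 * (log (log t) * (log t) ^ (2 / 3 : ℝ)) ∧
    ∀ d : ℝ, a < d → d ≤ (log t) ^ (-(2 / 3) : ℝ) / 4 → riemannZeta₁ ((1 + a - d : ℝ) + t * Complex.I) = 0 →
    -(Q ((1 + a : ℝ) + t * Complex.I)).re ≤ 288 * (log (log t) * (log t) ^ (2 / 3 : ℝ)) - 1 / d + 4 * d * (log t) ^ (4 / 3 : ℝ) := by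
  obtain ⟨L1, hL1, h⟩ := center
  refine ⟨L1, hL1, fun a t hL ha ha1 => ?_⟩
  have hL0 : 0 < log t := by linarith
  have ha0 : 0 < a := lt_of_lt_of_le (by positivity) ha
  have hp : 0 < (log t) ^ (-(2 / 3) : ℝ) := by positivity
  have hM : 0 < 3 * log (log t) := by have := log_pos (by linarith : 1 < log t); linarith
  have h1 := re_logder' (f := fun w => riemannZeta₁ ((1 + a : ℝ) + t * Complex.I + w)) (R := (log t) ^ (-(2 / 3) : ℝ) / 2) (by positivity)
    (differentiable_riemannZeta₁.comp (by fun_prop)) (by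
      rw [add_zero]
      exact zeta1_ne (by rw [re_s]; linarith)) hM (fun z hz => by
      rw [add_zero]
      exact h a t hL ha ha1 z hz) (fun z hz h0 => by
      by_contra hcon
      refine zeta1_ne ?_ h0
      rw [Complex.add_re, re_s]; linarith)
  rw [Q_shift, add_zero] at h1
  have e1 : (log t) ^ (-(2 / 3) : ℝ) = ((log t) ^ (2 / 3 : ℝ))⁻¹ := rpow_neg hL0.le _
  have e2 : (log t) ^ (4 / 3 : ℝ) = ((log t) ^ (2 / 3 : ℝ)) ^ 2 := by
    rw [← rpow_natCast, ← rpow_mul hL0.le]; norm_num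
  have e3 : 48 * (3 * log (log t)) / ((log t) ^ (-(2 / 3) : ℝ) / 2) = 288 * (log (log t) * (log t) ^ (2 / 3 : ℝ)) := by
    rw [e1]; field_simp; ring
  rw [e3] at h1
  refine ⟨h1.1, fun d hd hdR h0 => ?_⟩
  have := h1.2 d (by linarith) (by linarith) (by
    convert h0 using 2; push_cast; ring)
  refine this.trans (le_of_eq ?_)
  rw [e1, e2]; field_simp; ring

lemma asym1 {ε κ : ℝ} (hε : 0 < ε) (hκ : 0 < κ) : ∃ L1 ≥ (1000 : ℝ), ∀ L ≥ L1,
    log L * L ^ (2 / 3 : ℝ) ≤ κ * L ^ (2 / 3 + ε) ∧ 1 ≤ κ * L ^ ε := by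
  have h1 := (isLittleO_log_rpow_atTop hε).bound hκ
  have h2 := ((tendsto_rpow_atTop hε).const_mul_atTop hκ).eventually_ge_atTop 1
  obtain ⟨L1, h⟩ := eventually_atTop.1 (h1.and h2)
  refine ⟨max L1 1000, le_max_right _ _, fun L hL => ?_⟩
  have hL' : (1000 : ℝ) ≤ L := (le_max_right _ _).trans hL
  obtain ⟨h3, h4⟩ := h L ((le_max_left _ _).trans hL)
  refine ⟨?_, h4⟩
  rw [norm_of_nonneg (log_nonneg (by linarith)), norm_of_nonneg (by positivity)] at h3
  rw [add_comm, rpow_add (by linarith), ← mul_assoc]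
  gcongr

end VK

namespace VK

lemma inv_re_le {a t : ℝ} (ha : 0 < a) (ha1 : a ≤ 1) (ht : 1 ≤ |t|) : ((((1 + a : ℝ) : ℂ) + t * Complex.I - 1)⁻¹).re ≤ 1 := by
  refine (Complex.re_le_norm _).trans ?_
  rw [norm_inv]
  apply inv_le_one_of_one_le₀
  have := Complex.abs_im_le_norm (((1 + a : ℝ) : ℂ) + t * Complex.I - 1)
  rw [Complex.sub_im, im_s, Complex.one_im, sub_zero] at this
  linarith

lemma zero_free {ε : ℝ} (hε : 0 < ε) (hε1 : ε ≤ 1 / 4) : ∃ L2 ≥ (1000 : ℝ), ∀ β t : ℝ, L2 ≤ log t →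
    1 - (log t) ^ (-(2 / 3 + ε)) ≤ β → riemannZeta₁ (β + t * Complex.I) ≠ 0 := by
  obtain ⟨L1, hL1, hQ⟩ := re_Q
  obtain ⟨L3, hL3, has⟩ := asym1 (ε := ε) (κ := 1 / 1000000) hε (by norm_num)
  obtain ⟨C, hC, hreal⟩ := real_bounds
  have hpp : 0 < 2 / 3 + ε := by linarith
  obtain ⟨L4, h4⟩ := eventually_atTop.1 (((tendsto_rpow_neg_atTop hpp).const_mul (3 * C + 5)).eventually
    (gt_mem_nhds (by norm_num : (3 * C + 5) * 0 < (1 / 1000 : ℝ))))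
  refine ⟨max (max L1 L3) L4, hL1.trans ((le_max_left _ _).trans (le_max_left _ _)), fun β t hL hβ h0 => ?_⟩
  have hLL1 : L1 ≤ log t := ((le_max_left _ _).trans (le_max_left _ _)).trans hL
  have hLL3 : L3 ≤ log t := ((le_max_right _ _).trans (le_max_left _ _)).trans hL
  have hδC := h4 (log t) ((le_max_right _ _).trans hL)
  have hL0 : 1000 ≤ log t := hL1.trans hLL1
  obtain ⟨ha1, ha2⟩ := has _ hLL3
  set L := log t with hLdef
  have hLp : 0 < L := by linarith
  set δ := L ^ (-(2 / 3 + ε)) with hδ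
  have hδ0 : 0 < δ := by positivity
  have hδinv : L ^ (2 / 3 + ε) = 1 / δ := by rw [hδ, rpow_neg hLp.le, one_div, inv_inv]
  rw [hδinv] at ha1
  have hβ1 : β < 1 := by
    by_contra hcon
    exact zeta1_ne (by rw [re_s]; linarith) h0
  have hδsmall : 1000 * δ ≤ 1 := by
    have : 5 * δ ≤ (3 * C + 5) * δ := by gcongr; linarith
    linarith
  have hδL : L⁻¹ ≤ δ := by
    rw [hδ, ← rpow_neg_one]
    exact rpow_le_rpow_of_exponent_le (by linarith) (by linarith)
  have hδR : 1000000 * δ ≤ L ^ (-(2 / 3) : ℝ) := by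
    rw [hδ, neg_add, rpow_add hLp, rpow_neg hLp.le ε]
    have h1 : 0 < L ^ ε := by positivity
    have h2 : 1000000 * (L ^ ε)⁻¹ ≤ 1 := by
      rw [← div_eq_mul_inv, div_le_one h1]; linarith
    have h3 : 0 < L ^ (-(2 / 3) : ℝ) := by positivity
    calc 1000000 * (L ^ (-(2 / 3) : ℝ) * (L ^ ε)⁻¹) = L ^ (-(2 / 3) : ℝ) * (1000000 * (L ^ ε)⁻¹) := by ring
      _ ≤ L ^ (-(2 / 3) : ℝ) * 1 := by gcongr
      _ = _ := mul_one _
  have ht := abs_ge_of_log hL0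
  set a := 10 * δ with ha
  have haL : L⁻¹ ≤ a := by linarith
  have ha0 : 0 < a := by positivity
  have ha1' : a ≤ 1 := by linarith
  have q1 := (hQ a t hLL1 haL ha1').2 (1 + a - β) (by linarith) (by linarith) (by
    convert h0 using 3; push_cast; ring)
  -- height 2t
  have hl2 : log (2 * t) = log 2 + L := log_mul (by norm_num) (fun h => by rw [h] at ht; simp at ht; linarith)
  have hl2' : log (2 * t) ≤ 2 * L := by linarith [log_two_lt_d9]
  have hl2'' : L ≤ log (2 * t) := by linarith [log_two_gt_d9]
  have q2 := (hQ a (2 * t) (by linarith) ((inv_anti₀ hLp hl2'').trans haL) ha1').1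
  have q3 := (has (log (2 * t)) (by linarith)).1
  have q4 : (log (2 * t)) ^ (2 / 3 + ε) ≤ 2 * (1 / δ) := by
    rw [← hδinv]
    calc (log (2 * t)) ^ (2 / 3 + ε) ≤ (2 * L) ^ (2 / 3 + ε) :=
        rpow_le_rpow (by linarith) hl2' (by linarith)
      _ = 2 ^ (2 / 3 + ε) * L ^ (2 / 3 + ε) := mul_rpow (by norm_num) hLp.le
      _ ≤ 2 ^ (1 : ℝ) * L ^ (2 / 3 + ε) := by
        gcongr
        · norm_num
        · linarith
      _ = _ := by rw [rpow_one]
  -- three-four-one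
  have h341 := three_four_one (σ := 1 + a) t (by linarith)
  have hr := (hreal a ha0 ha1').2
  have hne : ∀ u : ℝ, 1 ≤ |u| → (((1 + a : ℝ) : ℂ) + u * Complex.I) ≠ 1 := fun u hu h => by
    have := congrArg Complex.im h
    rw [im_s, Complex.one_im] at this
    rw [this] at hu; simp at hu; linarith
  have h2t : 1 ≤ |2 * t| := by rw [abs_mul, abs_two]; linarith
  rw [LD_eq (hne t (by linarith)) (zeta1_ne (by rw [re_s]; linarith)),
    LD_eq (hne (2 * t) h2t) (zeta1_ne (by rw [re_s]; linarith)), Complex.sub_re, Complex.sub_re] at h341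
  have r1 := inv_re_le ha0 ha1' (by linarith : 1 ≤ |t|)
  have r2 := inv_re_le ha0 ha1' h2t
  have hd : 1 + a - β ≤ 11 * δ := by linarith
  have hd0 : 0 < 1 + a - β := by linarith
  have d1 : 1 / (11 * δ) ≤ 1 / (1 + a - β) := one_div_le_one_div_of_le hd0 hd
  have d2 : 4 * (1 + a - β) * L ^ (4 / 3 : ℝ) ≤ 1 / 10000 * (1 / δ) := by
    have e2 : L ^ (4 / 3 : ℝ) = (L ^ (-(2 / 3) : ℝ))⁻¹ ^ 2 := by
      rw [rpow_neg hLp.le, inv_inv, ← rpow_natCast, ← rpow_mul hLp.le]; norm_num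
    have e3 : (L ^ (-(2 / 3) : ℝ))⁻¹ ≤ (1000000 * δ)⁻¹ := inv_anti₀ (by positivity) hδR
    calc 4 * (1 + a - β) * L ^ (4 / 3 : ℝ) ≤ 4 * (11 * δ) * (1000000 * δ)⁻¹ ^ 2 := by
          rw [e2]
          exact mul_le_mul (by linarith) (pow_le_pow_left₀ (by positivity) e3 2) (by positivity) (by positivity)
      _ = 44 / 1000000000000 * (1 / δ) := by field_simp; norm_num
      _ ≤ _ := mul_le_mul_of_nonneg_right (by norm_num) (by positivity)
  have e4 : 1 / (11 * δ) = 1 / 11 * (1 / δ) := by field_simp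
  have e5 : 1 / a = 1 / 10 * (1 / δ) := by rw [ha]; field_simp
  have hfin : (3 * C + 5) < 1 / 1000 * (1 / δ) := by
    rw [mul_one_div, lt_div_iff₀ hδ0]; exact hδC
  have hδi : 0 < 1 / δ := by positivity
  rw [e5] at hr
  rw [e4] at d1
  rw [← hLdef] at q1
  clear_value δ L
  linarith

lemma region_hi {ε : ℝ} (hε : 0 < ε) (hε1 : ε ≤ 1 / 4) : ∃ L2 ≥ (1000 : ℝ), ∃ C > 0, ∀ σ t : ℝ, L2 ≤ log t →
    1 - (log t) ^ (-(2 / 3 + ε)) ≤ σ → σ ≤ 2 → riemannZeta₁ (σ + t * Complex.I) ≠ 0 ∧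
    ‖Q (σ + t * Complex.I)‖ ≤ C * (log t) ^ 2 ∧ ‖riemannZeta₀ (σ + t * Complex.I)‖ ≤ C * (log t) ^ 2 := by
  obtain ⟨L1, hL1, hzf⟩ := zero_free (ε := ε / 2) (by positivity) (by linarith)
  obtain ⟨L5, hL5, hc⟩ := center
  obtain ⟨L3, hL3, has⟩ := asym1 (ε := ε / 2) (κ := 1 / 1000000) (by positivity) (by norm_num)
  obtain ⟨C, hC, hz⟩ := zeta_bound'
  refine ⟨max (max L1 L3) L5 + 1, by have := (le_max_left L1 L3).trans (le_max_left _ L5); linarith, C + 18, by positivity, fun σ t hL hσ hσ2 => ?_⟩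
  have hLL1 : L1 + 1 ≤ log t := by have := (le_max_left L1 L3).trans (le_max_left _ L5); linarith
  have hLL3 : L3 + 1 ≤ log t := by have := (le_max_right L1 L3).trans (le_max_left _ L5); linarith
  have hLL5 : L5 + 1 ≤ log t := by have := (le_max_right (max L1 L3) L5); linarith
  have hL0 : 1001 ≤ log t := by linarith
  obtain ⟨-, ha2⟩ := has (log t) (by linarith)
  have ht := abs_ge_of_log (by linarith : 1000 ≤ log t)
  have hnear : ∀ u : ℝ, |u| ≤ 1 → log (t + u) ≤ log t + 1 ∧ log t - 1 ≤ log (t + u) := fun u hu =>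
    log_near' (by linarith) hu
  have hcc := fun a => hc a t (by linarith)
  have hzz := hz σ t (by linarith)
  set L := log t with hLdef
  have hLp : 0 < L := by linarith
  set δ := L ^ (-(2 / 3 + ε)) with hδ
  have hδ0 : 0 < δ := by positivity
  have hδε : 1000000 * δ ≤ L ^ (-(2 / 3 + ε / 2)) := by
    rw [hδ, show -(2 / 3 + ε) = -(2 / 3 + ε / 2) + -(ε / 2) by ring, rpow_add hLp, rpow_neg hLp.le (ε / 2)]
    have h1 : 0 < L ^ (ε / 2) := by positivity
    have h2 : 1000000 * (L ^ (ε / 2))⁻¹ ≤ 1 := by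
      rw [← div_eq_mul_inv, div_le_one h1]; linarith
    calc 1000000 * (L ^ (-(2 / 3 + ε / 2)) * (L ^ (ε / 2))⁻¹) = L ^ (-(2 / 3 + ε / 2)) * (1000000 * (L ^ (ε / 2))⁻¹) := by ring
      _ ≤ L ^ (-(2 / 3 + ε / 2)) * 1 := by gcongr
      _ = _ := mul_one _
  have h23 : L ^ (-(2 / 3 + ε / 2)) ≤ L ^ (-(2 / 3) : ℝ) := rpow_le_rpow_of_exponent_le (by linarith) (by linarith)
  have h1 : L ^ (-(2 / 3) : ℝ) ≤ 1 := rpow_le_one_of_one_le_of_nonpos (by linarith) (by norm_num)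
  have hδL : L⁻¹ ≤ δ := by
    rw [hδ, ← rpow_neg_one]
    exact rpow_le_rpow_of_exponent_le (by linarith) (by linarith)
  have hlogL : 0 < log L := log_pos (by linarith)
  have hlogLL : log L ≤ L := by linarith [log_le_sub_one_of_pos hLp]
  set a := max (σ - 1) δ with ha
  have haδ : δ ≤ a := le_max_right _ _
  have haσ : σ - 1 ≤ a := le_max_left _ _
  have ha1 : a ≤ 1 := max_le (by linarith) (by linarith)
  have haσ2 : a ≤ σ - 1 + 2 * δ := max_le (by linarith) (by linarith)
  have hs : ((σ : ℂ) + t * Complex.I) = ((1 + a : ℝ) : ℂ) + t * Complex.I + ((σ - 1 - a : ℝ) : ℂ) := by push_cast; ring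
  have hnz : ∀ z ∈ Metric.ball (0 : ℂ) (4 * δ), riemannZeta₁ (((1 + a : ℝ) : ℂ) + t * Complex.I + z) ≠ 0 := by
    intro z hz
    rw [mem_ball_zero_iff] at hz
    have hre := (abs_le.1 ((Complex.abs_re_le_norm z).trans hz.le)).1
    have him : |z.im| ≤ 1 := ((Complex.abs_im_le_norm z).trans hz.le).trans (by linarith)
    obtain ⟨n1, n2⟩ := hnear z.im him
    have hrat := rpow_ratio (L := L) (L' := log (t + z.im)) (p := 2 / 3 + ε / 2) (by linarith) n1 (by linarith) (by linarith) (by linarith)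
    have := hzf (1 + a + z.re) (t + z.im) (by linarith) (by linarith)
    convert this using 2
    apply Complex.ext <;> simp
  have hzn : ‖((σ - 1 - a : ℝ) : ℂ)‖ ≤ 4 * δ / 2 := by
    rw [Complex.norm_real, norm_eq_abs, abs_le]; constructor <;> linarith
  have hne : (σ : ℂ) + t * Complex.I ≠ 1 := fun h => by
    have := congrArg Complex.im h
    rw [im_s, Complex.one_im] at this
    rw [this] at ht; simp at ht; linarith
  refine ⟨?_, ?_, ?_⟩
  · rw [hs]
    refine hnz _ ?_
    rw [mem_ball_zero_iff]; linarith
  · have := logder_bound (f := fun w => riemannZeta₁ (((1 + a : ℝ) : ℂ) + t * Complex.I + w)) (R := 4 * δ) (M := 3 * log L)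
      (differentiable_riemannZeta₁.comp (by fun_prop)) (by positivity) (by positivity) hnz (fun z hz => by
        rw [add_zero]
        rw [mem_ball_zero_iff] at hz
        exact hcc a (hδL.trans haδ) ha1 z (by linarith)) hzn
    rw [Q_shift, ← hs] at this
    refine this.trans ?_
    rw [div_le_iff₀ (by positivity)]
    have e1 : 1 ≤ δ * L := by
      have := mul_le_mul_of_nonneg_right hδL hLp.le
      rwa [inv_mul_cancel₀ hLp.ne'] at this
    have e2 : L ≤ L * (δ * L) := le_mul_of_one_le_right hLp.le e1
    have e3 : 0 ≤ C * (L * (δ * L)) := by positivity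
    nlinarith
  · have e1 : riemannZeta₀ (σ + t * Complex.I) = riemannZeta (σ + t * Complex.I) - (σ + t * Complex.I - 1)⁻¹ := by
      rw [riemannZeta_eq_inv_sub_add hne, add_sub_cancel_left]
    have e2 : ‖((σ : ℂ) + t * Complex.I - 1)⁻¹‖ ≤ 1 := by
      rw [norm_inv]
      apply inv_le_one_of_one_le₀
      have := Complex.abs_im_le_norm ((σ : ℂ) + t * Complex.I - 1)
      rw [Complex.sub_im, im_s, Complex.one_im, sub_zero] at this
      linarith
    rw [e1]
    refine (norm_sub_le _ _).trans ?_
    have e3 := hzz (by linarith) (by linarith)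
    have e4 : L ≤ L ^ 2 := by nlinarith
    have e5 : C * L ≤ C * L ^ 2 := by gcongr
    nlinarith

lemma region {ε : ℝ} (hε : 0 < ε) (hε1 : ε ≤ 1 / 4) : ∃ T0 ≥ (3 : ℝ), ∃ C > 0, ∀ T ≥ T0, ∀ s : ℂ, |s.im| ≤ T →
    1 - (log T) ^ (-(2 / 3 + ε)) ≤ s.re → s.re ≤ 2 → riemannZeta₁ s ≠ 0 ∧ ‖-Q s - riemannZeta₀ s‖ ≤ C * (log T) ^ 2 := by
  obtain ⟨L2, hL2, C1, hC1, h1⟩ := region_hi hε hε1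
  obtain ⟨δ, hδ, C2, hC2, h2⟩ := compact_region (exp L2)
  obtain ⟨L4, h4⟩ := eventually_atTop.1 ((tendsto_rpow_neg_atTop (by linarith : 0 < 2 / 3 + ε)).eventually (gt_mem_nhds hδ))
  have hm1 := le_max_left (max L2 L4) 3
  refine ⟨exp (max L2 L4), ?_, 2 * C1 + 2 * C2, by positivity, fun T hT s him hre hre2 => ?_⟩
  · have := add_one_le_exp (max L2 L4)
    have := le_max_left L2 L4
    linarith
  have hT0 : 0 < T := lt_of_lt_of_le (exp_pos _) hT
  have hlT : max L2 L4 ≤ log T := by rwa [le_log_iff_exp_le hT0]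
  have hL2' : L2 ≤ log T := (le_max_left _ _).trans hlT
  have hL4' := h4 (log T) ((le_max_right _ _).trans hlT)
  have hs : (s.re : ℂ) + s.im * Complex.I = s := Complex.re_add_im s
  by_cases hcase : |s.im| ≤ exp L2
  · obtain ⟨h3, h4, h5, -⟩ := h2 s (by linarith) hre2 hcase
    refine ⟨h3, (norm_sub_le _ _).trans ?_⟩
    rw [norm_neg]
    have : 1 ≤ (log T) ^ 2 := one_le_pow₀ (by linarith)
    have : 2 * C2 ≤ 2 * C2 * (log T) ^ 2 := le_mul_of_one_le_right (by positivity) this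
    have : 0 ≤ 2 * C1 * (log T) ^ 2 := by positivity
    linarith
  · push Not at hcase
    have hp : 0 < |s.im| := lt_trans (exp_pos _) hcase
    have hl1 : L2 ≤ log s.im := by rw [← log_abs, le_log_iff_exp_le hp]; exact hcase.le
    have hl2 : log s.im ≤ log T := by rw [← log_abs]; exact log_le_log hp him
    obtain ⟨h3, h4, h5⟩ := h1 s.re s.im hl1 (le_trans (sub_le_sub_left
      (rpow_le_rpow_of_nonpos (by linarith) hl2 (by linarith)) _) hre) hre2
    rw [hs] at h3 h4 h5
    refine ⟨h3, (norm_sub_le _ _).trans ?_⟩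
    rw [norm_neg]
    have : C1 * (log s.im) ^ 2 ≤ C1 * (log T) ^ 2 := by gcongr; linarith
    have : 0 ≤ 2 * C2 * (log T) ^ 2 := by positivity
    linarith

end VK

namespace VK
local notation "Λ" => ArithmeticFunction.vonMangoldt

noncomputable def KK (s : ℂ) : ℂ := 1 / s - 1 / (s + 1)

lemma KK_eq {s : ℂ} (hs : 0 < s.re) : KK s = (s * (s + 1))⁻¹ ∧ s ≠ 0 ∧ s + 1 ≠ 0 := by
  have h1 : s ≠ 0 := fun h => by rw [h] at hs; simp at hs
  have h2 : s + 1 ≠ 0 := fun h => by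
    have := congrArg Complex.re h
    simp at this; linarith
  exact ⟨by rw [KK]; field_simp; ring, h1, h2⟩

lemma norm_sq_s (c y : ℝ) : ‖(c : ℂ) + y * Complex.I‖ ^ 2 = c ^ 2 + y ^ 2 := by
  rw [Complex.sq_norm, Complex.normSq_add_mul_I]

lemma KK_norm {c : ℝ} (y : ℝ) (hc : 1 ≤ c) : ‖KK (c + y * Complex.I)‖ ≤ (1 + y ^ 2)⁻¹ := by
  rw [(KK_eq (by rw [re_s]; linarith)).1, norm_inv, norm_mul]
  apply inv_anti₀ (by positivity)
  have h1 := norm_sq_s c y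
  have h2 := norm_sq_s (c + 1) y
  have e2 : (((c + 1 : ℝ) : ℂ) + y * Complex.I) = c + y * Complex.I + 1 := by push_cast; ring
  rw [e2] at h2
  have h3 : ‖(c : ℂ) + y * Complex.I‖ ≤ ‖(c : ℂ) + y * Complex.I + 1‖ := by
    apply le_of_sq_le_sq _ (norm_nonneg _)
    rw [h1, h2]; nlinarith
  have h4 := mul_le_mul_of_nonneg_left h3 (norm_nonneg ((c : ℂ) + y * Complex.I))
  nlinarith

lemma KK_norm' {s : ℂ} (hc : 1 / 2 ≤ s.re) : ‖KK s‖ ≤ 4 := by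
  obtain ⟨h1, h2, h3⟩ := KK_eq (s := s) (by linarith)
  rw [h1, norm_inv, norm_mul]
  have h4 := (Complex.re_le_norm s)
  have h5 := (Complex.re_le_norm (s + 1))
  rw [Complex.add_re, Complex.one_re] at h5
  apply inv_le_of_inv_le₀ (by norm_num)
  nlinarith [norm_nonneg s]

lemma KK_cont {c : ℝ} (hc : 1 ≤ c) : Continuous fun y : ℝ => KK (c + y * Complex.I) := by
  have h := fun y : ℝ => KK_eq (s := c + y * Complex.I) (by rw [re_s]; linarith)
  unfold KK
  exact (continuous_const.div (by fun_prop) fun y => (h y).2.1).sub (continuous_const.div (by fun_prop) fun y => (h y).2.2)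

lemma KK_int {c : ℝ} (hc : 1 ≤ c) : Integrable fun y : ℝ => KK (c + y * Complex.I) := by
  refine integrable_inv_one_add_sq.mono' (KK_cont hc).aestronglyMeasurable (ae_of_all _ fun y => KK_norm y hc)

lemma perron {c u : ℝ} (hc : 1 ≤ c) (hu : 0 < u) :
    (1 / (2 * π)) • ∫ y : ℝ, (u : ℂ) ^ (-(c + y * Complex.I)) * KK (c + y * Complex.I) = ((max (1 - u) 0 : ℝ) : ℂ) := by
  set f : ℝ → ℂ := fun u => Set.indicator (Set.Ioc 0 1) (fun _ => 1 : ℝ → ℂ) u -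
    Set.indicator (Set.Ioc 0 1) (fun t => (t : ℂ) ^ (1 : ℂ) : ℝ → ℂ) u with hf
  have hm : ∀ s : ℂ, 0 < s.re → HasMellin f s (KK s) := fun s hs => by
    have h1 := hasMellin_one_Ioc hs
    have h2 := hasMellin_cpow_Ioc 1 (s := s) (by simp; linarith)
    have h3 := hasMellin_sub h1.1 h2.1
    rw [h1.2, h2.2] at h3
    exact h3
  have hpos : ∀ v : ℝ, 0 < v → f v = ((max (1 - v) 0 : ℝ) : ℂ) := fun v hv => by
    rw [hf]; dsimp only
    by_cases h : v ≤ 1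
    · have hm : v ∈ Set.Ioc (0 : ℝ) 1 := ⟨hv, h⟩
      rw [Set.indicator_of_mem hm, Set.indicator_of_mem hm, max_eq_left (by linarith)]; simp
    · rw [Set.indicator_of_notMem (fun h' => h h'.2), Set.indicator_of_notMem (fun h' => h h'.2), max_eq_right (by linarith)]; simp
  have hcont : ContinuousAt f u := by
    have : (fun v : ℝ => ((max (1 - v) 0 : ℝ) : ℂ)) =ᶠ[nhds u] f := by
      filter_upwards [lt_mem_nhds hu] with v hv using (hpos v hv).symm
    exact ContinuousAt.congr (by fun_prop) this
  have hv : ∀ y : ℝ, mellin f (c + y * Complex.I) = KK (c + y * Complex.I) := fun y =>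
    (hm _ (by rw [re_s]; linarith)).2
  have := mellinInv_mellin_eq c f hu (hm c (by simp; linarith)).1 (by
    refine (KK_int hc).congr (ae_of_all _ fun y => (hv y).symm)) hcont
  rw [mellinInv, hpos u hu] at this
  simp_rw [hv, smul_eq_mul] at this
  exact this

/-- the coefficient sequence -/
noncomputable def aa (n : ℕ) : ℝ := if n = 0 then 0 else Λ n - 1

noncomputable def FF (s : ℂ) : ℂ := -Q s - riemannZeta₀ s

lemma FF_eq {s : ℂ} (hs : 1 < s.re) : FF s = LD s - riemannZeta s := by
  have h1 : s ≠ 1 := fun h => by rw [h] at hs; simp at hs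
  rw [LD_eq h1 (zeta1_ne hs.le), riemannZeta_eq_inv_sub_add h1, FF]; ring

lemma FF_sum {c : ℝ} (t : ℝ) (hc : 1 < c) :
    HasSum (fun n : ℕ => (aa n : ℂ) * (((n : ℝ) ^ (-c) : ℝ) : ℂ) * e (-t * log n)) (FF (c + t * Complex.I)) := by
  rw [FF_eq (by rw [re_s]; exact hc)]
  refine ((LD_sum t hc).sub (zeta_sum t hc)).congr_fun fun n => ?_
  rcases Nat.eq_zero_or_pos n with rfl | hn
  · rw [Nat.cast_zero, zero_rpow (by linarith)]; simp
  · rw [aa, if_neg hn.ne']; push_cast; ring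

lemma aa_abs (n : ℕ) {c : ℝ} (hc : 1 < c) : |aa n| * (n : ℝ) ^ (-c) ≤ Λ n * (n : ℝ) ^ (-c) + (n : ℝ) ^ (-c) := by
  have h : |aa n| ≤ Λ n + 1 := by
    have := ArithmeticFunction.vonMangoldt_nonneg (n := n)
    rw [aa]; split_ifs
    · simp; linarith
    · rw [abs_le]; constructor <;> linarith
  have := mul_le_mul_of_nonneg_right h (rpow_nonneg (Nat.cast_nonneg n) (-c))
  linarith

lemma aa_summable {c : ℝ} (hc : 1 < c) : Summable fun n : ℕ => |aa n| * (n : ℝ) ^ (-c) :=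
  Summable.of_nonneg_of_le (fun n => mul_nonneg (abs_nonneg _) (by positivity)) (fun n => aa_abs n hc)
    ((LD_real hc).add (zeta_real hc)).summable

lemma FF_norm {c : ℝ} (t : ℝ) (hc : 1 < c) : ‖FF (c + t * Complex.I)‖ ≤ (LD c).re + (riemannZeta c).re := by
  rw [← (FF_sum t hc).tsum_eq]
  refine tsum_of_norm_bounded ((LD_real hc).add (zeta_real hc)) fun n => ?_
  rw [norm_mul, norm_mul, norm_e, mul_one, Complex.norm_real, Complex.norm_real, norm_eq_abs, norm_eq_abs,
    abs_of_nonneg (a := (n : ℝ) ^ (-c)) (by positivity)]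
  exact aa_abs n hc

noncomputable def W (x : ℝ) : ℝ := ∑ n ∈ Finset.Icc 1 ⌊x⌋₊, (Λ n - 1) * (1 - n / x)

lemma W_hasSum {x : ℝ} (hx : 0 < x) : HasSum (fun n : ℕ => aa n * max (1 - n / x) 0) (W x) := by
  have : W x = ∑ n ∈ Finset.Icc 1 ⌊x⌋₊, aa n * max (1 - n / x) 0 := by
    refine Finset.sum_congr rfl fun n hn => ?_
    rw [Finset.mem_Icc] at hn
    have h2 : (n : ℝ) ≤ x := (Nat.le_floor_iff hx.le).1 hn.2
    rw [aa, if_neg (by omega), max_eq_left]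
    rw [sub_nonneg, div_le_one hx]; exact h2
  rw [this]
  refine hasSum_sum_of_ne_finset_zero fun n hn => ?_
  rcases Nat.eq_zero_or_pos n with rfl | h
  · simp [aa]
  · rw [max_eq_right, mul_zero]
    rw [Finset.mem_Icc, not_and, Nat.le_floor_iff hx.le] at hn
    have := hn h
    rw [sub_nonpos, one_le_div hx]; linarith

lemma kernel_term {x c : ℝ} (hx : 0 < x) {n : ℕ} (hn : 1 ≤ n) (y : ℝ) :
    (((n / x : ℝ)) : ℂ) ^ (-(c + y * Complex.I)) = (x : ℂ) ^ (c + y * Complex.I) * ((((n : ℝ) ^ (-c) : ℝ) : ℂ) * e (-y * log n)) := by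
  have hx0 : (x : ℂ) ≠ 0 := by exact_mod_cast hx.ne'
  rw [← cpow_eq_e hn, div_eq_mul_inv, Complex.ofReal_mul, Complex.mul_cpow_ofReal_nonneg (by positivity) (by positivity),
    Complex.ofReal_inv, Complex.inv_cpow _ _ (by rw [Complex.arg_ofReal_of_nonneg hx.le]; exact pi_pos.ne),
    Complex.cpow_neg (x : ℂ), inv_inv, mul_comm]
  simp

lemma W_eq {x c : ℝ} (hx : 0 < x) (hc : 1 < c) :
    (W x : ℂ) = (1 / (2 * π)) • ∫ y : ℝ, (x : ℂ) ^ (c + y * Complex.I) * KK (c + y * Complex.I) * FF (c + y * Complex.I) := by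
  set F : ℕ → ℝ → ℂ := fun n y => (x : ℂ) ^ (c + y * Complex.I) * KK (c + y * Complex.I) *
    ((aa n : ℂ) * (((n : ℝ) ^ (-c) : ℝ) : ℂ) * e (-y * log n)) with hF
  have hx0 : (x : ℂ) ≠ 0 := by exact_mod_cast hx.ne'
  have hn : ∀ n y, ‖F n y‖ = x ^ c * (|aa n| * (n : ℝ) ^ (-c)) * ‖KK (c + y * Complex.I)‖ := fun n y => by
    rw [hF]; dsimp only
    rw [norm_mul, norm_mul, norm_mul, norm_mul, norm_e, mul_one, Complex.norm_real, Complex.norm_real, norm_eq_abs, norm_eq_abs,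
      abs_of_nonneg (a := (n : ℝ) ^ (-c)) (by positivity), Complex.norm_cpow_eq_rpow_re_of_pos hx, re_s]
    ring
  have hcF : ∀ n, Continuous (F n) := fun n => by
    have h1 : Continuous fun y : ℝ => (x : ℂ) ^ (c + y * Complex.I) :=
      Continuous.const_cpow (by fun_prop) (Or.inl hx0)
    have h2 : Continuous fun y : ℝ => e (-y * log n) := by unfold e; fun_prop
    exact (h1.mul (KK_cont hc.le)).mul (continuous_const.mul h2)
  have hint : ∀ n, Integrable (F n) := fun n => by
    refine (((KK_int hc.le).norm).const_mul (x ^ c * (|aa n| * (n : ℝ) ^ (-c)))).mono' (hcF n).aestronglyMeasurable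
      (ae_of_all _ fun y => (hn n y).le)
  have hsum : Summable fun n => ∫ y, ‖F n y‖ := by
    simp_rw [hn, integral_const_mul]
    exact ((aa_summable hc).mul_left _).mul_right _
  have h1 := (hasSum_integral_of_summable_integral_norm hint hsum).const_smul (1 / (2 * π))
  have h2 : ∀ y, ∑' n, F n y = (x : ℂ) ^ (c + y * Complex.I) * KK (c + y * Complex.I) * FF (c + y * Complex.I) := fun y =>
    ((FF_sum y hc).mul_left _).tsum_eq
  simp_rw [h2] at h1
  refine (HasSum.unique (h1.congr_fun fun n => ?_) (Complex.hasSum_ofReal.2 (W_hasSum hx))).symm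
  rcases Nat.eq_zero_or_pos n with rfl | hn1
  · simp [aa, hF]
  · have h3 : ∀ y, F n y = aa n * (((n / x : ℝ) : ℂ) ^ (-(c + y * Complex.I)) * KK (c + y * Complex.I)) := fun y => by
      rw [kernel_term hx hn1, hF]; ring
    simp_rw [h3]
    rw [integral_const_mul, ← mul_smul_comm, perron hc.le (by positivity)]
    push_cast; ring
end VK

namespace VK
local notation "Λ" => ArithmeticFunction.vonMangoldt

lemma KK_norm_im {s : ℂ} (hc : 0 < s.re) {T : ℝ} (hT : 1 ≤ T) (hi : |s.im| = T) : ‖KK s‖ ≤ 1 / T := by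
  obtain ⟨h1, h2, h3⟩ := KK_eq (s := s) hc
  rw [h1, norm_inv, norm_mul, one_div]
  have h4 := (Complex.abs_im_le_norm s)
  have h5 := (Complex.abs_im_le_norm (s + 1))
  rw [Complex.add_im, Complex.one_im, add_zero] at h5
  rw [hi] at h4 h5
  apply inv_anti₀ (by linarith)
  nlinarith [norm_nonneg s]

lemma arctan_tail {T : ℝ} (hT : 0 < T) : π - 2 * arctan T ≤ 2 / T := by
  have h := arctan_inv_of_pos hT
  have h2 : arctan T⁻¹ ≤ T⁻¹ := by
    have h3 : 0 < arctan T⁻¹ := arctan_pos.2 (by positivity)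
    have := (Real.lt_tan h3 (arctan_lt_pi_div_two _)).le
    rwa [tan_arctan] at this
  rw [div_eq_mul_inv]; linarith

lemma tail_bound {f : ℝ → ℂ} {D T : ℝ} (hT : 0 < T) (hf : Continuous f) (hb : ∀ y, ‖f y‖ ≤ D * (1 + y ^ 2)⁻¹) :
    ‖∫ y, f y‖ ≤ ‖∫ y in (-T)..T, f y‖ + D * (2 / T) := by
  have hi0 := integrable_inv_one_add_sq.const_mul D
  have hi : Integrable f := hi0.mono' hf.aestronglyMeasurable (ae_of_all _ hb)
  have hm : MeasurableSet (Set.Ioc (-T) T) := measurableSet_Ioc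
  rw [← integral_add_compl hm hi, ← intervalIntegral.integral_of_le (by linarith)]
  refine (norm_add_le _ _).trans (add_le_add le_rfl ?_)
  have h1 : ‖∫ y in (Set.Ioc (-T) T)ᶜ, f y‖ ≤ ∫ y in (Set.Ioc (-T) T)ᶜ, D * (1 + y ^ 2)⁻¹ :=
    norm_integral_le_of_norm_le hi0.integrableOn (ae_of_all _ hb)
  have h2 := integral_add_compl hm hi0
  rw [← intervalIntegral.integral_of_le (by linarith), integral_const_mul, integral_const_mul, intervalIntegral.integral_const_mul,
    integral_univ_inv_one_add_sq, integral_inv_one_add_sq, arctan_neg] at h2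
  rw [integral_const_mul] at h1
  have hD : 0 ≤ D := by have := (norm_nonneg _).trans (hb 0); simpa using this
  have h3 := mul_le_mul_of_nonneg_left (arctan_tail hT) hD
  linarith

lemma cont_line (c : ℝ) : Continuous fun y : ℝ => (c : ℂ) + y * Complex.I := by fun_prop

lemma contour {x c T δ B D : ℝ} (hx : 1 ≤ x) (hc : 1 < c) (hc2 : c ≤ 2) (hδ : 0 < δ) (hδ2 : δ ≤ 1 / 2) (hT : 1 ≤ T)
    (hreg : ∀ s : ℂ, |s.im| ≤ T → 1 - δ ≤ s.re → s.re ≤ 2 → riemannZeta₁ s ≠ 0 ∧ ‖FF s‖ ≤ B)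
    (hD : ∀ t : ℝ, ‖FF (c + t * Complex.I)‖ ≤ D) :
    |W x| ≤ x ^ c * D * (2 / T) + 4 * (x ^ c * B / T) + 8 * (T * x ^ (1 - δ) * B) := by
  have hx0 : 0 < x := by linarith
  have hx0' : (x : ℂ) ≠ 0 := by exact_mod_cast hx0.ne'
  have hB : 0 ≤ B := (norm_nonneg _).trans (hreg 1 (by simp; linarith) (by simp; linarith) (by simp)).2
  set g : ℂ → ℂ := fun s => (x : ℂ) ^ s * KK s * FF s with hg
  have hW := W_eq hx0 hc
  have hdQ : ∀ s, riemannZeta₁ s ≠ 0 → DifferentiableAt ℂ FF s := fun s hs => by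
    have hd : Differentiable ℂ (deriv riemannZeta₁) := differentiable_riemannZeta₁.contDiff.differentiable_deriv_two
    unfold FF Q
    exact (((hd s).div (differentiable_riemannZeta₁ s) hs).neg).sub (differentiable_riemannZeta₀ s)
  have hdg : ∀ s : ℂ, 0 < s.re → riemannZeta₁ s ≠ 0 → DifferentiableAt ℂ g s := fun s hs h => by
    obtain ⟨-, h2, h3⟩ := KK_eq hs
    have h4 : DifferentiableAt ℂ KK s := by
      unfold KK
      exact ((differentiableAt_const _).div differentiableAt_id h2).sub
        ((differentiableAt_const _).div (by fun_prop) h3)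
    exact ((differentiableAt_id.const_cpow (Or.inl hx0')).mul h4).mul (hdQ s h)
  have hcont : Continuous fun y : ℝ => g (c + y * Complex.I) := by
    rw [continuous_iff_continuousAt]
    intro y
    have := (hdg (c + y * Complex.I) (by rw [re_s]; linarith) (zeta1_ne (by rw [re_s]; linarith))).continuousAt
    exact ContinuousAt.comp (f := fun y : ℝ => (c : ℂ) + y * Complex.I) this (cont_line c).continuousAt
  have hgn : ∀ s : ℂ, ‖g s‖ = x ^ s.re * ‖KK s‖ * ‖FF s‖ := fun s => by
    rw [hg]; dsimp only
    rw [norm_mul, norm_mul, Complex.norm_cpow_eq_rpow_re_of_pos hx0]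
  have ht := tail_bound (D := x ^ c * D) (T := T) (by linarith) hcont (fun y => by
    rw [hgn, re_s, mul_assoc, mul_comm ‖KK _‖, mul_assoc]
    gcongr
    · exact (norm_nonneg _).trans (hD y)
    · exact hD y
    · exact KK_norm y hc.le)
  have hrect := Complex.integral_boundary_rect_eq_zero_of_differentiableOn g ((1 - δ : ℝ) + (-T : ℝ) * Complex.I) (c + T * Complex.I) (by
    intro s hs
    rw [re_s, re_s, im_s, im_s, Set.uIcc_of_le (by linarith), Set.uIcc_of_le (by linarith)] at hs
    have h1 : 1 - δ ≤ s.re := hs.1.1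
    have h2 : s.re ≤ c := hs.1.2
    have h3 : |s.im| ≤ T := abs_le.2 hs.2
    exact (hdg s (by linarith) (hreg s h3 h1 (by linarith)).1).differentiableWithinAt)
  rw [re_s, re_s, im_s, im_s] at hrect
  have hhor : ∀ y : ℝ, |y| = T → ‖∫ u in (1 - δ)..c, g (u + y * Complex.I)‖ ≤ 2 * (x ^ c * B / T) := fun y hy => by
    have h1 : ∀ u ∈ Set.uIoc (1 - δ) c, ‖g (u + y * Complex.I)‖ ≤ x ^ c * (1 / T) * B := fun u hu => by
      rw [Set.uIoc_of_le (by linarith)] at hu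
      obtain ⟨hu1, hu2⟩ := hu
      rw [hgn, re_s]
      have h4 := (hreg (u + y * Complex.I) (by rw [im_s, hy]) (by rw [re_s]; linarith) (by rw [re_s]; linarith)).2
      have h5 := KK_norm_im (s := u + y * Complex.I) (by rw [re_s]; linarith) hT (by rw [im_s, hy])
      gcongr
    refine (intervalIntegral.norm_integral_le_of_norm_le_const h1).trans ?_
    rw [abs_of_nonneg (by linarith)]
    have h6 : 0 ≤ x ^ c * (1 / T) * B := by positivity
    calc x ^ c * (1 / T) * B * (c - (1 - δ)) ≤ x ^ c * (1 / T) * B * 2 := mul_le_mul_of_nonneg_left (by linarith) h6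
      _ = _ := by ring
  have hver : ‖∫ y in (-T)..T, g ((1 - δ : ℝ) + y * Complex.I)‖ ≤ 8 * (T * x ^ (1 - δ) * B) := by
    have h1 : ∀ y ∈ Set.uIoc (-T) T, ‖g ((1 - δ : ℝ) + y * Complex.I)‖ ≤ x ^ (1 - δ) * 4 * B := fun y hy => by
      rw [Set.uIoc_of_le (by linarith)] at hy
      rw [hgn, re_s]
      have h4 := (hreg ((1 - δ : ℝ) + y * Complex.I) (by rw [im_s]; exact abs_le.2 ⟨hy.1.le, hy.2⟩) (by rw [re_s])
        (by rw [re_s]; linarith)).2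
      have h5 := KK_norm' (s := (1 - δ : ℝ) + y * Complex.I) (by rw [re_s]; linarith)
      gcongr
    refine (intervalIntegral.norm_integral_le_of_norm_le_const h1).trans ?_
    rw [abs_of_nonneg (by linarith)]
    apply le_of_eq; ring
  have h1 := hhor (-T) (by rw [abs_neg, abs_of_nonneg (by linarith)])
  have h2 := hhor T (by rw [abs_of_nonneg (by linarith)])
  set I1 := ∫ u in (1 - δ)..c, g (u + (-T : ℝ) * Complex.I)
  set I2 := ∫ u in (1 - δ)..c, g (u + T * Complex.I)
  set I3 := ∫ y in (-T)..T, g (c + y * Complex.I)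
  set I4 := ∫ y in (-T)..T, g ((1 - δ : ℝ) + y * Complex.I)
  have h3 : Complex.I • I3 = Complex.I • I4 - I1 + I2 := by linear_combination hrect
  have h4 : ‖I3‖ ≤ ‖I4‖ + ‖I1‖ + ‖I2‖ := by
    have : ‖I3‖ = ‖Complex.I • I3‖ := by rw [norm_smul, Complex.norm_I, one_mul]
    rw [this, h3]
    refine (norm_add_le _ _).trans ?_
    have := norm_sub_le (Complex.I • I4) I1
    rw [norm_smul, Complex.norm_I, one_mul] at this
    linarith
  have h5 : |W x| ≤ ‖∫ y : ℝ, g (c + y * Complex.I)‖ := by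
    rw [← norm_eq_abs, ← Complex.norm_real, hW, norm_smul]
    have : ‖1 / (2 * π)‖ ≤ 1 := by
      rw [norm_eq_abs, abs_of_pos (by positivity), div_le_one (by positivity)]
      linarith [pi_gt_three]
    exact mul_le_of_le_one_left (norm_nonneg _) this
  linarith

lemma ev_poly_exp {β c : ℝ} (C k : ℝ) (hβ : 0 < β) (hc : 0 < c) : ∀ᶠ L : ℝ in atTop, C * L ^ k ≤ exp (c * L ^ β) := by
  have h1 := (tendsto_rpow_mul_exp_neg_mul_atTop_nhds_zero (k / β) c hc).comp (tendsto_rpow_atTop hβ)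
  have h2 := (h1.const_mul C).eventually (gt_mem_nhds (show C * 0 < 1 by simp))
  filter_upwards [h2, eventually_gt_atTop 0] with L hL hL0
  simp only [Function.comp] at hL
  rw [← rpow_mul hL0.le, mul_div_cancel₀ _ hβ.ne', neg_mul, exp_neg, ← mul_assoc, ← div_eq_mul_inv, div_lt_one (exp_pos _)] at hL
  exact hL.le

lemma W_bound {ε : ℝ} (hε : 0 < ε) (hε1 : ε ≤ 1 / 4) : ∃ x0 ≥ 3, ∀ x ≥ x0, |W x| ≤ x * exp (-(1 / 2) * (log x) ^ (3 / 5 - ε)) := by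
  obtain ⟨T0, hT0, C, hC, hr⟩ := region hε hε1
  obtain ⟨C1, hC1, hrb⟩ := real_bounds
  set β := 3 / 5 - ε with hβ
  have hβ0 : 0 < β := by rw [hβ]; linarith
  set γ := 1 - β * (2 / 3 + ε) with hγ
  have hγβ : 0 < γ - β := by rw [hγ, hβ]; nlinarith
  have hE : ∀ᶠ L : ℝ in atTop, T0 ≤ exp (L ^ β) ∧ 2 ≤ L ∧ 2 ≤ L ^ (γ - β) ∧ 2 ≤ (L ^ β) ^ (2 / 3 + ε) ∧
      (exp 1 * 2 * (1 + 2 * C1) + 4 * exp 1 * C + 8 * C) * L ^ (2 : ℝ) ≤ exp (1 / 2 * L ^ β) :=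
    ((tendsto_exp_atTop.comp (tendsto_rpow_atTop hβ0)).eventually_ge_atTop T0).and ((eventually_ge_atTop 2).and
    (((tendsto_rpow_atTop hγβ).eventually_ge_atTop 2).and
    ((((tendsto_rpow_atTop (by linarith : 0 < 2 / 3 + ε)).comp (tendsto_rpow_atTop hβ0)).eventually_ge_atTop 2).and
    (ev_poly_exp _ 2 hβ0 (by norm_num)))))
  obtain ⟨x0, hx0⟩ := eventually_atTop.1 (tendsto_log_atTop.eventually hE)
  refine ⟨max x0 3, le_max_right _ _, fun x hx => ?_⟩
  obtain ⟨h1, h2, h3, h4, h5⟩ := hx0 x ((le_max_left _ _).trans hx)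
  have hx3 : 3 ≤ x := (le_max_right _ _).trans hx
  have hxp : 0 < x := by linarith
  set L := log x with hL
  have hLp : 0 < L := by linarith
  have hxL : x = exp L := (exp_log hxp).symm
  set v := L ^ β with hv
  have hv0 : 0 < v := by positivity
  have hvL : v ≤ L := by
    rw [hv]; conv_rhs => rw [← rpow_one L]
    exact rpow_le_rpow_of_exponent_le (by linarith) (by rw [hβ]; linarith)
  set δ := v ^ (-(2 / 3 + ε)) with hδ
  have hδ0 : 0 < δ := by positivity
  have hδ2 : δ ≤ 1 / 2 := by
    rw [hδ, rpow_neg hv0.le, one_div]; exact inv_anti₀ (by norm_num) h4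
  have hreg : ∀ s : ℂ, |s.im| ≤ exp v → 1 - δ ≤ s.re → s.re ≤ 2 → riemannZeta₁ s ≠ 0 ∧ ‖FF s‖ ≤ C * v ^ 2 := by
    intro s hs1 hs2 hs3
    have := hr (exp v) h1 s hs1 (by rw [log_exp]; exact hs2) hs3
    rwa [log_exp] at this
  have ha : 0 < 1 / L ∧ 1 / L ≤ 1 := ⟨by positivity, by rw [div_le_one hLp]; linarith⟩
  obtain ⟨hz1, hz2⟩ := hrb (1 / L) ha.1 ha.2
  have hD : ∀ t : ℝ, ‖FF ((1 + 1 / L : ℝ) + t * Complex.I)‖ ≤ (1 + 2 * C1) * L ^ 2 := fun t => by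
    refine (FF_norm t (by linarith)).trans ?_
    have e1 : C1 / (1 / L) = C1 * L := by field_simp
    have e2 : 1 / (1 / L) = L := by field_simp
    rw [e1] at hz1; rw [e2] at hz2
    have e3 : L ≤ L ^ 2 := le_self_pow₀ (by linarith) two_ne_zero
    have e4 : C1 * L + C1 ≤ 2 * C1 * L ^ 2 := by
      have e5 := mul_le_mul_of_nonneg_left e3 hC1.le
      have e6 := mul_le_mul_of_nonneg_left (show 1 ≤ L by linarith) hC1.le
      linarith
    linarith
  have hfin := contour (x := x) (by linarith) (by linarith) (by linarith) hδ0 hδ2 (one_le_exp hv0.le) hreg hD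
  refine hfin.trans ?_
  have hxc : x ^ (1 + 1 / L) = exp 1 * x := by
    rw [rpow_add hxp, rpow_one, rpow_def_of_pos hxp, ← hL, mul_one_div_cancel hLp.ne', mul_comm]
  have hxd : exp v * x ^ (1 - δ) ≤ x * exp (-v) := by
    have e1 : δ * L = L ^ γ := by
      rw [hδ, hv, ← rpow_mul hLp.le, ← rpow_add_one hLp.ne', hγ]; congr 1; ring
    have e2 : 2 * v ≤ δ * L := by
      rw [e1, show γ = (γ - β) + β by ring, rpow_add hLp]
      exact mul_le_mul_of_nonneg_right h3 hv0.le
    rw [rpow_def_of_pos hxp, ← hL]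
    conv_rhs => rw [hxL]
    rw [← exp_add, ← exp_add, exp_le_exp]
    linarith
  rw [hxc]
  have hB : C * v ^ 2 ≤ C * L ^ 2 := by gcongr
  have e3 : exp (-v) = (exp v)⁻¹ := exp_neg v
  have t1 : exp 1 * x * ((1 + 2 * C1) * L ^ 2) * (2 / exp v) = x * exp (-v) * (exp 1 * 2 * (1 + 2 * C1) * L ^ 2) := by
    rw [e3]; ring
  have t2 : 4 * (exp 1 * x * (C * v ^ 2) / exp v) ≤ x * exp (-v) * (4 * exp 1 * C * L ^ 2) := by
    rw [e3, show 4 * (exp 1 * x * (C * v ^ 2) / exp v) = x * (exp v)⁻¹ * (4 * exp 1 * (C * v ^ 2)) by ring,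
      mul_assoc (4 * exp 1)]
    gcongr
  have t3 : 8 * (exp v * x ^ (1 - δ) * (C * v ^ 2)) ≤ x * exp (-v) * (8 * C * L ^ 2) := by
    have := mul_le_mul hxd hB (by positivity) (by positivity)
    linarith
  have h5' := mul_le_mul_of_nonneg_left h5 (show 0 ≤ x * exp (-v) by positivity)
  rw [rpow_two] at h5'
  have e6 : x * exp (-v) * exp (1 / 2 * v) = x * exp (-(1 / 2) * v) := by
    rw [mul_assoc, ← exp_add]; congr 2; ring
  rw [e6] at h5'
  linarith
end VK

namespace VK
local notation "Λ" => ArithmeticFunction.vonMangoldt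

lemma gen_lower {u h : ℝ} (hu : 0 ≤ u) (hh : 0 ≤ h) (w : ℕ → ℝ) (hw0 : ∀ n, 0 ≤ w n) (hwh : ∀ n, w n ≤ h)
    (hwz : ∀ n : ℕ, (n : ℝ) ≤ u → w n = 0) :
    -(h * (h + 1)) ≤ ∑ n ∈ Finset.Icc 1 ⌊u + h⌋₊, (Λ n - 1) * w n := by
  have h1 : ∀ n ∈ Finset.Icc 1 ⌊u + h⌋₊, (if ⌊u⌋₊ < n then -h else 0) ≤ (Λ n - 1) * w n := fun n _ => by
    have hL := ArithmeticFunction.vonMangoldt_nonneg (n := n)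
    have := mul_nonneg hL (hw0 n)
    split_ifs with hn
    · linarith [hwh n]
    · rw [hwz n, mul_zero]
      exact (Nat.le_floor_iff hu).1 (by omega)
  refine le_trans ?_ (Finset.sum_le_sum h1)
  rw [← Finset.sum_filter, Finset.sum_const, nsmul_eq_mul]
  have h2 : ((Finset.Icc 1 ⌊u + h⌋₊).filter (fun n => ⌊u⌋₊ < n)).card ≤ ⌊u + h⌋₊ - ⌊u⌋₊ := by
    rw [← Nat.card_Ioc]
    apply Finset.card_le_card
    intro n hn
    rw [Finset.mem_filter, Finset.mem_Icc] at hn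
    rw [Finset.mem_Ioc]; omega
  have h3 : (((Finset.Icc 1 ⌊u + h⌋₊).filter (fun n => ⌊u⌋₊ < n)).card : ℝ) ≤ h + 1 := by
    have h4 : ⌊u⌋₊ ≤ ⌊u + h⌋₊ := Nat.floor_mono (by linarith)
    have h5 : (((Finset.Icc 1 ⌊u + h⌋₊).filter (fun n => ⌊u⌋₊ < n)).card : ℝ) ≤ ((⌊u + h⌋₊ - ⌊u⌋₊ : ℕ) : ℝ) := by exact_mod_cast h2
    rw [Nat.cast_sub h4] at h5
    have h6 := Nat.floor_le (a := u + h) (by linarith)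
    have h7 := Nat.lt_floor_add_one u
    linarith
  have := mul_le_mul_of_nonneg_left h3 hh
  linarith

lemma G_eq {u : ℝ} (hu : 0 < u) {N : ℕ} (hN : ⌊u⌋₊ ≤ N) :
    u * W u = ∑ n ∈ Finset.Icc 1 N, (Λ n - 1) * max (u - n) 0 := by
  rw [W, Finset.mul_sum]
  have h1 : ∀ n ∈ Finset.Icc 1 ⌊u⌋₊, u * ((Λ n - 1) * (1 - n / u)) = (Λ n - 1) * max (u - n) 0 := fun n hn => by
    rw [Finset.mem_Icc, Nat.le_floor_iff hu.le] at hn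
    rw [max_eq_left (by linarith)]; field_simp
  rw [Finset.sum_congr rfl h1]
  refine Finset.sum_subset (Finset.Icc_subset_Icc_right hN) fun n hn hn' => ?_
  rw [Finset.mem_Icc] at hn
  rw [Finset.mem_Icc, not_and, Nat.le_floor_iff hu.le] at hn'
  have := hn' hn.1
  rw [max_eq_right (by linarith), mul_zero]

lemma A_eq {u : ℝ} (hu : 0 ≤ u) {N : ℕ} (hN : ⌊u⌋₊ ≤ N) (h : ℝ) :
    h * (Chebyshev.psi u - ⌊u⌋₊) = ∑ n ∈ Finset.Icc 1 N, (Λ n - 1) * (if (n : ℝ) ≤ u then h else 0) := by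
  have h0 : Chebyshev.psi u - ⌊u⌋₊ = ∑ n ∈ Finset.Icc 1 ⌊u⌋₊, (Λ n - 1) := by
    rw [Chebyshev.psi_eq_sum_Icc, Finset.sum_sub_distrib, Finset.sum_const, Nat.card_Icc, nsmul_one, Nat.add_sub_cancel]
    congr 1
    rw [← Finset.add_sum_Ioc_eq_sum_Icc (by omega)]
    simp; rfl
  rw [h0, Finset.mul_sum]
  have h1 : ∀ n ∈ Finset.Icc 1 ⌊u⌋₊, h * (Λ n - 1) = (Λ n - 1) * (if (n : ℝ) ≤ u then h else 0) := fun n hn => by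
    rw [Finset.mem_Icc, Nat.le_floor_iff hu] at hn
    rw [if_pos hn.2, mul_comm]
  rw [Finset.sum_congr rfl h1]
  refine Finset.sum_subset (Finset.Icc_subset_Icc_right hN) fun n hn hn' => ?_
  rw [Finset.mem_Icc] at hn
  rw [Finset.mem_Icc, not_and, Nat.le_floor_iff hu] at hn'
  rw [if_neg (hn' hn.1), mul_zero]

lemma desmooth {x h : ℝ} (hh : 0 < h) (hx : h < x) :
    h * (Chebyshev.psi x - ⌊x⌋₊) ≤ (x + h) * W (x + h) - x * W x + h * (h + 1) ∧
    x * W x - (x - h) * W (x - h) - h * (h + 1) ≤ h * (Chebyshev.psi x - ⌊x⌋₊) := by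
  have f1 : ⌊x⌋₊ ≤ ⌊x + h⌋₊ := Nat.floor_mono (by linarith)
  have f2 : ⌊x - h⌋₊ ≤ ⌊x⌋₊ := Nat.floor_mono (by linarith)
  constructor
  · have h1 := gen_lower (u := x) (by linarith) hh.le
      (fun n => max (x + h - n) 0 - max (x - n) 0 - (if (n : ℝ) ≤ x then h else 0)) (fun n => ?_) (fun n => ?_) (fun n hn => ?_)
    · rw [G_eq (u := x + h) (by linarith) le_rfl, G_eq (u := x) (by linarith) f1, A_eq (u := x) (by linarith) f1]
      simp_rw [mul_sub, Finset.sum_sub_distrib] at h1 ⊢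
      linarith
    · split_ifs with h1
      · rw [max_eq_left (by linarith), max_eq_left (by linarith)]; linarith
      · rw [max_eq_right (a := x - n) (by linarith)]; simp
    · split_ifs with h1
      · rw [max_eq_left (by linarith), max_eq_left (by linarith)]; linarith
      · rw [max_eq_right (a := x - n) (by linarith)]; simp; constructor <;> linarith
    · rw [if_pos hn, max_eq_left (by linarith), max_eq_left (by linarith)]; linarith
  · have h1 := gen_lower (u := x - h) (by linarith) hh.le
      (fun n => (if (n : ℝ) ≤ x then h else 0) - (max (x - n) 0 - max (x - h - n) 0)) (fun n => ?_) (fun n => ?_) (fun n hn => ?_)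
    · rw [sub_add_cancel] at h1
      rw [G_eq (u := x - h) (by linarith) f2, G_eq (u := x) (by linarith) le_rfl, A_eq (u := x) (by linarith) le_rfl]
      simp_rw [mul_sub, Finset.sum_sub_distrib] at h1 ⊢
      linarith
    · split_ifs with h1
      · rw [max_eq_left (a := x - n) (by linarith)]
        have := le_max_left (x - h - n) 0
        linarith
      · rw [max_eq_right (a := x - n) (by linarith)]; simp
    · split_ifs with h1
      · rw [max_eq_left (a := x - n) (by linarith)]
        have : max (x - h - n) 0 ≤ x - n := max_le (by linarith) (by linarith)
        linarith
      · rw [max_eq_right (a := x - n) (by linarith), max_eq_right (by linarith)]; linarith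
    · rw [if_pos (by linarith), max_eq_left (by linarith), max_eq_left (by linarith)]; linarith

lemma psi_bound {ε : ℝ} (hε : 0 < ε) (hε1 : ε ≤ 1 / 4) : ∃ x0 ≥ 3, ∀ x ≥ x0,
    |Chebyshev.psi x - x| ≤ 12 * x * exp (-(1 / 8) * (log x) ^ (3 / 5 - ε)) := by
  obtain ⟨x0, hx0, hW⟩ := W_bound hε hε1
  set β := 3 / 5 - ε with hβ
  have hβ0 : 0 < β := by rw [hβ]; linarith
  have hE : ∀ᶠ L : ℝ in atTop, 2 ≤ L ∧ 8 ≤ L ^ β ∧ (1 : ℝ) * L ^ (0 : ℝ) ≤ exp (1 / 8 * L ^ β) ∧ L ^ β ≤ L :=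
    (eventually_ge_atTop 2).and (((tendsto_rpow_atTop hβ0).eventually_ge_atTop 8).and ((ev_poly_exp _ 0 hβ0 (by norm_num)).and (by
      filter_upwards [eventually_ge_atTop 1] with L hL
      conv_rhs => rw [← rpow_one L]
      exact rpow_le_rpow_of_exponent_le hL (by rw [hβ]; linarith))))
  obtain ⟨x1, hx1⟩ := eventually_atTop.1 (tendsto_log_atTop.eventually hE)
  refine ⟨max x1 (2 * x0), by have := le_max_right x1 (2 * x0); linarith, fun x hx => ?_⟩
  obtain ⟨h1, h2, -, h4⟩ := hx1 x ((le_max_left _ _).trans hx)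
  have hxx : 2 * x0 ≤ x := (le_max_right _ _).trans hx
  have hx6 : 6 ≤ x := by linarith
  have hxp : 0 < x := by linarith
  set L := log x with hL
  set v := L ^ β with hv
  set E := exp (-(1 / 8) * v) with hE
  have hE0 : 0 < E := exp_pos _
  have hE2 : E ≤ 1 / 2 := by
    have : exp (-(1 / 8) * v) ≤ exp (-1) := exp_le_exp.2 (by linarith)
    have h3 := exp_neg_one_lt_d9
    linarith
  have hxE : 1 ≤ x * E := by
    rw [← exp_log hxp, hE, ← exp_add]
    apply one_le_exp; linarith
  have hu : ∀ u, x / 2 ≤ u → u ≤ 2 * x → |u * W u| ≤ 4 * x ^ 2 * E ^ 2 := fun u hu1 hu2 => by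
    have h5 := hW u (by linarith)
    have h6 : exp (-(1 / 2) * (log u) ^ β) ≤ E ^ 2 := by
      rw [hE, ← exp_nat_mul, exp_le_exp]
      have h7 : L / 2 ≤ log u := by
        have : log (x / 2) ≤ log u := log_le_log (by linarith) hu1
        rw [log_div hxp.ne' two_ne_zero, ← hL] at this
        linarith [log_two_lt_d9]
      have h8 : v / 2 ≤ (log u) ^ β := by
        calc v / 2 = L ^ β * (1 / 2) ^ (1 : ℝ) := by rw [rpow_one, hv]; ring
          _ ≤ L ^ β * (1 / 2) ^ β := by
            gcongr ?_ * ?_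
            exact rpow_le_rpow_of_exponent_ge (by norm_num) (by norm_num) (by rw [hβ]; linarith)
          _ = (L / 2) ^ β := by rw [← mul_rpow (by linarith) (by norm_num)]; congr 1; ring
          _ ≤ _ := rpow_le_rpow (by linarith) h7 hβ0.le
      push_cast; linarith
    have hu0 : 0 < u := by linarith
    rw [abs_mul, abs_of_pos hu0]
    calc u * |W u| ≤ u * (u * exp (-(1 / 2) * (log u) ^ β)) := mul_le_mul_of_nonneg_left h5 hu0.le
      _ ≤ 2 * x * (2 * x * E ^ 2) := by gcongr
      _ = _ := by ring
  set h := x * E with hh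
  have hhx : h ≤ x / 2 := by
    have := mul_le_mul_of_nonneg_left hE2 hxp.le
    linarith
  obtain ⟨d1, d2⟩ := desmooth (x := x) (h := h) (by linarith) (by linarith)
  have b1 := abs_le.1 (hu (x + h) (by linarith) (by linarith))
  have b2 := abs_le.1 (hu x (by linarith) (by linarith))
  have b3 := abs_le.1 (hu (x - h) (by linarith) (by linarith))
  have hh0 : 0 < h := by linarith
  have hsq : 4 * x ^ 2 * E ^ 2 = h * (4 * h) := by rw [hh]; ring
  rw [hsq] at b1 b2 b3
  have k1 : Chebyshev.psi x - ⌊x⌋₊ ≤ 10 * h := by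
    refine le_of_mul_le_mul_left ?_ hh0
    have := mul_le_mul_of_nonneg_left hxE hh0.le
    clear_value h E v L
    linarith [b1.2, b2.1]
  have k2 : -(10 * h) ≤ Chebyshev.psi x - ⌊x⌋₊ := by
    refine le_of_mul_le_mul_left ?_ hh0
    have := mul_le_mul_of_nonneg_left hxE hh0.le
    clear_value h E v L
    linarith [b3.2, b2.1]
  have k3 := Nat.floor_le hxp.le
  have k4 := Nat.lt_floor_add_one x
  rw [mul_assoc, ← hh, abs_le]
  constructor <;> linarith
end VK

namespace VK

lemma theta_bound {ε : ℝ} (hε : 0 < ε) (hε1 : ε ≤ 1 / 4) : ∃ C ≥ 1, ∀ x ≥ 2,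
    |Chebyshev.theta x - x| ≤ C * (x * exp (-(1 / 8) * (log x) ^ (3 / 5 - ε))) := by
  obtain ⟨x0, hx0, hψ⟩ := psi_bound hε hε1
  set β := 3 / 5 - ε with hβ
  have hβ0 : 0 < β := by rw [hβ]; linarith
  have hE : ∀ᶠ L : ℝ in atTop, 1 ≤ L ∧ (2 : ℝ) * L ^ (1 : ℝ) ≤ exp (3 / 8 * L ^ (1 : ℝ)) ∧ L ^ β ≤ L :=
    (eventually_ge_atTop 1).and ((ev_poly_exp _ 1 zero_lt_one (by norm_num)).and (by
      filter_upwards [eventually_ge_atTop 1] with L hL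
      conv_rhs => rw [← rpow_one L]
      exact rpow_le_rpow_of_exponent_le hL (by rw [hβ]; linarith)))
  obtain ⟨x1, hx1⟩ := eventually_atTop.1 (tendsto_log_atTop.eventually hE)
  set X := max x0 x1 with hX
  have hX3 : 3 ≤ X := hx0.trans (le_max_left _ _)
  refine ⟨13 + 3 * exp ((1 / 8) * (log X) ^ β), by have := exp_pos ((1 / 8) * (log X) ^ β); linarith, fun x hx => ?_⟩
  have hxp : 0 < x := by linarith
  have hlx : 0 < log x := log_pos (by linarith)
  have hEp := exp_pos ((1 / 8) * (log X) ^ β)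
  have hxE : 0 < x * exp (-(1 / 8) * (log x) ^ β) := by positivity
  rcases le_total X x with h | h
  · have h1 := hψ x ((le_max_left _ _).trans h)
    obtain ⟨h0, h2, h3⟩ := hx1 x ((le_max_right _ _).trans h)
    have h4 := Chebyshev.abs_psi_sub_theta_le_sqrt_mul_log (x := x) (by linarith)
    rw [rpow_one] at h2
    have h5 : 2 * √x * log x ≤ x * exp (-(1 / 8) * (log x) ^ β) := by
      have e1 : √x = exp (log x / 2) := by rw [exp_half, exp_log hxp]
      have e2 : exp (log x) = x := exp_log hxp
      calc 2 * √x * log x = √x * (2 * log x) := by ring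
        _ ≤ √x * exp (3 / 8 * log x) := by gcongr
        _ = exp (log x) * exp (-(1 / 8) * log x) := by rw [e1, ← exp_add, ← exp_add]; congr 1; ring
        _ ≤ _ := by rw [e2]; gcongr _ * ?_; exact exp_le_exp.2 (by linarith)
    have h6 : |Chebyshev.theta x - x| ≤ |Chebyshev.psi x - x| + |Chebyshev.psi x - Chebyshev.theta x| := by
      rw [abs_sub_comm (Chebyshev.psi x) (Chebyshev.theta x)]
      have := abs_add_le (Chebyshev.psi x - x) (Chebyshev.theta x - Chebyshev.psi x)
      rwa [sub_add_sub_comm, add_comm (Chebyshev.psi x), add_sub_add_right_eq_sub] at this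
    have h7 : 0 ≤ exp ((1 / 8) * (log X) ^ β) * (x * exp (-(1 / 8) * (log x) ^ β)) := by positivity
    linarith
  · have h1 := Chebyshev.theta_le_log4_mul_x hxp.le
    have h2 := Chebyshev.theta_nonneg x
    have h3 : log 4 ≤ 2 := by
      rw [show (4 : ℝ) = 2 ^ 2 by norm_num, log_pow]; push_cast; linarith [log_two_lt_d9]
    have h4 : |Chebyshev.theta x - x| ≤ 3 * x := by
      have := mul_le_mul_of_nonneg_right h3 hxp.le
      rw [abs_le]; constructor <;> linarith
    have h5 : 1 ≤ exp ((1 / 8) * (log X) ^ β) * exp (-(1 / 8) * (log x) ^ β) := by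
      rw [← exp_add]; apply one_le_exp
      have : (log x) ^ β ≤ (log X) ^ β := rpow_le_rpow hlx.le (log_le_log hxp h) hβ0.le
      linarith
    have h6 := mul_le_mul_of_nonneg_left h5 hxp.le
    linarith

lemma log_ne {t : ℝ} (ht : 2 ≤ t) : log t ≠ 0 := (log_pos (by linarith)).ne'

lemma cont_inv_log (x : ℝ) : ContinuousOn (fun t : ℝ => (log t)⁻¹) (Set.Icc 2 x) := fun t ht =>
  ((continuousAt_log (by have := ht.1; linarith)).inv₀ (log_ne ht.1)).continuousWithinAt

lemma int_inv_log {a b : ℝ} (ha : 2 ≤ a) (hb : a ≤ b) : IntervalIntegrable (fun t : ℝ => (log t)⁻¹) volume a b := by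
  apply ContinuousOn.intervalIntegrable_of_Icc hb
  exact (cont_inv_log b).mono (Set.Icc_subset_Icc_left ha)

lemma li_parts {x : ℝ} (hx : 2 ≤ x) : ∫ t in (2 : ℝ)..x, (log t)⁻¹ = x / log x - 2 / log 2 + ∫ t in (2 : ℝ)..x, t / (t * log t ^ 2) := by
  have hc2 : ContinuousOn (fun t : ℝ => t / (t * log t ^ 2)) (Set.Icc 2 x) := fun t ht => by
    have h2 : t ≠ 0 := by have := ht.1; intro h; linarith
    exact (continuousAt_id.div (continuousAt_id.mul ((continuousAt_log h2).pow 2))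
      (mul_ne_zero h2 (pow_ne_zero 2 (log_ne ht.1)))).continuousWithinAt
  have hi2 : IntervalIntegrable (fun t : ℝ => t / (t * log t ^ 2)) volume 2 x := hc2.intervalIntegrable_of_Icc hx
  have h := intervalIntegral.integral_eq_sub_of_hasDerivAt (f := fun t : ℝ => t / log t)
    (f' := fun t => (log t)⁻¹ - t / (t * log t ^ 2)) (a := 2) (b := x) (fun t ht => by
      rw [Set.uIcc_of_le hx] at ht
      have h2 : t ≠ 0 := by have := ht.1; intro h; linarith
      have h3 := log_ne ht.1
      have := (hasDerivAt_id t).div (hasDerivAt_log h2) h3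
      refine this.congr_deriv ?_
      rw [id]; field_simp) ((int_inv_log le_rfl hx).sub hi2)
  rw [intervalIntegral.integral_sub (int_inv_log le_rfl hx) hi2] at h
  linarith

lemma pi_bound {ε : ℝ} (hε : 0 < ε) (hε1 : ε ≤ 1 / 4) : ∃ C > 0, ∃ x0 ≥ 4, ∀ x ≥ x0,
    |(Nat.primeCounting ⌊x⌋₊ : ℝ) - ∫ t in (2 : ℝ)..x, (log t)⁻¹| ≤ C * (x * exp (-(1 / 16) * (log x) ^ (3 / 5 - ε))) := by
  obtain ⟨C, hC, hθ⟩ := theta_bound hε hε1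
  set β := 3 / 5 - ε with hβ
  have hβ0 : 0 < β := by rw [hβ]; linarith
  refine ⟨9 * C + 3, by linarith, exp 4, by have := add_one_le_exp (4 : ℝ); linarith, fun x hx => ?_⟩
  have hx4 : 4 ≤ x := by have := add_one_le_exp (4 : ℝ); linarith
  have hxp : 0 < x := by linarith
  have hL4 : 4 ≤ log x := by rwa [le_log_iff_exp_le hxp]
  set m := √x with hm
  have hm2 : 2 ≤ m := by rw [hm]; apply le_sqrt_of_sq_le; linarith
  have hmx : m ≤ x := by rw [hm]; rw [sqrt_le_left (by linarith)]; nlinarith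
  have hlm : log m = log x / 2 := log_sqrt hxp.le
  set L := log x with hL
  set v := L ^ β with hv
  have hvL : v ≤ L := by
    rw [hv]; conv_rhs => rw [← rpow_one L]
    exact rpow_le_rpow_of_exponent_le (by linarith) (by rw [hβ]; linarith)
  have hv0 : 0 < v := by positivity
  set E := exp (-(1 / 16) * v) with hE
  have hmE : m ≤ x * E := by
    have : m = exp (L / 2) := by rw [hm, exp_half, exp_log hxp]
    rw [this]
    conv_rhs => rw [← exp_log hxp, hE, ← exp_add]
    exact exp_le_exp.2 (by linarith)
  set f := fun t : ℝ => (Chebyshev.theta t - t) / (t * log t ^ 2) with hf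
  have hi1 : ∀ b, 2 ≤ b → IntervalIntegrable (fun t => Chebyshev.theta t / (t * log t ^ 2)) volume 2 b := fun b hb => by
    rw [intervalIntegrable_iff_integrableOn_Icc_of_le hb]
    exact Chebyshev.integrableOn_theta_div_id_mul_log_sq b
  have hi2 : ∀ b, 2 ≤ b → IntervalIntegrable (fun t : ℝ => t / (t * log t ^ 2)) volume 2 b := fun b hb => by
    apply ContinuousOn.intervalIntegrable_of_Icc hb
    intro t ht
    have h2 : t ≠ 0 := by have := ht.1; intro h; linarith
    exact (continuousAt_id.div (continuousAt_id.mul ((continuousAt_log h2).pow 2))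
      (mul_ne_zero h2 (pow_ne_zero 2 (log_ne ht.1)))).continuousWithinAt
  have hif : ∀ b, 2 ≤ b → IntervalIntegrable f volume 2 b := fun b hb => by
    refine ((hi1 b hb).sub (hi2 b hb)).congr fun t _ => ?_
    simp only [hf, Pi.sub_apply]; ring
  have hsplit : (Nat.primeCounting ⌊x⌋₊ : ℝ) - ∫ t in (2 : ℝ)..x, (log t)⁻¹ =
      (Chebyshev.theta x - x) / L + 2 / log 2 + ((∫ t in (2 : ℝ)..m, f t) + ∫ t in m..x, f t) := by
    rw [intervalIntegral.integral_add_adjacent_intervals (hif m hm2) ((hif m hm2).symm.trans (hif x (by linarith))),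
      Chebyshev.primeCounting_eq_theta_div_log_add_integral (by linarith), li_parts (by linarith)]
    have : ∫ t in (2 : ℝ)..x, f t = (∫ t in (2 : ℝ)..x, Chebyshev.theta t / (t * log t ^ 2)) - ∫ t in (2 : ℝ)..x, t / (t * log t ^ 2) := by
      rw [← intervalIntegral.integral_sub (hi1 x (by linarith)) (hi2 x (by linarith))]
      congr 1; ext t; rw [hf]; ring
    rw [this]; ring
  have hfb : ∀ t, 2 ≤ t → ‖f t‖ ≤ 4 * C * exp (-(1 / 8) * (log t) ^ β) := fun t ht => by
    have h1 := hθ t ht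
    have h2 : 1 / 2 < log t := by
      have := log_le_log (by norm_num) ht; linarith [log_two_gt_d9]
    have h3 : 1 / 4 ≤ log t ^ 2 := by nlinarith
    have ht0 : 0 < t := by linarith
    rw [hf]; dsimp only
    rw [norm_div, norm_eq_abs, norm_eq_abs, abs_of_pos (a := t * log t ^ 2) (by positivity), div_le_iff₀ (by positivity)]
    refine h1.trans ?_
    have h4 : 0 ≤ C * (t * exp (-(1 / 8) * (log t) ^ β)) := by positivity
    have := mul_le_mul_of_nonneg_left h3 h4
    linarith
  have hb1 : ‖∫ t in (2 : ℝ)..m, f t‖ ≤ 4 * C * m := by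
    refine (intervalIntegral.norm_integral_le_of_norm_le_const (C := 4 * C) fun t ht => ?_).trans ?_
    · rw [Set.uIoc_of_le hm2] at ht
      refine (hfb t ht.1.le).trans ?_
      have h0 : 0 ≤ (log t) ^ β := rpow_nonneg (log_nonneg (by linarith [ht.1])) _
      have : exp (-(1 / 8) * (log t) ^ β) ≤ 1 := exp_le_one_iff.2 (by linarith)
      exact mul_le_of_le_one_right (by linarith) this
    · rw [abs_of_nonneg (by linarith)]
      exact mul_le_mul_of_nonneg_left (by linarith) (by linarith)
  have hb2 : ‖∫ t in m..x, f t‖ ≤ 4 * C * (x * E) := by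
    refine (intervalIntegral.norm_integral_le_of_norm_le_const (C := 4 * C * E) fun t ht => ?_).trans ?_
    · rw [Set.uIoc_of_le hmx] at ht
      refine (hfb t (by linarith [ht.1])).trans ?_
      gcongr
      have h7 : L / 2 ≤ log t := by rw [← hlm]; exact log_le_log (by linarith) ht.1.le
      have h8 : v / 2 ≤ (log t) ^ β := by
        calc v / 2 = L ^ β * (1 / 2) ^ (1 : ℝ) := by rw [rpow_one, hv]; ring
          _ ≤ L ^ β * (1 / 2) ^ β := by
            gcongr ?_ * ?_
            exact rpow_le_rpow_of_exponent_ge (by norm_num) (by norm_num) (by rw [hβ]; linarith)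
          _ = (L / 2) ^ β := by rw [← mul_rpow (by linarith) (by norm_num)]; congr 1; ring
          _ ≤ _ := rpow_le_rpow (by linarith) h7 hβ0.le
      exact exp_le_exp.2 (by linarith)
    · rw [abs_of_nonneg (by linarith), mul_assoc (4 * C), mul_comm E]
      have hE0 : 0 < E := exp_pos _
      gcongr
      linarith
  have hb3 : |(Chebyshev.theta x - x) / L| ≤ C * (x * E) := by
    rw [abs_div, abs_of_pos (by linarith : 0 < L), div_le_iff₀ (by linarith)]
    refine (hθ x (by linarith)).trans ?_
    have h1 : exp (-(1 / 8) * v) ≤ E := exp_le_exp.2 (by linarith)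
    have h2 : C * (x * exp (-(1 / 8) * v)) ≤ C * (x * E) := by gcongr
    have hE0 : 0 < E := exp_pos _
    have h3 : 0 ≤ C * (x * E) := by positivity
    exact h2.trans (le_mul_of_one_le_right h3 (by linarith))
  have hb4 : |2 / log 2| ≤ 3 := by
    rw [abs_of_pos (by positivity), div_le_iff₀ (by positivity)]; linarith [log_two_gt_d9]
  rw [hsplit]
  have t1 := abs_add_le ((Chebyshev.theta x - x) / L + 2 / log 2) ((∫ t in (2 : ℝ)..m, f t) + ∫ t in m..x, f t)
  have t2 := abs_add_le ((Chebyshev.theta x - x) / L) (2 / log 2)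
  have t3 := abs_add_le (∫ t in (2 : ℝ)..m, f t) (∫ t in m..x, f t)
  rw [norm_eq_abs] at hb1 hb2
  have t4 := mul_le_mul_of_nonneg_left hmE (by linarith : 0 ≤ C)
  linarith
end VK

namespace VK

lemma lpf_mul {N m k p : ℕ} (hm : N < (m+1)^2) (hk : 1 ≤ k) (hp : p.Prime) (hmp : m < p)
    (h : k * p ≤ N) : largestPrimeFactor (k*p) = p := by
  have hkm : k < m + 1 := by
    by_contra hc
    have := Nat.mul_le_mul (not_lt.mp hc) (show m+1 ≤ p from hmp)
    nlinarith
  have h2 : ¬ k * p ≤ 1 := by nlinarith [hp.two_le]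
  rw [largestPrimeFactor, if_neg h2, Nat.primeFactors_mul (by omega) hp.ne_zero, hp.primeFactors,
    Finset.sup_union]
  simp only [Finset.sup_singleton, id]
  apply sup_eq_right.2
  apply Finset.sup_le
  intro q hq
  have := Nat.le_of_mem_primeFactors hq
  simp only [id]; omega

lemma lpf_prime {n : ℕ} (hn : 2 ≤ n) : (largestPrimeFactor n).Prime ∧ largestPrimeFactor n ∣ n := by
  rw [largestPrimeFactor, if_neg (by omega)]
  have h : n.primeFactors.Nonempty := Nat.nonempty_primeFactors.2 (by omega)
  obtain ⟨q, hq, he⟩ := Finset.exists_mem_eq_sup _ h id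
  rw [he]
  exact ⟨Nat.prime_of_mem_primeFactors hq, Nat.dvd_of_mem_primeFactors hq⟩

lemma card_primes (m M : ℕ) : ((Finset.Ioc m M).filter Nat.Prime).card
    = Nat.primeCounting M - Nat.primeCounting m := by
  rcases le_total M m with h | h
  · rw [Finset.Ioc_eq_empty (by omega)]
    simp [Nat.sub_eq_zero_of_le (Nat.monotone_primeCounting h)]
  · have h1 : Finset.range (M+1) = Finset.range (m+1) ∪ Finset.Ioc m M := by
      ext; simp; omega
    have h2 : Disjoint (Finset.range (m+1)) (Finset.Ioc m M) := by
      rw [Finset.disjoint_left]; intro a; simp; omega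
    simp only [Nat.primeCounting, Nat.primeCounting', Nat.count_eq_card_filter_range]
    rw [h1, Finset.filter_union, Finset.card_union_of_disjoint (Finset.disjoint_filter_filter h2), Nat.add_sub_cancel_left]

lemma count_eq {N m : ℕ} (hm : N < (m+1)^2) (hm1 : 1 ≤ m) :
    ((Finset.Icc 1 N).filter (fun n => m < largestPrimeFactor n)).card
    = ∑ k ∈ Finset.Icc 1 N, (Nat.primeCounting (N/k) - Nat.primeCounting m) := by
  simp_rw [← card_primes]
  rw [← Finset.card_sigma]
  apply Finset.card_nbij' (i := fun n => (⟨n / largestPrimeFactor n, largestPrimeFactor n⟩ : Σ _ : ℕ, ℕ))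
    (j := fun a => a.1 * a.2)
  · intro n hn
    simp only [Finset.mem_coe, Finset.mem_filter, Finset.mem_Icc, Finset.mem_sigma, Finset.mem_Ioc] at hn ⊢
    have hn2 : 2 ≤ n := by
      by_contra hc
      have := hn.2; rw [largestPrimeFactor, if_pos (by omega)] at this; omega
    obtain ⟨hp, hd⟩ := lpf_prime hn2
    obtain ⟨k, hk⟩ := hd
    set p := largestPrimeFactor n
    have hk0 : 1 ≤ k := by
      rcases Nat.eq_zero_or_pos k with h | h
      · rw [h] at hk; omega
      · exact h
    have e : n / p = k := by rw [hk]; exact Nat.mul_div_cancel_left k hp.pos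
    rw [e]
    refine ⟨⟨hk0, ?_⟩, ⟨hn.2, ?_⟩, hp⟩
    · nlinarith [hp.two_le]
    · rw [Nat.le_div_iff_mul_le (by omega)]; omega
  · rintro ⟨k, p⟩ hn
    simp only [Finset.mem_coe, Finset.mem_filter, Finset.mem_Icc, Finset.mem_sigma, Finset.mem_Ioc] at hn ⊢
    obtain ⟨⟨h1, h2⟩, ⟨h3, h4⟩, h5⟩ := hn
    rw [Nat.le_div_iff_mul_le (by omega), mul_comm] at h4
    rw [lpf_mul hm h1 h5 h3 h4]
    exact ⟨⟨by nlinarith [h5.two_le], h4⟩, h3⟩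
  · intro n hn
    simp only [Finset.mem_coe, Finset.mem_filter, Finset.mem_Icc] at hn ⊢
    have hn2 : 2 ≤ n := by
      by_contra hc
      have := hn.2; rw [largestPrimeFactor, if_pos (by omega)] at this; omega
    exact Nat.div_mul_cancel (lpf_prime hn2).2
  · rintro ⟨k, p⟩ hn
    simp only [Finset.mem_coe, Finset.mem_filter, Finset.mem_Icc, Finset.mem_sigma, Finset.mem_Ioc] at hn ⊢
    obtain ⟨⟨h1, h2⟩, ⟨h3, h4⟩, h5⟩ := hn
    rw [Nat.le_div_iff_mul_le (by omega), mul_comm] at h4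
    rw [lpf_mul hm h1 h5 h3 h4, Nat.mul_div_cancel _ h5.pos]

lemma list_med {l : List ℕ} (hl : l.Pairwise (· ≤ ·)) {i m : ℕ} (hi : i < l.length) :
    (l[i] ≤ m → l.countP (fun a => m < a) + (i+1) ≤ l.length) ∧
    (m < l[i] → l.length ≤ l.countP (fun a => m < a) + i) := by
  have hs := List.pairwise_iff_getElem.1 hl
  constructor
  · intro h
    have e : l.countP (fun a => m < a) = (l.take (i+1)).countP (fun a => m < a)
        + (l.drop (i+1)).countP (fun a => m < a) := by
      rw [← List.countP_append, List.take_append_drop]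
    have h0 : (l.take (i+1)).countP (fun a => m < a) = 0 := by
      rw [List.countP_eq_zero]
      intro a ha
      obtain ⟨j, hj, rfl⟩ := List.mem_iff_getElem.1 ha
      simp only [List.length_take] at hj
      rw [List.getElem_take]
      have : l[j] ≤ l[i] := by
        rcases Nat.lt_or_ge j i with h' | h'
        · exact hs _ _ _ _ h'
        · have : j = i := by omega
          subst this; exact le_rfl
      simp; omega
    have h1 := List.countP_le_length (p := fun a => decide (m < a)) (l := l.drop (i+1))
    rw [List.length_drop] at h1
    omega
  · intro h
    have e : l.countP (fun a => m < a) = (l.take i).countP (fun a => m < a)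
        + (l.drop i).countP (fun a => m < a) := by
      rw [← List.countP_append, List.take_append_drop]
    have h0 : (l.drop i).countP (fun a => m < a) = (l.drop i).length := by
      rw [List.countP_eq_length]
      intro a ha
      obtain ⟨j, hj, rfl⟩ := List.mem_iff_getElem.1 ha
      simp only [List.length_drop] at hj
      rw [List.getElem_drop]
      have : l[i] ≤ l[i+j] := by
        rcases Nat.eq_zero_or_pos j with h' | h'
        · subst h'; exact le_rfl
        · exact hs _ _ _ _ (by omega)
      simp; omega
    rw [List.length_drop] at h0
    omega

lemma med_count {x : ℝ} (hx : 1 ≤ x) (m : ℕ) :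
    (medianLPF x ≤ m → 2 * ((Finset.Icc 1 ⌊x⌋₊).filter (fun n => m < largestPrimeFactor n)).card ≤ ⌊x⌋₊) ∧
    (m < medianLPF x → ⌊x⌋₊ ≤ 2 * ((Finset.Icc 1 ⌊x⌋₊).filter (fun n => m < largestPrimeFactor n)).card) := by
  have hN : 1 ≤ ⌊x⌋₊ := Nat.one_le_floor_iff _ |>.2 hx
  set N := ⌊x⌋₊ with hNd
  set s := (Finset.Icc 1 N).val.map largestPrimeFactor with hs
  set l := s.sort (· ≤ ·) with hl
  have hlen : l.length = N := by
    rw [hl, Multiset.length_sort, hs, Multiset.card_map]; simp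
  have hc : ((Finset.Icc 1 N).filter (fun n => m < largestPrimeFactor n)).card
      = l.countP (fun a => m < a) := by
    have h1 : (l : Multiset ℕ).countP (fun a => m < a) = l.countP (fun a => m < a) :=
      Multiset.coe_countP ..
    rw [← h1, hl, Multiset.sort_eq, hs, Multiset.countP_map]
    rfl
  have hi : (N+1)/2 - 1 < l.length := by omega
  have hM : medianLPF x = l[(N+1)/2-1] := by
    rw [medianLPF, List.getD_eq_getElem _ _ hi]
  have := list_med (l := l) (m := m) (Multiset.pairwise_sort s (· ≤ ·)) hi
  rw [hM, hc]
  constructor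
  · intro h; have := this.1 h; omega
  · intro h; have := this.2 h; omega

end VK

namespace VK

lemma int_fract {x a b : ℝ} (ha : 2 ≤ a) (hab : a ≤ b) :
    IntervalIntegrable (fun t => Int.fract (x/t) / log t) volume a b := by
  apply (int_inv_log ha hab).mono_fun
  · apply Measurable.aestronglyMeasurable
    exact (measurable_fract.comp (measurable_const.div measurable_id)).div Real.measurable_log
  · refine Eventually.of_forall fun t => ?_
    beta_reduce
    rw [norm_div, norm_inv, div_eq_mul_inv]
    apply mul_le_of_le_one_left (by positivity)
    rw [Real.norm_of_nonneg (Int.fract_nonneg _)]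
    exact (Int.fract_lt_one _).le

lemma fract_bd {x a b : ℝ} (ha : 2 ≤ a) (hab : a ≤ b) :
    0 ≤ ∫ t in a..b, Int.fract (x/t) / log t ∧
    ∫ t in a..b, Int.fract (x/t) / log t ≤ (b - a) * (log a)⁻¹ := by
  have hp : ∀ t ∈ Set.Icc a b, 0 < log t := fun t ht => log_pos (by linarith [ht.1])
  constructor
  · apply intervalIntegral.integral_nonneg hab
    intro t ht
    exact div_nonneg (Int.fract_nonneg _) (hp t ht).le
  · have : ∫ t in a..b, Int.fract (x/t) / log t ≤ ∫ t in a..b, (log a)⁻¹ := by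
      apply intervalIntegral.integral_mono_on hab (int_fract ha hab) (by simp)
      intro t ht
      rw [div_eq_mul_inv]
      have h1 : (log t)⁻¹ ≤ (log a)⁻¹ :=
        inv_anti₀ (log_pos (by linarith)) (log_le_log (by linarith) ht.1)
      have h2 := (Int.fract_lt_one (x/t)).le
      have h3 : 0 ≤ (log t)⁻¹ := (inv_pos.2 (hp t ht)).le
      exact (mul_le_of_le_one_left h3 h2).trans h1
    simpa using this

lemma log2_inv : (log 2)⁻¹ ≤ 2 := by
  rw [inv_le_comm₀ (log_pos (by norm_num)) (by norm_num)]
  linarith [Real.log_two_gt_d9]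

lemma lif_nonneg {x : ℝ} (hx : 2 ≤ x) : 0 ≤ lif x := (fract_bd le_rfl hx).1

lemma lif_le {x : ℝ} (hx : 4 ≤ x) : lif x ≤ 2 * √x + 2 * x / log x := by
  have h1 : 2 ≤ √x := Real.le_sqrt_of_sq_le (by linarith)
  have h2 : √x ≤ x := by
    rw [Real.sqrt_le_left (by linarith)]; nlinarith
  have e := intervalIntegral.integral_add_adjacent_intervals (int_fract (x := x) le_rfl h1) (int_fract (x := x) h1 h2)
  rw [lif, ← e]
  have b1 := (fract_bd (x := x) le_rfl h1).2
  have b2 := (fract_bd (x := x) h1 h2).2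
  rw [Real.log_sqrt (by linarith)] at b2
  have hl : 0 < log x := log_pos (by linarith)
  have b3 : (√x - 2) * (log 2)⁻¹ ≤ √x * 2 := by
    apply mul_le_mul (by linarith) log2_inv (inv_nonneg.2 (log_nonneg (by norm_num))) (by linarith)
  have b4 : (x - √x) * (log x / 2)⁻¹ ≤ 2 * x / log x := by
    rw [inv_div, mul_div_assoc', div_le_div_iff_of_pos_right hl]; linarith
  linarith

lemma lif_small : ∀ᶠ x : ℝ in atTop, lif x / x ≤ 1/20 := by
  have h2 := Real.tendsto_log_atTop.eventually_ge_atTop (80:ℝ)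
  filter_upwards [h2, eventually_ge_atTop (6400:ℝ)] with x hL hx
  rw [div_le_iff₀ (by linarith)]
  have := lif_le (x := x) (by linarith)
  have h3 : √x * 80 ≤ x := by
    have h80 : 80 ≤ √x := Real.le_sqrt_of_sq_le (by linarith)
    nlinarith [Real.sq_sqrt (show 0 ≤ x by linarith)]
  have h4 : 2 * x / log x ≤ 2 * x / 80 := by
    apply div_le_div_of_nonneg_left (by linarith) (by norm_num) hL
  linarith

lemma J_eq {x y : ℝ} (hy : 2 ≤ y) (hyx : y ≤ x) : ∃ R : ℝ, 0 ≤ R ∧ R ≤ 2 * y ∧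
    ∑ k ∈ Finset.Icc 1 ⌊x/y⌋₊, ∫ t in y..(x/k), (log t)⁻¹
      = x * (log (log x) - log (log y)) - lif x + R := by
  have hx : 0 < x := by linarith
  refine ⟨∫ t in (2:ℝ)..y, Int.fract (x/t) / log t, (fract_bd le_rfl hy).1, ?_, ?_⟩
  · refine (fract_bd le_rfl hy).2.trans ?_
    have : (y - 2) * (log 2)⁻¹ ≤ y * 2 :=
      mul_le_mul (by linarith) log2_inv (inv_nonneg.2 (log_nonneg (by norm_num))) (by linarith)
    linarith
  have e := intervalIntegral.integral_add_adjacent_intervals (int_fract (x := x) le_rfl hy) (int_fract (x := x) hy hyx)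
  have e1 : ∫ t in y..x, x * (t⁻¹ / log t) = x * (log (log x) - log (log y)) := by
    rw [intervalIntegral.integral_const_mul]
    congr 1
    apply intervalIntegral.integral_eq_sub_of_hasDerivAt
    · intro t ht
      rw [Set.uIcc_of_le hyx] at ht
      exact (Real.hasDerivAt_log (by linarith [ht.1])).log (log_ne (by linarith [ht.1]))
    · apply ContinuousOn.intervalIntegrable
      intro t ht
      rw [Set.uIcc_of_le hyx] at ht
      have h0 : t ≠ 0 := by linarith [ht.1]
      exact ((continuousAt_inv₀ h0).div (Real.continuousAt_log h0) (log_ne (by linarith [ht.1]))).continuousWithinAt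
  have i1 : IntervalIntegrable (fun t => x * (t⁻¹ / log t)) volume y x := by
    apply ContinuousOn.intervalIntegrable
    intro t ht
    rw [Set.uIcc_of_le hyx] at ht
    have h0 : t ≠ 0 := by linarith [ht.1]
    exact (((continuousAt_inv₀ h0).div (Real.continuousAt_log h0) (log_ne (by linarith [ht.1]))).const_mul x).continuousWithinAt
  have e2 := intervalIntegral.integral_sub i1 (int_fract (x := x) hy hyx)
  have hk : ∀ k ∈ Finset.Icc 1 ⌊x/y⌋₊, x / k ∈ Set.Icc y x := by
    intro k hk
    rw [Finset.mem_Icc] at hk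
    have hk1 : (1:ℝ) ≤ k := by exact_mod_cast hk.1
    have hk2 : (k:ℝ) ≤ x / y := (Nat.le_floor_iff (by positivity)).1 hk.2
    rw [le_div_iff₀ (by linarith)] at hk2
    refine ⟨?_, div_le_self hx.le hk1⟩
    rw [le_div_iff₀ (by linarith)]; linarith
  have e3 : ∀ k ∈ Finset.Icc 1 ⌊x/y⌋₊, ∫ t in y..(x/k), (log t)⁻¹
      = ∫ t in y..x, Set.indicator {t | t ≤ x / k} (fun t => (log t)⁻¹) t := fun k h =>
    (intervalIntegral.integral_indicator (hk k h)).symm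
  rw [Finset.sum_congr rfl e3, ← intervalIntegral.integral_finset_sum]
  · rw [intervalIntegral.integral_congr (g := fun t => x * (t⁻¹ / log t) - Int.fract (x/t) / log t)]
    · rw [e2, e1, lif, ← e]; ring
    · intro t ht
      rw [Set.uIcc_of_le hyx] at ht
      have ht0 : 0 < t := by linarith [ht.1]
      have hxt : 0 ≤ x / t := by positivity
      simp only [Set.indicator_apply, Set.mem_setOf_eq]
      rw [← Finset.sum_filter]
      have : (Finset.Icc 1 ⌊x/y⌋₊).filter (fun k : ℕ => t ≤ x / k) = Finset.Icc 1 ⌊x/t⌋₊ := by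
        ext k
        simp only [Finset.mem_filter, Finset.mem_Icc]
        have hle : ⌊x/t⌋₊ ≤ ⌊x/y⌋₊ := Nat.floor_mono (div_le_div_of_nonneg_left hx.le (by linarith) ht.1)
        constructor
        · rintro ⟨⟨a, b⟩, c⟩
          refine ⟨a, (Nat.le_floor_iff hxt).2 ?_⟩
          have a' : (1:ℝ) ≤ k := by exact_mod_cast a
          rw [le_div_iff₀ (by linarith)] at c
          rw [le_div_iff₀ ht0]; linarith
        · rintro ⟨a, b⟩
          refine ⟨⟨a, b.trans hle⟩, ?_⟩
          have a' : (1:ℝ) ≤ k := by exact_mod_cast a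
          have c := (Nat.le_floor_iff hxt).1 b
          rw [le_div_iff₀ ht0] at c
          rw [le_div_iff₀ (by linarith)]; linarith
      rw [this, Finset.sum_const, Nat.card_Icc, nsmul_eq_mul, Nat.add_sub_cancel]
      have hf := Int.self_sub_floor (x/t)
      have hfl : ((⌊x/t⌋₊ : ℕ) : ℝ) = (⌊x/t⌋ : ℤ) := natCast_floor_eq_intCast_floor hxt
      rw [hfl, ← hf]
      field_simp
      ring
  · intro k h
    have := (int_inv_log hy hyx)
    rw [intervalIntegrable_iff] at this ⊢
    exact this.indicator measurableSet_Iic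

lemma count_est {ε : ℝ} (hε : 0 < ε) (hε1 : ε ≤ 1/4) : ∃ C > 0, ∃ x0 ≥ (4:ℝ), ∀ x ≥ x0, ∀ y : ℝ,
    √x ≤ y → y ≤ x → |((((Finset.Icc 1 ⌊x⌋₊).filter (fun n => ⌊y⌋₊ < largestPrimeFactor n)).card : ℕ) : ℝ)
      - ∑ k ∈ Finset.Icc 1 ⌊x/y⌋₊, ∫ t in y..(x/k), (log t)⁻¹|
      ≤ C * x * (1 + log x) * exp (-(1/32) * (log x)^(3/5-ε)) := by
  obtain ⟨C, hC, x0, hx0, H⟩ := pi_bound hε hε1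
  refine ⟨2 * C, by positivity, x0^2, by nlinarith, fun x hx y hy hyx => ?_⟩
  have hsx : x0 ≤ √x := Real.le_sqrt_of_sq_le hx
  have hxp : 0 < x := by nlinarith
  have hyp : 0 < y := by linarith
  have hx1 : 1 < x := by nlinarith
  have hL : 0 < log x := log_pos hx1
  set β := 3/5 - ε with hβ
  set E := exp (-(1/32) * (log x)^β) with hE
  have hu : ∀ u : ℝ, √x ≤ u → exp (-(1/16) * (log u)^β) ≤ E := by
    intro u hu
    apply exp_le_exp.2
    have h1 : log x / 2 ≤ log u := by
      rw [← Real.log_sqrt hxp.le]; exact log_le_log (by linarith) hu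
    have h2 : (log x / 2)^β ≤ (log u)^β := rpow_le_rpow (by positivity) h1 (by linarith)
    rw [div_rpow hL.le (by norm_num)] at h2
    have h3 : (2:ℝ)^β ≤ 2^(1:ℝ) := rpow_le_rpow_of_exponent_le (by norm_num) (by linarith)
    rw [rpow_one] at h3
    have h4 : (log x)^β / 2 ≤ (log x)^β / 2^β :=
      div_le_div_of_nonneg_left (by positivity) (by positivity) h3
    linarith
  have hN : ⌊x⌋₊ < (⌊y⌋₊ + 1)^2 := by
    have h1 := Nat.lt_floor_add_one y
    have h2 := Nat.floor_le hxp.le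
    have h3 : x < ((⌊y⌋₊ : ℝ) + 1)^2 := by
      have := Real.sq_sqrt hxp.le
      have h4 : √x < ⌊y⌋₊ + 1 := by linarith
      have := Real.sqrt_nonneg x
      nlinarith
    exact_mod_cast h2.trans_lt h3
  have hy1 : 1 ≤ ⌊y⌋₊ := (Nat.one_le_floor_iff _).2 (by linarith)
  rw [count_eq hN hy1]
  have hsub : Finset.Icc 1 ⌊x/y⌋₊ ⊆ Finset.Icc 1 ⌊x⌋₊ := by
    apply Finset.Icc_subset_Icc_right
    exact Nat.floor_mono (div_le_self hxp.le (by linarith))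
  rw [← Finset.sum_subset hsub]
  swap
  · intro k hk hk2
    rw [Finset.mem_Icc] at hk hk2
    apply Nat.sub_eq_zero_of_le
    apply Nat.monotone_primeCounting
    rw [← Nat.floor_div_natCast]
    apply Nat.floor_mono
    have h1 : ⌊x/y⌋₊ < k := by omega
    have h2 := (Nat.floor_lt (by positivity)).1 h1
    have hk1 : (1:ℝ) ≤ k := by exact_mod_cast hk.1
    rw [div_lt_iff₀ hyp] at h2
    rw [div_le_iff₀ (by linarith)]; linarith
  have hyli := H y (by linarith)
  have hlast : ∀ k ∈ Finset.Icc 1 ⌊x/y⌋₊, |((Nat.primeCounting (⌊x⌋₊/k) - Nat.primeCounting ⌊y⌋₊ : ℕ) : ℝ)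
      - ∫ t in y..(x/k), (log t)⁻¹| ≤ 2 * C * x * E * (k:ℝ)⁻¹ := by
    intro k hk
    rw [Finset.mem_Icc] at hk
    have hk1 : (1:ℝ) ≤ k := by exact_mod_cast hk.1
    have hk2 : (k:ℝ) ≤ x / y := (Nat.le_floor_iff (by positivity)).1 hk.2
    have hk3 : y ≤ x / k := by
      rw [le_div_iff₀ hyp] at hk2
      rw [le_div_iff₀ (by linarith)]; linarith
    rw [← Nat.floor_div_natCast, Nat.cast_sub (Nat.monotone_primeCounting (Nat.floor_mono hk3))]
    have hb := H (x/k) (by linarith)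
    have e := intervalIntegral.integral_add_adjacent_intervals
      (int_inv_log le_rfl (show 2 ≤ y by linarith)) (int_inv_log (show 2 ≤ y by linarith) hk3)
    have c1 : C * (x/k * exp (-(1/16) * (log (x/k))^β)) ≤ C * (x/k*E) := by
      have := hu (x/k) (by linarith)
      gcongr
    have c2 : C * (y * exp (-(1/16) * (log y)^β)) ≤ C * (x/k*E) := by
      have := hu y hy
      gcongr
    have c3 : 2 * C * x * E * (k:ℝ)⁻¹ = C * (x/k*E) + C * (x/k*E) := by ring
    rw [c3]
    rw [abs_le] at hb hyli ⊢
    constructor <;> linarith [hb.1, hb.2, hyli.1, hyli.2]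
  rw [Nat.cast_sum, ← Finset.sum_sub_distrib]
  refine (Finset.abs_sum_le_sum_abs _ _).trans ((Finset.sum_le_sum hlast).trans ?_)
  rw [← Finset.mul_sum]
  have hh : ∑ k ∈ Finset.Icc 1 ⌊x/y⌋₊, (k:ℝ)⁻¹ ≤ 1 + log x := by
    have h1 := harmonic_floor_le_one_add_log (x/y) (by rw [one_le_div hyp]; exact hyx)
    rw [harmonic_eq_sum_Icc] at h1
    push_cast at h1
    have h2 : log (x/y) ≤ log x := log_le_log (by positivity) (div_le_self hxp.le (by linarith))
    linarith
  calc _ ≤ 2 * C * x * E * (1 + log x) := by gcongr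
    _ = _ := by ring

end VK

namespace VK

lemma med_core {x τ ℓ : ℝ} (hx : 4 ≤ x)
    (hcount : ∀ y : ℝ, √x ≤ y → y ≤ x → |((((Finset.Icc 1 ⌊x⌋₊).filter (fun n => ⌊y⌋₊ < largestPrimeFactor n)).card : ℕ) : ℝ)
      - ∑ k ∈ Finset.Icc 1 ⌊x/y⌋₊, ∫ t in y..(x/k), (log t)⁻¹| ≤ x * τ / 4)
    (hℓ : lif x = ℓ * x) (hℓ0 : 0 ≤ ℓ) (hℓ1 : ℓ ≤ 1/20) (hτ : 0 < τ) (hτ1 : τ ≤ 1/20)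
    (h1 : 1 < x * τ / 2) (h7 : 2 * x ^ (0.7:ℝ) ≤ x * τ / 4) :
    x ^ exp (-1/2 - ℓ - τ) ≤ medianLPF x ∧ (medianLPF x : ℝ) ≤ x ^ exp (-1/2 - ℓ + τ) := by
  have hxp : 0 < x := by linarith
  have hL : 0 < log x := log_pos (by linarith)
  have key : ∀ s : ℝ, -τ ≤ s → s ≤ τ → √x ≤ x ^ exp (-1/2 - ℓ + s) ∧ x ^ exp (-1/2 - ℓ + s) ≤ x
      ∧ |((((Finset.Icc 1 ⌊x⌋₊).filter (fun n => ⌊x ^ exp (-1/2 - ℓ + s)⌋₊ < largestPrimeFactor n)).card : ℕ) : ℝ)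
        - (x / 2 - s * x + x * τ / 8)| ≤ x * τ / 4 + x * τ / 8 := by
    intro s hs1 hs2
    set θ := exp (-1/2 - ℓ + s) with hθ
    have t1 : 1/2 ≤ θ := by
      have : exp (-log 2) ≤ θ := exp_le_exp.2 (by linarith [Real.log_two_gt_d9])
      rw [exp_neg, exp_log (by norm_num)] at this
      linarith
    have t2 : θ ≤ 0.7 := by
      have h2 : θ ≤ exp (-0.4) := exp_le_exp.2 (by linarith)
      have h3 := Real.quadratic_le_exp_of_nonneg (x := 0.4) (by norm_num)
      rw [exp_neg] at h2
      refine h2.trans ?_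
      rw [inv_le_comm₀ (exp_pos _) (by norm_num)]
      refine le_trans ?_ h3
      norm_num
    have a1 : √x ≤ x ^ θ := by
      rw [Real.sqrt_eq_rpow]; exact rpow_le_rpow_of_exponent_le (by linarith) t1
    have a2' : x ^ θ ≤ x ^ (0.7:ℝ) := rpow_le_rpow_of_exponent_le (by linarith) t2
    have a2 : x ^ θ ≤ x := by
      conv_rhs => rw [← rpow_one x]
      exact rpow_le_rpow_of_exponent_le (by linarith) (by linarith)
    refine ⟨a1, a2, ?_⟩
    have hsq : 2 ≤ √x := Real.le_sqrt_of_sq_le (by linarith)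
    obtain ⟨R, r1, r2, r3⟩ := J_eq (x := x) (y := x ^ θ) (by linarith) a2
    have hc := hcount _ a1 a2
    rw [r3, log_rpow hxp, log_mul (exp_pos _).ne' hL.ne', hθ, log_exp, hℓ] at hc
    rw [← hθ] at hc
    rw [abs_le] at hc ⊢
    constructor <;> linarith [hc.1, hc.2]
  have hN1 := Nat.floor_le hxp.le
  have hN2 := Nat.lt_floor_add_one x
  constructor
  · obtain ⟨-, -, k⟩ := key (-τ) le_rfl (by linarith)
    rw [← sub_eq_add_neg] at k
    set y := x ^ exp (-1/2 - ℓ - τ)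
    have hm : ⌊y⌋₊ < medianLPF x := by
      by_contra hcon
      have h2 := (med_count (by linarith) ⌊y⌋₊).1 (not_lt.1 hcon)
      have h3 : (2:ℝ) * (((Finset.Icc 1 ⌊x⌋₊).filter (fun n => ⌊y⌋₊ < largestPrimeFactor n)).card : ℕ) ≤ ⌊x⌋₊ := by
        exact_mod_cast h2
      rw [abs_le] at k
      linarith [k.1]
    have h4 : ((⌊y⌋₊ : ℕ) : ℝ) + 1 ≤ medianLPF x := by exact_mod_cast hm
    linarith [Nat.lt_floor_add_one y]
  · obtain ⟨-, -, k⟩ := key τ (by linarith) le_rfl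
    set y := x ^ exp (-1/2 - ℓ + τ)
    have hm : medianLPF x ≤ ⌊y⌋₊ := by
      by_contra hcon
      have h2 := (med_count (by linarith) ⌊y⌋₊).2 (not_le.1 hcon)
      have h3 : ((⌊x⌋₊ : ℕ) : ℝ) ≤ 2 * (((Finset.Icc 1 ⌊x⌋₊).filter (fun n => ⌊y⌋₊ < largestPrimeFactor n)).card : ℕ) := by
        exact_mod_cast h2
      rw [abs_le] at k
      linarith [k.2]
    have h4 : (medianLPF x : ℝ) ≤ ⌊y⌋₊ := by exact_mod_cast hm
    linarith [Nat.floor_le (show 0 ≤ y from rpow_nonneg hxp.le _)]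

lemma med_close {x ℓ τ M : ℝ} (hx : 4 ≤ x) (hℓ0 : 0 ≤ ℓ) (hτ : 0 < τ) (hτ1 : τ ≤ 1/20)
    (hLτ : 4 * log x * τ ≤ 1) (hM1 : x ^ exp (-1/2 - ℓ - τ) ≤ M) (hM2 : M ≤ x ^ exp (-1/2 - ℓ + τ)) :
    |M - x ^ exp (-1/2 - ℓ)| ≤ x ^ exp (-1/2:ℝ) * (4 * log x * τ) := by
  have hxp : 0 < x := by linarith
  have hL : 0 < log x := log_pos (by linarith)
  set θ := exp (-1/2 - ℓ) with hθ
  have t0 : 0 < θ := exp_pos _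
  have t1 : θ ≤ 1 := exp_le_one_iff.2 (by linarith)
  have hY0 : 0 < x ^ θ := rpow_pos_of_pos hxp _
  have hY : x ^ θ ≤ x ^ exp (-1/2:ℝ) :=
    rpow_le_rpow_of_exponent_le (by linarith) (exp_le_exp.2 (by linarith))
  have split : ∀ s : ℝ, x ^ exp (-1/2 - ℓ + s) = x ^ θ * exp (log x * θ * (exp s - 1)) := by
    intro s
    rw [exp_add (-1/2 - ℓ) s, ← hθ, rpow_def_of_pos hxp, rpow_def_of_pos hxp, ← exp_add (log x * θ)]
    congr 1; ring
  have hθL : log x * θ ≤ log x := mul_le_of_le_one_right hL.le t1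
  have hθL0 : 0 ≤ log x * θ := by positivity
  have up : M ≤ x ^ θ * (1 + 4 * log x * τ) := by
    refine hM2.trans ?_
    rw [split]
    apply mul_le_mul_of_nonneg_left _ hY0.le
    have e1 : exp τ - 1 ≤ 2 * τ := by
      have := Real.abs_exp_sub_one_le (x := τ) (by rw [abs_of_pos hτ]; linarith)
      rw [abs_of_pos hτ] at this
      exact (le_abs_self _).trans this
    have e2 : log x * θ * (exp τ - 1) ≤ 2 * log x * τ := by
      have h0 : 0 ≤ exp τ - 1 := by linarith [Real.add_one_le_exp τ]
      calc _ ≤ log x * (2 * τ) := mul_le_mul hθL e1 h0 hL.le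
        _ = _ := by ring
    have h3 : 0 ≤ 2 * log x * τ := by positivity
    have e3 := Real.abs_exp_sub_one_le (x := 2 * log x * τ) (by rw [abs_of_nonneg h3]; linarith)
    rw [abs_of_nonneg h3] at e3
    have e4 := (le_abs_self _).trans e3
    linarith [exp_le_exp.2 e2]
  have lo : x ^ θ * (1 - 4 * log x * τ) ≤ M := by
    refine le_trans ?_ hM1
    rw [sub_eq_add_neg (-1/2 - ℓ) τ, split]
    apply mul_le_mul_of_nonneg_left _ hY0.le
    have e1 := Real.add_one_le_exp (-τ)
    have e2 := Real.add_one_le_exp (log x * θ * (exp (-τ) - 1))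
    have e3 : log x * θ * (-τ) ≤ log x * θ * (exp (-τ) - 1) :=
      mul_le_mul_of_nonneg_left (by linarith) hθL0
    have e4 : log x * θ * τ ≤ log x * τ := mul_le_mul_of_nonneg_right hθL hτ.le
    have e5 : 0 ≤ log x * τ := by positivity
    linarith
  have fin : x ^ θ * (4 * log x * τ) ≤ x ^ exp (-1/2:ℝ) * (4 * log x * τ) :=
    mul_le_mul_of_nonneg_right hY (by positivity)
  rw [abs_le]
  constructor <;> linarith

lemma med_main {ε : ℝ} (hε : 0 < ε) (hε1 : ε ≤ 1/4) : ∀ᶠ x : ℝ in atTop,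
    |(medianLPF x : ℝ) - x ^ ((1 / √(exp 1)) * exp (-(lif x) / x))| ≤
      x ^ (1 / √(exp 1)) * exp (-(1/128) * (log x)^(3/5-ε)) := by
  obtain ⟨C, hC, x0, hx0, H⟩ := count_est hε hε1
  have hβ : 0 < 3/5 - ε := by linarith
  have T := Real.tendsto_log_atTop
  have v1 := T.eventually (ev_poly_exp (c := 1/64) (8*C) 1 hβ (by norm_num))
  have v2 := T.eventually (ev_poly_exp (c := 1/128) 4 1 hβ (by norm_num))
  have v3 := T.eventually (ev_poly_exp (c := 1/64) 20 0 hβ (by norm_num))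
  have v4 := T.eventually (ev_poly_exp (c := 1/5) 8 0 one_pos (by norm_num))
  filter_upwards [v1, v2, v3, v4, lif_small, T.eventually_ge_atTop 20, eventually_ge_atTop x0]
    with x w1 w2 w3 w4 hlif hL hx
  have hx4 : 4 ≤ x := hx0.le.trans hx
  have hxp : 0 < x := by linarith
  set L := log x with hLd
  set β := 3/5 - ε with hβd
  simp only [rpow_one, rpow_zero, mul_one] at w1 w2 w3 w4
  have hLβ : L ^ β ≤ L := by
    conv_rhs => rw [← rpow_one L]
    exact rpow_le_rpow_of_exponent_le (by linarith) (by linarith)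
  set τ := exp (-(1/64) * L^β) with hτd
  have hτ : 0 < τ := exp_pos _
  have hτ2 : τ * exp (1/64 * L^β) = 1 := by
    rw [hτd, ← exp_add]; simp
  have hτ1 : τ ≤ 1/20 := by
    have := mul_le_mul_of_nonneg_left w3 hτ.le
    rw [hτ2] at this; linarith
  have hLτ : 4 * L * τ ≤ exp (-(1/128) * L^β) := by
    calc 4 * L * τ ≤ exp (1/128 * L^β) * τ := mul_le_mul_of_nonneg_right w2 hτ.le
      _ = _ := by rw [hτd, ← exp_add]; congr 1; ring
  have hLτ1 : 4 * L * τ ≤ 1 := hLτ.trans (exp_le_one_iff.2 (by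
    have : 0 ≤ L^β := by positivity
    linarith))
  have hxe : x = exp L := (exp_log hxp).symm
  have h7 : 2 * x ^ (0.7:ℝ) ≤ x * τ / 4 := by
    have e1 : 8 * exp (0.7 * L) ≤ exp (1/5 * L) * exp (0.7 * L) :=
      mul_le_mul_of_nonneg_right w4 (exp_pos _).le
    rw [← exp_add] at e1
    have e2 : exp (1/5 * L + 0.7 * L) ≤ x * τ := by
      rw [hxe, hτd, ← exp_add]; apply exp_le_exp.2; linarith
    rw [rpow_def_of_pos hxp, ← hLd, mul_comm L]
    linarith
  have h1 : 1 < x * τ / 2 := by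
    have : 1 ≤ x ^ (0.7:ℝ) := one_le_rpow (by linarith) (by norm_num)
    linarith
  have hcore := med_core (x := x) (τ := τ) (ℓ := lif x / x) hx4 ?_
    (by field_simp) (div_nonneg (lif_nonneg (by linarith)) hxp.le) hlif hτ hτ1 h1 h7
  · have hcl := med_close hx4 (div_nonneg (lif_nonneg (by linarith)) hxp.le) hτ hτ1 hLτ1 hcore.1 hcore.2
    have hs : 1 / √(exp 1) = exp (-1/2:ℝ) := by
      rw [← exp_half, one_div, ← exp_neg]; congr 1; ring
    have hs2 : 1 / √(exp 1) * exp (-(lif x)/x) = exp (-1/2 - lif x / x) := by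
      rw [hs, ← exp_add]; congr 1; ring
    rw [hs2, hs]
    refine hcl.trans (mul_le_mul_of_nonneg_left hLτ (rpow_nonneg hxp.le _))
  · intro y hy hyx
    refine (H x hx y hy hyx).trans ?_
    have e1 : exp (-(1/32) * L^β) = τ * τ := by rw [hτd, ← exp_add]; congr 1; ring
    rw [e1]
    have e2 : 4 * C * (1 + L) * τ ≤ 1 := by
      rw [← hτ2, mul_comm τ]
      refine mul_le_mul_of_nonneg_right (le_trans ?_ w1) hτ.le
      nlinarith
    have e3 := mul_le_mul_of_nonneg_left e2 (show 0 ≤ x * τ / 4 by positivity)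
    linarith

end VK

theorem median_largest_prime_factor_precise :
    ∀ ε > (0:ℝ), ∃ c > (0:ℝ), ∃ C > (0:ℝ), ∀ᶠ x : ℝ in atTop,
      |(medianLPF x : ℝ) -
          x ^ ((1 / Real.sqrt (Real.exp 1)) * Real.exp (-(lif x) / x))| ≤
        C * x ^ (1 / Real.sqrt (Real.exp 1)) *
          Real.exp (-c * (Real.log x) ^ ((3:ℝ)/5 - ε)) := by
  intro ε hε
  refine ⟨1/128, by norm_num, 1, one_pos, ?_⟩
  filter_upwards [VK.med_main (ε := min ε (1/4)) (lt_min hε (by norm_num)) (min_le_right _ _),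
    Real.tendsto_log_atTop.eventually_ge_atTop 1, eventually_gt_atTop 0] with x h hL hx
  refine h.trans ?_
  rw [one_mul]
  apply mul_le_mul_of_nonneg_left _ (rpow_nonneg hx.le _)
  apply exp_le_exp.2
  have : (log x)^((3:ℝ)/5 - ε) ≤ (log x)^((3:ℝ)/5 - min ε (1/4)) :=
    rpow_le_rpow_of_exponent_le hL (by linarith [min_le_left ε (1/4)])
  linarith
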